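/- arXiv:2109.13485 — 5 statements merged into one kernel-verified Lean document; each statement's English description precedes it below -/
import Mathlib

section
/- Let (a_n)_{n≥0} be a sequence of real numbers such that both infinite Hankel matrices H_0 = (a_{i+j})_{i,j≥0} and H_1 = (a_{i+j+1})_{i,j≥0} are positive semidefinite, i.e. for every m ≥ 1 and every vector c = (c_0,…,c_{m−1}) of real numbers, ∑_{i,j=0}^{m−1} c_i c_j a_{i+j} ≥ 0 and ∑_{i,j=0}^{m−1} c_i c_j a_{i+j+1} ≥ 0. Then (a_n) is a Stieltjes moment sequence: there exists a Borel measure ρ on ℝ supported on [0,∞), with finite moments of all orders, such that a_n = ∫ x^n dρ(x) for all n ≥ 0. -/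
open MeasureTheory

namespace StieltjesMoment

open Polynomial Filter Topology CompactlySupported
open scoped NNReal ENNReal

/-- The polynomials of the form `A + X * B` with `A` and `B` sums of squares. -/
def IsHalfLineCertified (p : ℝ[X]) : Prop :=
  ∃ A B : ℝ[X], IsSumSq A ∧ IsSumSq B ∧ p = A + X * B

lemma IsHalfLineCertified.mul {p q : ℝ[X]} (hp : IsHalfLineCertified p)
    (hq : IsHalfLineCertified q) : IsHalfLineCertified (p * q) := by
  obtain ⟨A, B, hA, hB, rfl⟩ := hp
  obtain ⟨C, D, hC, hD, rfl⟩ := hq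
  exact ⟨A * C + X * X * (B * D), A * D + B * C,
    (hA.mul hC).add ((IsSumSq.mul_self X).mul (hB.mul hD)), (hA.mul hD).add (hB.mul hC), by ring⟩

lemma _root_.IsSumSq.isHalfLineCertified {p : ℝ[X]} (hp : IsSumSq p) : IsHalfLineCertified p :=
  ⟨p, 0, hp, .zero, by simp⟩

lemma isSumSq_C {r : ℝ} (hr : 0 ≤ r) : IsSumSq (C r) := by
  rw [← Real.mul_self_sqrt hr, C_mul]
  exact .mul_self _

lemma isHalfLineCertified_X_sub_C {r : ℝ} (hr : r ≤ 0) : IsHalfLineCertified (X - C r) :=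
  ⟨C (-r), 1, isSumSq_C (by linarith), by simp, by
    rw [C_neg]; ring⟩

lemma isSumSq_quadratic (z : ℂ) : IsSumSq (X ^ 2 - C (2 * z.re) * X + C (‖z‖ ^ 2)) := by
  have h : X ^ 2 - C (2 * z.re) * X + C (‖z‖ ^ 2) =
      (X - C z.re) * (X - C z.re) + C z.im * C z.im := by
    rw [← Complex.normSq_eq_norm_sq, Complex.normSq_apply]
    simp only [C_mul, C_add, map_ofNat]
    ring
  rw [h]
  exact (IsSumSq.mul_self _).add (.mul_self _)

lemma eval_nonneg_of_forall_gt {q : ℝ[X]} {x : ℝ} (h : ∀ y, x < y → 0 ≤ q.eval y) :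
    0 ≤ q.eval x := by
  have hcl : IsClosed {y : ℝ | 0 ≤ q.eval y} := isClosed_le continuous_const q.continuous
  have hsub := hcl.closure_subset_iff.2 (show Set.Ioi x ⊆ {y : ℝ | 0 ≤ q.eval y} from h)
  rw [closure_Ioi] at hsub
  exact hsub Set.self_mem_Ici

/-- If `(x - r) q(x) ≥ 0` for all `x ≥ 0` and `r > 0`, then `q r = 0`. -/
lemma isRoot_of_pos_root {q : ℝ[X]} {r : ℝ} (hr : 0 < r)
    (h : ∀ x, 0 ≤ x → 0 ≤ (x - r) * q.eval x) : q.IsRoot r := by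
  have hmin : IsLocalMin (fun x => ((X - C r) * q).eval x) r := by
    filter_upwards [lt_mem_nhds hr] with x hx
    simpa using h x hx.le
  have := hmin.deriv_eq_zero
  rw [Polynomial.deriv] at this
  simpa [derivative_mul] using this

/-- A real polynomial which is nonnegative on `[0, ∞)` has the form `A + X * B` with `A` and `B`
sums of squares. -/
theorem isHalfLineCertified_of_nonneg (p : ℝ[X]) (hp : ∀ x, 0 ≤ x → 0 ≤ p.eval x) :
    IsHalfLineCertified p := by
  induction hn : p.natDegree using Nat.strong_induction_on generalizing p with
  | _ n ih =>
    subst hn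
    by_cases hdeg : p.natDegree = 0
    · obtain ⟨c, rfl⟩ := natDegree_eq_zero.1 hdeg
      exact (isSumSq_C (by simpa using hp 0 le_rfl)).isHalfLineCertified
    have hp0 : p ≠ 0 := by rintro rfl; simp at hdeg
    have key : ∀ d q : ℝ[X], p = d * q → 0 < d.natDegree → IsHalfLineCertified d →
        (∀ x, 0 ≤ x → 0 ≤ q.eval x) → IsHalfLineCertified p := by
      rintro d q rfl hd hcd hq
      refine hcd.mul (ih _ ?_ q hq rfl)
      rw [natDegree_mul (left_ne_zero_of_mul hp0) (right_ne_zero_of_mul hp0)]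
      omega
    obtain ⟨z, hz⟩ := IsAlgClosed.exists_aeval_eq_zero ℂ p
      (fun h => hdeg (natDegree_eq_zero_iff_degree_le_zero.2 h.le))
    by_cases him : z.im = 0
    · have hroot : p.IsRoot z.re := by
        have hzr : z = algebraMap ℝ ℂ z.re := Complex.ext rfl (by simpa using him)
        rw [hzr, aeval_algebraMap_apply] at hz
        simpa using hz
      generalize z.re = r at hroot
      obtain ⟨q, hq⟩ := dvd_iff_isRoot.2 hroot
      have hmul : ∀ x, 0 ≤ x → 0 ≤ (x - r) * q.eval x := fun x hx => by
        simpa [hq] using hp x hx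
      rcases le_or_gt r 0 with hr | hr
      · exact key _ q hq (by simp) (isHalfLineCertified_X_sub_C hr)
          fun x hx => eval_nonneg_of_forall_gt fun y hy =>
            nonneg_of_mul_nonneg_right (hmul y (hx.trans hy.le)) (by linarith)
      · obtain ⟨s, rfl⟩ := dvd_iff_isRoot.2 (isRoot_of_pos_root hr hmul)
        refine key ((X - C r) * (X - C r)) s (by rw [hq, mul_assoc]) ?_
          (IsSumSq.mul_self _).isHalfLineCertified ?_
        · rw [natDegree_mul (X_sub_C_ne_zero r) (X_sub_C_ne_zero r)]
          simp
        · have hs : ∀ x, 0 ≤ x → x ≠ r → 0 ≤ s.eval x := fun x hx hxr => by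
            have h := hmul x hx
            rw [eval_mul, eval_sub, eval_X, eval_C, ← mul_assoc] at h
            exact nonneg_of_mul_nonneg_right h (mul_self_pos.2 (sub_ne_zero.2 hxr))
          intro x hx
          rcases eq_or_ne x r with rfl | hxr
          · exact eval_nonneg_of_forall_gt fun y hy => hs y (hx.trans hy.le) hy.ne'
          · exact hs x hx hxr
    · obtain ⟨q, hq⟩ := p.quadratic_dvd_of_aeval_eq_zero_im_ne_zero hz him
      refine key _ q hq ?_ (isSumSq_quadratic z).isHalfLineCertified fun x hx => ?_
      · have : (X ^ 2 - C (2 * z.re) * X + C (‖z‖ ^ 2) : ℝ[X]).natDegree = 2 := by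
          compute_degree!
        omega
      · have h := hp x hx
        rw [hq, eval_mul] at h
        refine nonneg_of_mul_nonneg_right h ?_
        have hz2 : ‖z‖ ^ 2 = z.re * z.re + z.im * z.im := by
          rw [← Complex.normSq_eq_norm_sq, Complex.normSq_apply]
        simp only [eval_add, eval_sub, eval_pow, eval_X, eval_mul, eval_C, hz2]
        nlinarith [sq_nonneg (x - z.re), mul_self_pos.2 him]

/-- The linear functional on polynomials sending `X ^ n` to `a n`. -/
noncomputable def momentFunctional (a : ℕ → ℝ) : ℝ[X] →ₗ[ℝ] ℝ :=
  lsum fun n => a n • LinearMap.id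

lemma momentFunctional_C_mul_X_pow (a : ℕ → ℝ) (r : ℝ) (n : ℕ) :
    momentFunctional a (C r * X ^ n) = r * a n := by
  rw [momentFunctional, lsum_apply, C_mul_X_pow_eq_monomial,
    sum_monomial_index _ _ (LinearMap.map_zero _)]
  simp [mul_comm]

lemma momentFunctional_X_pow (a : ℕ → ℝ) (n : ℕ) : momentFunctional a (X ^ n) = a n := by
  simpa using momentFunctional_C_mul_X_pow a 1 n

lemma momentFunctional_X_pow_mul_mul_self (a : ℕ → ℝ) (k : ℕ) (q : ℝ[X]) :
    momentFunctional a (X ^ k * (q * q)) =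
      ∑ i : Fin (q.natDegree + 1), ∑ j : Fin (q.natDegree + 1),
        q.coeff i * q.coeff j * a (i + j + k) := by
  have h : X ^ k * (q * q) = ∑ i : Fin (q.natDegree + 1), ∑ j : Fin (q.natDegree + 1),
      C (q.coeff i * q.coeff j) * X ^ ((i : ℕ) + j + k) := by
    conv_lhs => rw [q.as_sum_range_C_mul_X_pow, ← Fin.sum_univ_eq_sum_range
      (fun i => C (q.coeff i) * X ^ i), Finset.sum_mul_sum, Finset.mul_sum]
    refine Finset.sum_congr rfl fun i _ => ?_
    rw [Finset.mul_sum]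
    refine Finset.sum_congr rfl fun j _ => ?_
    rw [C_mul]
    ring
  rw [h]
  simp only [map_sum, momentFunctional_C_mul_X_pow]

lemma momentFunctional_X_pow_mul_nonneg {a : ℕ → ℝ} {k : ℕ}
    (h : ∀ m : ℕ, 1 ≤ m → ∀ c : Fin m → ℝ,
      0 ≤ ∑ i : Fin m, ∑ j : Fin m, c i * c j * a ((i : ℕ) + (j : ℕ) + k))
    {p : ℝ[X]} (hp : IsSumSq p) : 0 ≤ momentFunctional a (X ^ k * p) := by
  induction hp with
  | zero => simp
  | sq_add q _ ih =>
    rw [mul_add, map_add, momentFunctional_X_pow_mul_mul_self]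
    exact add_nonneg (h _ (by omega) _) ih

/-- A linear functional on real polynomials which is nonnegative on those that are nonnegative on
`[0, ∞)` extends to a positive functional on compactly supported perturbations of polynomials. -/
theorem exists_extension (L : ℝ[X] →ₗ[ℝ] ℝ)
    (hL : ∀ p : ℝ[X], (∀ x, 0 ≤ x → 0 ≤ p.eval x) → 0 ≤ L p) :
    ∃ G : C_c(ℝ≥0, ℝ) × ℝ[X] →ₗ[ℝ] ℝ, (∀ p, G (0, p) = L p) ∧
      ∀ g p, (∀ x : ℝ≥0, 0 ≤ g x + p.eval (x : ℝ)) → 0 ≤ G (g, p) := by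
  let s : PointedCone ℝ (C_c(ℝ≥0, ℝ) × ℝ[X]) :=
    { carrier := {y | ∀ x : ℝ≥0, 0 ≤ y.1 x + y.2.eval (x : ℝ)}
      add_mem' := fun {y z} hy hz x => by
        have := add_nonneg (hy x) (hz x)
        simp only [Prod.fst_add, Prod.snd_add, CompactlySupportedContinuousMap.coe_add,
          Pi.add_apply, eval_add]
        linarith
      zero_mem' := fun x => by simp
      smul_mem' := fun c y hy x => by
        have := mul_nonneg c.2 (hy x)
        change 0 ≤ (c : ℝ) * y.1 x + ((c : ℝ) • y.2).eval (x : ℝ)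
        rw [eval_smul, smul_eq_mul]
        linarith }
  let f : (C_c(ℝ≥0, ℝ) × ℝ[X]) →ₗ.[ℝ] ℝ :=
    ⟨LinearMap.range (LinearMap.inr ℝ C_c(ℝ≥0, ℝ) ℝ[X]),
      L ∘ₗ LinearMap.snd ℝ _ _ ∘ₗ Submodule.subtype _⟩
  have nonneg : ∀ x : f.domain, (x : C_c(ℝ≥0, ℝ) × ℝ[X]) ∈ s → 0 ≤ f x := by
    rintro ⟨_, p, rfl⟩ hx
    refine hL p fun x hx0 => ?_
    have h : 0 ≤ 0 + p.eval x := hx ⟨x, hx0⟩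
    rwa [zero_add] at h
  have dense : ∀ y, ∃ x : f.domain, (x : C_c(ℝ≥0, ℝ) × ℝ[X]) + y ∈ s := by
    rintro ⟨g, p⟩
    obtain ⟨M, hM⟩ := g.hasCompactSupport.exists_bound_of_continuous g.continuous
    refine ⟨⟨(0, C M - p), _, rfl⟩, fun x => ?_⟩
    have := (abs_le.1 (hM x)).1
    change 0 ≤ (0 + g) x + (C M - p + p).eval (x : ℝ)
    simp only [zero_add, sub_add_cancel, eval_C]
    linarith
  obtain ⟨G, hG, hGs⟩ := riesz_extension s f nonneg dense
  exact ⟨G, fun p => hG ⟨(0, p), p, rfl⟩, fun g p h => hGs (g, p) h⟩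

/-- The product of `x ^ n` with a continuous cutoff equal to `1` on `[0, k]` and to `0` on
`[k + 1, ∞)`. -/
noncomputable def truncPow (n k : ℕ) : C_c(ℝ≥0, ℝ) where
  toFun x := ((x ^ n * min 1 (k + 1 - x) : ℝ≥0) : ℝ)
  continuous_toFun := by fun_prop
  hasCompactSupport' := HasCompactSupport.intro (isCompact_Icc (a := 0) (b := (k + 1 : ℝ≥0)))
    fun x hx => by
      have : (k + 1 : ℝ≥0) ≤ x := by
        by_contra! h
        exact hx ⟨zero_le, h.le⟩
      simp [tsub_eq_zero_of_le this]

lemma truncPow_apply (n k : ℕ) (x : ℝ≥0) :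
    truncPow n k x = ((x ^ n * min 1 (k + 1 - x) : ℝ≥0) : ℝ) := rfl

lemma truncPow_eq_of_le {n k : ℕ} {x : ℝ≥0} (h : x ≤ k) : truncPow n k x = (x : ℝ) ^ n := by
  have : (1 : ℝ≥0) ≤ k + 1 - x := le_tsub_of_add_le_left (add_le_add_left h 1)
  simp [truncPow_apply, min_eq_left this]

lemma truncPow_nonneg (n k : ℕ) (x : ℝ≥0) : 0 ≤ truncPow n k x := NNReal.coe_nonneg _

lemma truncPow_le (n k : ℕ) (x : ℝ≥0) : truncPow n k x ≤ (x : ℝ) ^ n := by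
  rw [truncPow_apply, ← NNReal.coe_pow, NNReal.coe_le_coe]
  exact mul_le_of_le_one_right zero_le (min_le_left _ _)

lemma mul_pow_sub_truncPow_le (n k : ℕ) (x : ℝ≥0) :
    (k : ℝ) * ((x : ℝ) ^ n - truncPow n k x) ≤ (x : ℝ) ^ (n + 1) := by
  rcases le_total x k with h | h
  · rw [truncPow_eq_of_le h, sub_self, mul_zero]
    positivity
  · have h' : (k : ℝ) ≤ x := by exact_mod_cast h
    calc (k : ℝ) * ((x : ℝ) ^ n - truncPow n k x) ≤ k * (x : ℝ) ^ n := by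
          gcongr
          linarith [truncPow_nonneg n k x]
      _ ≤ x * (x : ℝ) ^ n := by gcongr
      _ = (x : ℝ) ^ (n + 1) := by ring

lemma monotone_truncPow (n : ℕ) (x : ℝ≥0) : Monotone fun k => truncPow n k x := by
  intro k l hkl
  simp only [truncPow_apply, NNReal.coe_le_coe]
  gcongr

lemma tendsto_truncPow (n : ℕ) (x : ℝ≥0) :
    Tendsto (fun k => truncPow n k x) atTop (𝓝 ((x : ℝ) ^ n)) := by
  obtain ⟨K, hK⟩ := exists_nat_ge x
  refine tendsto_const_nhds.congr' ?_
  filter_upwards [eventually_ge_atTop K] with k hk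
  exact (truncPow_eq_of_le (hK.trans (by exact_mod_cast hk))).symm

/-- A measure on `[0, ∞)` whose truncated `n`-th moments converge to `r` has `n`-th moment `r`. -/
lemma integrable_pow_and_integral_eq {μ : Measure ℝ≥0} [IsFiniteMeasureOnCompacts μ] {n : ℕ}
    {r : ℝ} (h : Tendsto (fun k => ∫ x, truncPow n k x ∂μ) atTop (𝓝 r)) :
    Integrable (fun x : ℝ≥0 => (x : ℝ) ^ n) μ ∧ ∫ x : ℝ≥0, (x : ℝ) ^ n ∂μ = r := by
  have hr : 0 ≤ r := ge_of_tendsto' h fun k => integral_nonneg (truncPow_nonneg n k)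
  have h1 := lintegral_tendsto_of_tendsto_of_monotone (μ := μ)
    (f := fun k x => ENNReal.ofReal (truncPow n k x))
    (F := fun x => ENNReal.ofReal ((x : ℝ) ^ n))
    (fun k => ((truncPow n k).continuous.measurable.ennreal_ofReal).aemeasurable)
    (.of_forall fun x k l hkl => ENNReal.ofReal_le_ofReal (monotone_truncPow n x hkl))
    (.of_forall fun x => ENNReal.tendsto_ofReal (tendsto_truncPow n x))
  have h2 : ∀ k, ∫⁻ x, ENNReal.ofReal (truncPow n k x) ∂μ =
      ENNReal.ofReal (∫ x, truncPow n k x ∂μ) := fun k =>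
    (ofReal_integral_eq_lintegral_ofReal (truncPow n k).integrable
      (.of_forall (truncPow_nonneg n k))).symm
  simp only [h2] at h1
  have h3 := tendsto_nhds_unique h1 (ENNReal.tendsto_ofReal h)
  have hmeas : AEStronglyMeasurable (fun x : ℝ≥0 => (x : ℝ) ^ n) μ :=
    (by fun_prop : Continuous fun x : ℝ≥0 => (x : ℝ) ^ n).aestronglyMeasurable
  have hpos : 0 ≤ᵐ[μ] fun x : ℝ≥0 => (x : ℝ) ^ n := .of_forall fun x => by positivity
  refine ⟨⟨hmeas, ?_⟩, ?_⟩
  · rw [hasFiniteIntegral_iff_ofReal hpos, h3]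
    exact ENNReal.ofReal_lt_top
  · rw [integral_eq_lintegral_of_nonneg_ae hpos hmeas, h3, ENNReal.toReal_ofReal hr]

/-- **Haviland's theorem** on the half-line: a linear functional on real polynomials which is
nonnegative on those that are nonnegative on `[0, ∞)` is integration against a measure. -/
theorem exists_measure_of_nonneg (L : ℝ[X] →ₗ[ℝ] ℝ)
    (hL : ∀ p : ℝ[X], (∀ x, 0 ≤ x → 0 ≤ p.eval x) → 0 ≤ L p) :
    ∃ μ : Measure ℝ≥0, ∀ n : ℕ, Integrable (fun x : ℝ≥0 => (x : ℝ) ^ n) μ ∧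
      ∫ x : ℝ≥0, (x : ℝ) ^ n ∂μ = L (X ^ n) := by
  obtain ⟨G, hGL, hG⟩ := exists_extension L hL
  let Λ : C_c(ℝ≥0, ℝ) →ₚ[ℝ] ℝ := .mk₀ (G ∘ₗ LinearMap.inl ℝ _ _) fun g hg =>
    hG g 0 fun x => by simpa using hg x
  have hΛ : ∀ g, Λ g = G (g, 0) := fun g => rfl
  refine ⟨RealRMK.rieszMeasure Λ, fun n => integrable_pow_and_integral_eq ?_⟩
  have hsplit : ∀ g p, G (g, p) = G (g, 0) + L p := fun g p => by
    rw [← hGL p, ← map_add]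
    simp
  simp only [RealRMK.integral_rieszMeasure, hΛ]
  have hupper : ∀ k, G (truncPow n k, 0) ≤ L (X ^ n) := fun k => by
    have h := hG (-truncPow n k) (X ^ n) fun x => by
      simpa using truncPow_le n k x
    have hneg : G (-truncPow n k, 0) = -G (truncPow n k, 0) := by
      rw [← map_neg]
      simp
    rw [hsplit, hneg] at h
    linarith
  have hlower : ∀ k : ℕ, L (X ^ n) - L (X ^ (n + 1)) / ((k : ℝ) + 1) ≤
      G (truncPow n (k + 1), 0) := fun k => by
    have h := hG (((k : ℝ) + 1) • truncPow n (k + 1))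
        (X ^ (n + 1) - ((k : ℝ) + 1) • X ^ n) fun x => by
      have := mul_pow_sub_truncPow_le n (k + 1) x
      push_cast at this
      simp only [CompactlySupportedContinuousMap.coe_smul, Pi.smul_apply, smul_eq_mul, eval_sub,
        eval_pow, eval_X, eval_smul]
      linarith
    have hsmul : G (((k : ℝ) + 1) • truncPow n (k + 1), 0) =
        ((k : ℝ) + 1) * G (truncPow n (k + 1), 0) := by
      rw [← smul_eq_mul, ← map_smul]
      simp
    rw [hsplit, hsmul, map_sub, map_smul, smul_eq_mul] at h
    rw [sub_le_iff_le_add, ← sub_le_iff_le_add', le_div_iff₀ (by positivity)]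
    linarith
  rw [← tendsto_add_atTop_iff_nat 1]
  refine tendsto_of_tendsto_of_tendsto_of_le_of_le ?_ tendsto_const_nhds hlower
    fun k => hupper (k + 1)
  have := (tendsto_one_div_add_atTop_nhds_zero_nat (𝕜 := ℝ)).const_mul (L (X ^ (n + 1)))
  simpa [div_eq_mul_inv] using this.const_sub (L (X ^ n))

end StieltjesMoment

open StieltjesMoment

/-- If both infinite Hankel matrices `H₀ = (a_{i+j})` and `H₁ = (a_{i+j+1})` of a real
sequence are positive semidefinite, then the sequence is a Stieltjes moment sequence:
it is represented by a Borel measure on `[0, ∞)` with finite moments of all orders. -/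
theorem stmt_1 (a : ℕ → ℝ)
    (h0 : ∀ m : ℕ, 1 ≤ m → ∀ c : Fin m → ℝ,
      0 ≤ ∑ i : Fin m, ∑ j : Fin m, c i * c j * a ((i : ℕ) + (j : ℕ)))
    (h1 : ∀ m : ℕ, 1 ≤ m → ∀ c : Fin m → ℝ,
      0 ≤ ∑ i : Fin m, ∑ j : Fin m, c i * c j * a ((i : ℕ) + (j : ℕ) + 1)) :
    ∃ ρ : Measure ℝ, ρ (Set.Iio 0) = 0 ∧
      (∀ n : ℕ, Integrable (fun x : ℝ => x ^ n) ρ) ∧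
      ∀ n : ℕ, a n = ∫ x, x ^ n ∂ρ := by
  obtain ⟨μ, hμ⟩ := exists_measure_of_nonneg (momentFunctional a) fun p hp => by
    obtain ⟨A, B, hA, hB, rfl⟩ := isHalfLineCertified_of_nonneg p hp
    rw [map_add]
    exact add_nonneg (by simpa using momentFunctional_X_pow_mul_nonneg (k := 0) h0 hA)
      (by simpa using momentFunctional_X_pow_mul_nonneg (k := 1) h1 hB)
  refine ⟨μ.map ((↑) : NNReal → ℝ), ?_, fun n => ?_, fun n => ?_⟩
  · rw [Measure.map_apply measurable_coe_nnreal_real measurableSet_Iio]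
    convert measure_empty (μ := μ)
    ext x
    simp
  · exact (integrable_map_measure (by fun_prop) measurable_coe_nnreal_real.aemeasurable).2 (hμ n).1
  · rw [integral_map measurable_coe_nnreal_real.aemeasurable (by fun_prop)]
    exact ((hμ n).2.trans (momentFunctional_X_pow a n)).symm
end

section
/- Let (a_n)_{n≥0} be a sequence of real numbers. Then (a_n) is a Stieltjes moment sequence (there exists a Borel measure ρ on ℝ supported on [0,∞), with finite moments, such that a_n = ∫ x^n dρ(x) for all n ≥ 0) if and only if the infinite Hankel matrix H_0 = (a_{i+j})_{i,j≥0} is totally positive, meaning that for every m ≥ 1 and all strictly increasing tuples of indices r_1 < ⋯ < r_m and s_1 < ⋯ < s_m of natural numbers, the determinant of the m×m matrix (a_{r_i + s_j})_{1≤i,j≤m} is nonnegative. -/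
open MeasureTheory

/-- A real symmetric matrix whose principal minors are all nonnegative is positive semidefinite. -/
theorem Matrix.IsHermitian.posSemidef_of_principal_minors_nonneg {n : Type*} [Fintype n]
    [DecidableEq n] {M : Matrix n n ℝ} (hM : M.IsHermitian)
    (h : ∀ s : Finset n, 0 ≤ (M.submatrix (Subtype.val : s → n) Subtype.val).det) :
    M.PosSemidef := by
  rw [hM.posSemidef_iff_eigenvalues_nonneg]
  intro i
  by_contra! hneg
  simp only [Pi.zero_apply] at hneg
  set l := hM.eigenvalues i
  set t : ℝ := -l⁻¹
  have ht : 0 < t := by simpa [t] using hneg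
  set P : Polynomial ℝ := (1 + (Polynomial.X : Polynomial ℝ) • M.map Polynomial.C).det
  have hcoeff : ∀ k, 0 ≤ P.coeff k := fun k => by
    rw [Matrix.coeff_det_one_add_X_smul_eq_sum_minors]
    exact Finset.sum_nonneg fun s _ => h s
  have h0 : P.coeff 0 = 1 := by
    rw [Matrix.coeff_det_one_add_X_smul_eq_sum_minors]
    simp
  have hpos : 0 < P.eval t := by
    rw [Polynomial.eval_eq_sum_range]
    refine Finset.sum_pos' (fun k _ => mul_nonneg (hcoeff k) (pow_nonneg ht.le k)) ⟨0, by simp, ?_⟩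
    simp [h0]
  have heval : P.eval t = (1 + t • M).det := by
    simp only [P]
    rw [← Polynomial.coe_evalRingHom, RingHom.map_det]
    congr 1
    ext a b
    simp [Matrix.one_apply, apply_ite, mul_comm t]
  rw [heval] at hpos
  refine hpos.ne' (Matrix.exists_mulVec_eq_zero_iff.mp
    ⟨(hM.eigenvectorBasis i).ofLp, ?_, ?_⟩)
  · intro h0
    apply (hM.eigenvectorBasis.orthonormal.ne_zero i)
    ext j
    simpa using congrFun h0 j
  · have := hM.mulVec_eigenvectorBasis i
    rw [Matrix.add_mulVec, Matrix.one_mulVec, Matrix.smul_mulVec, this, smul_smul]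
    have : t * l = -1 := by simp [t, hneg.ne]
    change _ + (t * l) • _ = _
    rw [this]; simp

/-- The linear functional on real polynomials sending `X ^ n` to `a n`. -/
noncomputable def momentFunctional (a : ℕ → ℝ) : Polynomial ℝ →ₗ[ℝ] ℝ :=
  Polynomial.lsum fun n => a n • LinearMap.id

theorem momentFunctional_monomial (a : ℕ → ℝ) (n : ℕ) (c : ℝ) :
    momentFunctional a (Polynomial.monomial n c) = a n * c := by
  simp [momentFunctional]

/-- If all minors of the Hankel matrix of `a` are nonnegative, the moment functional is nonnegative
on `X ^ k * q²`. -/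
theorem momentFunctional_X_pow_mul_sq_nonneg {a : ℕ → ℝ}
    (h : ∀ m : ℕ, 1 ≤ m → ∀ r s : Fin m → ℕ, StrictMono r → StrictMono s →
        0 ≤ (Matrix.of fun i j : Fin m => a (r i + s j)).det) (k : ℕ) (q : Polynomial ℝ) :
    0 ≤ momentFunctional a (Polynomial.X ^ k * (q * q)) := by
  set N := q.natDegree + 1
  set H : Matrix (Fin N) (Fin N) ℝ := Matrix.of fun i j => a (i + (j + k))
  have hH : H.PosSemidef := by
    refine Matrix.IsHermitian.posSemidef_of_principal_minors_nonneg ?_ fun s => ?_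
    · ext i j
      simp only [H, Matrix.conjTranspose_apply, Matrix.of_apply, star_trivial]
      congr 1; ring
    · obtain hs | hs := Nat.eq_zero_or_pos s.card
      · have : IsEmpty s := by simpa using hs
        simp
      · have := h s.card hs (fun i => (s.orderEmbOfFin rfl i : ℕ))
          (fun i => (s.orderEmbOfFin rfl i : ℕ) + k)
          (fun i j hij => by simpa using hij) (fun i j hij => by simpa using hij)
        rw [← Matrix.det_submatrix_equiv_self (s.orderIsoOfFin rfl).toEquiv]
        exact this
  have hq := hH.dotProduct_mulVec_nonneg fun i => q.coeff i
  refine hq.trans_eq (Eq.symm ?_)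
  have hqs : q = ∑ i : Fin N, Polynomial.monomial i (q.coeff i) := by
    conv_lhs => rw [q.as_sum_range]
    exact Finset.sum_range _
  conv_lhs => rw [hqs]
  rw [Finset.sum_mul_sum]
  simp only [Finset.mul_sum, map_sum, Polynomial.X_pow_mul_monomial,
    Polynomial.monomial_mul_monomial, momentFunctional_monomial, dotProduct, Matrix.mulVec,
    H, Matrix.of_apply]
  refine Finset.sum_congr rfl fun i _ => Finset.sum_congr rfl fun j _ => ?_
  simp only [star_trivial, Pi.star_apply, add_assoc]
  ring

/-- If `u * q` is nonnegative on `[0, ∞)` and `u` is positive on `(0, ∞)` except possibly at one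
point, then `q` is nonnegative on `[0, ∞)`. -/
theorem Polynomial.eval_nonneg_of_mul_eval_nonneg {u q : Polynomial ℝ} {x₀ : ℝ}
    (hu : ∀ x, 0 < x → x ≠ x₀ → 0 < u.eval x) (h : ∀ x, 0 ≤ x → 0 ≤ (u * q).eval x) {x : ℝ}
    (hx : 0 ≤ x) : 0 ≤ q.eval x := by
  refine ge_of_tendsto (q.continuous.continuousWithinAt (s := Set.Ioi x) (x := x)) ?_
  have hne : ∀ᶠ y in nhdsWithin x (Set.Ioi x), y ≠ x₀ := by
    obtain rfl | hne := eq_or_ne x x₀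
    · filter_upwards [self_mem_nhdsWithin] with y hy using ne_of_gt hy
    · exact (eventually_ne_nhds hne).filter_mono nhdsWithin_le_nhds
  filter_upwards [hne, self_mem_nhdsWithin] with y hy hxy
  have hy0 : 0 < y := hx.trans_lt hxy
  have := h y hy0.le
  rw [Polynomial.eval_mul] at this
  exact nonneg_of_mul_nonneg_right this (hu y hy0 hy)

open Polynomial in
/-- A functional on real polynomials that is nonnegative on `q²` and `X q²` is nonnegative on all
polynomials that are nonnegative on `[0, ∞)`. -/
theorem nonneg_of_nonneg_on_squares (L : ℝ[X] →ₗ[ℝ] ℝ) (h0 : ∀ q, 0 ≤ L (q * q))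
    (h1 : ∀ q, 0 ≤ L (X * (q * q))) (p : ℝ[X]) (hp : ∀ x : ℝ, 0 ≤ x → 0 ≤ p.eval x) :
    0 ≤ L p := by
  induction hn : p.natDegree using Nat.strong_induction_on generalizing L p with
  | _ n ih =>
  have hC : ∀ c : ℝ, 0 ≤ c → 0 ≤ L (C c) := fun c hc => by
    have := h0 (C (√c))
    rwa [← C_mul, Real.mul_self_sqrt hc] at this
  obtain hd | hd := Nat.eq_zero_or_pos p.natDegree
  · rw [eq_C_of_natDegree_eq_zero hd]
    refine hC _ ?_
    simpa [coeff_zero_eq_eval_zero] using hp 0 le_rfl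
  have hdeg : 0 < p.degree := natDegree_pos_iff_degree_pos.mp hd
  have htop : Filter.Tendsto (fun x => p.eval x) Filter.atTop Filter.atTop := by
    refine p.tendsto_atTop_of_leadingCoeff_nonneg hdeg ?_
    by_contra! hlc
    have := p.tendsto_atBot_of_leadingCoeff_nonpos hdeg hlc.le
    obtain ⟨x, hx, hx'⟩ := ((this.eventually (Filter.eventually_lt_atBot 0)).and
      (Filter.eventually_ge_atTop 0)).exists
    exact absurd (hp x hx') (not_le.mpr hx)
  obtain ⟨x₀, hx₀, hmin⟩ : ∃ x₀ : ℝ, 0 ≤ x₀ ∧ ∀ x, 0 ≤ x → p.eval x₀ ≤ p.eval x := by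
    obtain ⟨x₀, h, h'⟩ := p.continuous.continuousOn.exists_isMinOn' (s := Set.Ici (0 : ℝ))
      isClosed_Ici (x₀ := 0) Set.self_mem_Ici (by
        refine Filter.Eventually.filter_mono ?_ (htop.eventually (Filter.eventually_ge_atTop _))
        rw [_root_.cocompact_eq_atBot_atTop, inf_sup_right, sup_le_iff]
        refine ⟨?_, inf_le_left⟩
        rw [disjoint_iff.mp ((Filter.disjoint_atBot_principal_Ici 0))]
        exact bot_le)
    exact ⟨x₀, h, fun x hx => h' hx⟩
  set c := p.eval x₀
  set d := p - C c
  have hdnat : d.natDegree = p.natDegree := natDegree_sub_C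
  have hd0 : d ≠ 0 := by rintro h; simp [h] at hdnat; omega
  have hdn : ∀ x, 0 ≤ x → 0 ≤ d.eval x := fun x hx => by simpa [d] using hmin x hx
  have hroot : d.IsRoot x₀ := by simp [d, c]
  have hLp : L p = L (C c) + L d := by rw [← map_add]; simp [d]
  rw [hLp]
  refine add_nonneg (hC _ (hp _ hx₀)) ?_
  obtain rfl | hx₀ := hx₀.eq_or_lt
  · obtain ⟨q, hq⟩ : X ∣ d := by simpa using dvd_iff_isRoot.mpr hroot
    have hq0 : q ≠ 0 := by rintro rfl; simp at hq; exact hd0 hq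
    have hqd : d.natDegree = q.natDegree + 1 := by rw [hq, natDegree_X_mul hq0]
    rw [hq]
    refine ih q.natDegree (by omega) (L ∘ₗ LinearMap.mulLeft ℝ X) (fun r => by simpa using h1 r)
      (fun r => ?_) q ?_ rfl
    · have := h0 (X * r)
      simp only [LinearMap.comp_apply, LinearMap.mulLeft_apply]
      convert this using 2; ring
    · exact fun x hx => eval_nonneg_of_mul_eval_nonneg (x₀ := 0)
        (fun y hy _ => by simpa using hy) (hq ▸ hdn) hx
  · have hder : (derivative d).IsRoot x₀ := by
      have hloc : IsLocalMin (fun x => d.eval x) x₀ := by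
        filter_upwards [lt_mem_nhds hx₀] with x hx
        rw [hroot.eq_zero]
        exact hdn x hx.le
      simpa using hloc.deriv_eq_zero
    obtain ⟨q, hq⟩ : (X - C x₀) ^ 2 ∣ d :=
      (le_rootMultiplicity_iff hd0).mp ((one_lt_rootMultiplicity_iff_isRoot hd0).mpr ⟨hroot, hder⟩)
    have hq0 : q ≠ 0 := by rintro rfl; simp at hq; exact hd0 hq
    have hqd : d.natDegree = 2 + q.natDegree := by
      rw [hq, natDegree_mul (pow_ne_zero _ (X_sub_C_ne_zero _)) hq0, natDegree_pow,
        natDegree_X_sub_C]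
    rw [hq]
    refine ih q.natDegree (by omega) (L ∘ₗ LinearMap.mulLeft ℝ ((X - C x₀) ^ 2)) (fun r => ?_)
      (fun r => ?_) q ?_ rfl
    · have := h0 ((X - C x₀) * r)
      simp only [LinearMap.comp_apply, LinearMap.mulLeft_apply]
      convert this using 2; ring
    · have := h1 ((X - C x₀) * r)
      simp only [LinearMap.comp_apply, LinearMap.mulLeft_apply]
      convert this using 2; ring
    · exact fun x hx => eval_nonneg_of_mul_eval_nonneg (x₀ := x₀)
        (fun y _ hy => by simpa using sq_pos_of_ne_zero (sub_ne_zero.mpr hy)) (hq ▸ hdn) hx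

/-- A nonzero polynomial has fewer sign variations than nonzero coefficients. -/
theorem Polynomial.signVariations_lt_card_support {P : Polynomial ℝ} (hP : P ≠ 0) :
    P.signVariations < P.support.card := by
  induction hn : P.support.card generalizing P with
  | zero => simp_all
  | succ n ih =>
    by_cases h : P.eraseLead = 0
    · rw [← P.eraseLead_add_C_mul_X_pow, h, zero_add, Polynomial.C_mul_X_pow_eq_monomial,
        Polynomial.signVariations_monomial]
      omega
    · have h1 := Polynomial.card_support_eraseLead_add_one hP
      have h2 := ih h (by omega)
      have h3 := P.signVariations_le_eraseLead_succ
      omega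

/-- A generalized Vandermonde determinant with distinct positive nodes does not vanish. -/
theorem det_pow_ne_zero {m : ℕ} {r : Fin m → ℕ} (hr : Function.Injective r) {x : Fin m → ℝ}
    (hx : Function.Injective x) (hpos : ∀ i, 0 < x i) :
    (Matrix.of fun i j => x i ^ r j).det ≠ 0 := by
  intro hdet
  obtain ⟨v, hv, hv0⟩ := Matrix.exists_mulVec_eq_zero_iff.mpr hdet
  set P : Polynomial ℝ := ∑ j, Polynomial.monomial (r j) (v j)
  have hcoeff : ∀ j, P.coeff (r j) = v j := fun j => by
    simp [P, Polynomial.finsetSum_coeff, Polynomial.coeff_monomial, hr.eq_iff]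
  have hP : P ≠ 0 := by
    rintro h
    exact hv (funext fun j => by simp [← hcoeff j, h])
  have hsupp : P.support.card ≤ m := by
    have : P.support ⊆ Finset.univ.image r := by
      intro n hn
      by_contra hnr
      simp only [Finset.mem_image, Finset.mem_univ, true_and, not_exists] at hnr
      simp [P, Polynomial.finsetSum_coeff, Polynomial.coeff_monomial, hnr] at hn
    simpa using (Finset.card_le_card this).trans Finset.card_image_le
  have hroots : m ≤ P.roots.countP (0 < ·) := by
    have hle : (Finset.univ.image x).val ≤ P.roots.filter (0 < ·) := by
      rw [Multiset.le_iff_subset (Finset.nodup _)]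
      intro y hy
      simp only [Finset.mem_val, Finset.mem_image, Finset.mem_univ, true_and] at hy
      obtain ⟨i, rfl⟩ := hy
      rw [Multiset.mem_filter, Polynomial.mem_roots hP]
      refine ⟨?_, hpos i⟩
      have := congrFun hv0 i
      simp only [Matrix.mulVec, dotProduct, Matrix.of_apply, Pi.zero_apply] at this
      simp [P, Polynomial.IsRoot, Polynomial.eval_finsetSum, ← this, mul_comm]
    rw [Multiset.countP_eq_card_filter]
    have hcard := Multiset.card_le_card hle
    rwa [Finset.card_val, Finset.card_image_of_injective _ hx, Finset.card_fin] at hcard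
  have := P.roots_countP_pos_le_signVariations
  have := Polynomial.signVariations_lt_card_support hP
  omega

/-- A generalized Vandermonde determinant with increasing positive nodes is positive. -/
theorem det_pow_pos {m : ℕ} {r : Fin m → ℕ} (hr : StrictMono r) {x : Fin m → ℝ}
    (hx : StrictMono x) (hpos : ∀ i, 0 < x i) : 0 < (Matrix.of fun i j => x i ^ r j).det := by
  induction m with
  | zero => simp
  | succ m ih =>
    have hlow : 0 < (Matrix.of fun i j : Fin m => x i.castSucc ^ r j.castSucc).det :=
      ih (hr.comp Fin.strictMono_castSucc) (hx.comp Fin.strictMono_castSucc) fun i => hpos _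
    set D : ℝ → ℝ := fun t =>
      (Matrix.of fun i j => (Fin.snoc (fun i => x i.castSucc) t : Fin (m + 1) → ℝ) i ^ r j).det
    set c : Fin (m + 1) → ℝ := fun j => (-1) ^ (m + j : ℕ) *
      (Matrix.of fun i k : Fin m => x i.castSucc ^ r (j.succAbove k)).det
    set P : Polynomial ℝ := ∑ j, Polynomial.monomial (r j) (c j)
    have hPD : ∀ t, P.eval t = D t := fun t => by
      simp only [D]
      rw [Matrix.det_succ_row _ (Fin.last m)]
      simp only [P, Polynomial.eval_finsetSum, Polynomial.eval_monomial]
      refine Finset.sum_congr rfl fun j _ => ?_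
      simp only [c, Fin.val_last, Matrix.of_apply, Fin.snoc_last, mul_right_comm]
      congr 2
      congr 1
      ext i k
      simp
    have hclast : 0 < c (Fin.last m) := by
      simpa [c, ← two_mul] using hlow
    have hcoeff : P.coeff (r (Fin.last m)) = c (Fin.last m) := by
      simp [P, Polynomial.finsetSum_coeff, Polynomial.coeff_monomial, hr.injective.eq_iff]
    have hdeg : P.natDegree = r (Fin.last m) := by
      refine Polynomial.natDegree_eq_of_le_of_coeff_ne_zero ?_ (hcoeff.symm ▸ hclast.ne')
      refine Polynomial.natDegree_sum_le_of_forall_le _ _ fun j _ => ?_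
      exact (Polynomial.natDegree_monomial_le _).trans (hr.monotone (Fin.le_last j))
    have hlc : 0 < P.leadingCoeff := by rwa [Polynomial.leadingCoeff, hdeg, hcoeff]
    have hlarge : ∀ᶠ t in Filter.atTop, 0 < P.eval t := by
      by_cases h : 0 < P.degree
      · exact (P.tendsto_atTop_of_leadingCoeff_nonneg h hlc.le).eventually_gt_atTop 0
      · rw [Polynomial.eq_C_of_degree_le_zero (not_lt.mp h)] at hlc ⊢
        rw [Polynomial.leadingCoeff_C] at hlc
        simp [hlc]
    have hxD : (Matrix.of fun i j => x i ^ r j).det = P.eval (x (Fin.last m)) := by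
      rw [hPD]
      have hsnoc : (Fin.snoc (fun i => x i.castSucc) (x (Fin.last m)) : Fin (m + 1) → ℝ) = x :=
        Fin.snoc_init_self x
      simp only [D, hsnoc]
    rw [hxD]
    by_contra! hle
    obtain ⟨t, ht, hxt⟩ := (hlarge.and (Filter.eventually_ge_atTop (x (Fin.last m)))).exists
    obtain ⟨s, hs, hs0⟩ := intermediate_value_Icc hxt P.continuous.continuousOn ⟨hle, ht.le⟩
    simp only [hPD] at hs0
    have hmono : StrictMono (Fin.snoc (fun i => x i.castSucc) s : Fin (m + 1) → ℝ) := by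
      intro i j hij
      induction i using Fin.lastCases with
      | last => exact absurd hij (Fin.le_last j).not_gt
      | cast i =>
        induction j using Fin.lastCases with
        | last => simpa using (hx (Fin.castSucc_lt_last i)).trans_le hs.1
        | cast j => simpa using hx hij
    refine det_pow_ne_zero hr.injective hmono.injective (fun i => ?_) hs0
    induction i using Fin.lastCases with
    | last => simpa using (hpos _).trans_le hs.1
    | cast i => simpa using hpos _

/-- A generalized Vandermonde determinant with increasing nonnegative nodes is nonnegative. -/
theorem det_pow_nonneg {m : ℕ} {r : Fin m → ℕ} (hr : StrictMono r) {x : Fin m → ℝ}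
    (hx : StrictMono x) (hpos : ∀ i, 0 ≤ x i) : 0 ≤ (Matrix.of fun i j => x i ^ r j).det := by
  have hcont : Continuous fun ε : ℝ => (Matrix.of fun i j => (x i + ε) ^ r j).det :=
    Continuous.matrix_det (continuous_matrix fun i j => by simp only [Matrix.of_apply]; fun_prop)
  have htend := hcont.continuousWithinAt (s := Set.Ioi 0) (x := 0)
  have := ge_of_tendsto (b := 0) htend (by
    filter_upwards [self_mem_nhdsWithin] with ε hε
    exact (det_pow_pos hr (fun i j hij => by simpa using hx hij)
      fun i => add_pos_of_nonneg_of_pos (hpos i) hε).le)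
  simpa using this

/-- Two generalized Vandermonde determinants with the same nonnegative nodes do not have opposite
signs. -/
theorem det_pow_mul_det_pow_nonneg {m : ℕ} {r s : Fin m → ℕ} (hr : StrictMono r)
    (hs : StrictMono s) {x : Fin m → ℝ} (hpos : ∀ i, 0 ≤ x i) :
    0 ≤ (Matrix.of fun i j => x i ^ r j).det * (Matrix.of fun i j => x i ^ s j).det := by
  by_cases hx : Function.Injective x
  · set σ := Tuple.sort x
    have hmono : StrictMono (x ∘ σ) :=
      (Tuple.monotone_sort x).strictMono_of_injective (hx.comp σ.injective)
    have key : ∀ u : Fin m → ℕ, (Matrix.of fun i j => (x ∘ σ) i ^ u j).det =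
        (σ.sign : ℤ) * (Matrix.of fun i j => x i ^ u j).det :=
      fun u => by rw [← Matrix.det_permute]; rfl
    have := mul_nonneg (det_pow_nonneg hr hmono fun i => hpos _)
      (det_pow_nonneg hs hmono fun i => hpos _)
    rw [key, key, mul_mul_mul_comm] at this
    simpa [← Int.cast_mul, ← Units.val_mul, Int.units_mul_self] using this
  · simp only [Function.Injective, not_forall] at hx
    obtain ⟨i, j, hij, hne⟩ := hx
    rw [Matrix.det_zero_of_row_eq hne (by ext k; simp [hij]), zero_mul]

/-- **Andréief's identity** for monomials. -/
theorem integral_det_pow_mul_det_pow (ρ : Measure ℝ) [SigmaFinite ρ]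
    (hint : ∀ n : ℕ, Integrable (fun x : ℝ => x ^ n) ρ) {m : ℕ} (r s : Fin m → ℕ) :
    ∫ x : Fin m → ℝ, (Matrix.of fun i j => x i ^ r j).det * (Matrix.of fun i j => x i ^ s j).det
      ∂(Measure.pi fun _ => ρ) =
    m.factorial * (Matrix.of fun i j => ∫ x, x ^ (r i + s j) ∂ρ).det := by
  set A : Matrix (Fin m) (Fin m) ℝ := Matrix.of fun i j => ∫ x, x ^ (r i + s j) ∂ρ
  have hexp : ∀ x : Fin m → ℝ,
      (Matrix.of fun i j => x i ^ r j).det * (Matrix.of fun i j => x i ^ s j).det =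
      ∑ σ : Equiv.Perm (Fin m), ∑ τ : Equiv.Perm (Fin m),
        ((σ.sign : ℤ) * (τ.sign : ℤ) : ℝ) * ∏ i, x i ^ (r (σ i) + s (τ i)) := fun x => by
    rw [← Matrix.det_transpose, Matrix.det_apply', ← Matrix.det_transpose (Matrix.of _),
      Matrix.det_apply', Finset.sum_mul_sum]
    refine Finset.sum_congr rfl fun σ _ => Finset.sum_congr rfl fun τ _ => ?_
    simp only [Matrix.transpose_apply, Matrix.of_apply, pow_add, Finset.prod_mul_distrib]
    ring
  have hI : ∀ σ τ : Equiv.Perm (Fin m), Integrable (fun x : Fin m → ℝ =>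
      ((σ.sign : ℤ) * (τ.sign : ℤ) : ℝ) * ∏ i, x i ^ (r (σ i) + s (τ i)))
      (Measure.pi fun _ => ρ) := fun σ τ =>
    (Integrable.fintype_prod (f := fun i (y : ℝ) => y ^ (r (σ i) + s (τ i)))
      fun i => hint _).const_mul _
  simp_rw [hexp]
  rw [integral_finsetSum _ fun σ _ => integrable_finsetSum _ fun τ _ => hI σ τ]
  have hσ : ∀ σ : Equiv.Perm (Fin m), ∫ x : Fin m → ℝ, ∑ τ : Equiv.Perm (Fin m),
      ((σ.sign : ℤ) * (τ.sign : ℤ) : ℝ) * ∏ i, x i ^ (r (σ i) + s (τ i))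
      ∂(Measure.pi fun _ => ρ) = A.det := fun σ => by
    rw [integral_finsetSum _ fun τ _ => hI σ τ]
    have hperm := Matrix.det_permute σ A
    rw [← Matrix.det_transpose, Matrix.det_apply'] at hperm
    have : A.det = (σ.sign : ℤ) * ((σ.sign : ℤ) * A.det) := by
      rw [← mul_assoc, ← Int.cast_mul, ← Units.val_mul, Int.units_mul_self]; simp
    rw [this, ← hperm, Finset.mul_sum]
    refine Finset.sum_congr rfl fun τ _ => ?_
    rw [integral_const_mul,
      integral_fintype_prod_eq_prod (fun i (y : ℝ) => y ^ (r (σ i) + s (τ i))), mul_assoc]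
    rfl
  simp only [hσ, Finset.sum_const, Finset.card_univ, Fintype.card_perm, Fintype.card_fin,
    nsmul_eq_mul]

/-- The minors of the Hankel matrix of moments of a measure on `[0, ∞)` are nonnegative. -/
theorem det_moments_nonneg (ρ : Measure ℝ) (hρ : ρ (Set.Iio 0) = 0)
    (hint : ∀ n : ℕ, Integrable (fun x : ℝ => x ^ n) ρ) {m : ℕ} {r s : Fin m → ℕ}
    (hr : StrictMono r) (hs : StrictMono s) :
    0 ≤ (Matrix.of fun i j => ∫ x, x ^ (r i + s j) ∂ρ).det := by
  have : IsFiniteMeasure ρ := by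
    have := hint 0
    simpa [integrable_const_iff] using this
  have hae : ∀ᵐ x ∂(Measure.pi fun _ : Fin m => ρ), ∀ i, 0 ≤ x i := by
    rw [ae_all_iff]
    intro i
    refine (Measure.quasiMeasurePreserving_eval (fun _ => ρ) i).ae (p := fun y => 0 ≤ y) ?_
    rw [ae_iff]
    simpa [Set.Iio] using hρ
  have hnn := integral_nonneg_of_ae (hae.mono fun x hx => det_pow_mul_det_pow_nonneg hr hs hx)
  rw [integral_det_pow_mul_det_pow ρ hint] at hnn
  exact nonneg_of_mul_nonneg_right hnn (by positivity)

open scoped CompactlySupported NNReal in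
open Polynomial in
/-- A functional on real polynomials that is nonnegative on polynomials nonnegative on `[0, ∞)`
extends to a positive functional on compactly supported perturbations of polynomials. -/
theorem exists_extension_compactlySupported (L : ℝ[X] →ₗ[ℝ] ℝ)
    (hL : ∀ p : ℝ[X], (∀ x : ℝ, 0 ≤ x → 0 ≤ p.eval x) → 0 ≤ L p) :
    ∃ Λ : C_c(ℝ≥0, ℝ) →ₗ[ℝ] ℝ, ∀ (p : ℝ[X]) (f : C_c(ℝ≥0, ℝ)),
      (∀ x : ℝ≥0, 0 ≤ p.eval (x : ℝ) + f x) → 0 ≤ L p + Λ f := by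
  let S : PointedCone ℝ (ℝ[X] × C_c(ℝ≥0, ℝ)) :=
    { carrier := {y | ∀ x : ℝ≥0, 0 ≤ y.1.eval (x : ℝ) + y.2 x}
      add_mem' := fun {y z} hy hz x => by
        have := add_nonneg (hy x) (hz x)
        simpa [add_add_add_comm] using this
      zero_mem' := fun x => by simp
      smul_mem' := fun c y hy x => by
        have := mul_nonneg c.2 (hy x)
        rw [mul_add] at this
        change 0 ≤ eval (x : ℝ) ((c : ℝ) • y.1) + (c : ℝ) * y.2 x
        rwa [eval_smul, smul_eq_mul] }
  let F : (ℝ[X] × C_c(ℝ≥0, ℝ)) →ₗ.[ℝ] ℝ :=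
    { domain := Submodule.prod ⊤ ⊥
      toFun := (L ∘ₗ LinearMap.fst ℝ _ _) ∘ₗ Submodule.subtype _ }
  obtain ⟨g, hg, hgS⟩ := riesz_extension S F
    (by
      rintro ⟨⟨p, f⟩, _, hf⟩ h
      refine hL p fun x hx => ?_
      have hfx : f ⟨x, hx⟩ = 0 := by rw [show f = 0 from hf]; rfl
      have h' : 0 ≤ p.eval x + f ⟨x, hx⟩ := h ⟨x, hx⟩
      rwa [hfx, add_zero] at h')
    (by
      rintro ⟨p, f⟩
      obtain ⟨M, hM⟩ := f.continuous.bounded_above_of_compact_support f.hasCompactSupport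
      refine ⟨⟨(C M - p, 0), trivial, rfl⟩, fun x => ?_⟩
      have : -M ≤ f x := (abs_le.mp (hM x)).1
      simp
      linarith)
  refine ⟨g ∘ₗ LinearMap.inr ℝ _ _, fun p f h => ?_⟩
  have h1 : g (p, 0) = L p := hg ⟨(p, 0), trivial, rfl⟩
  have h2 := hgS (p, f) h
  have h3 : ((p, f) : ℝ[X] × C_c(ℝ≥0, ℝ)) = (p, 0) + (0, f) := by simp
  rwa [h3, map_add, h1] at h2

open scoped CompactlySupported NNReal in
open Polynomial Filter in
/-- **Haviland's theorem** on the half-line: a functional on real polynomials that is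
nonnegative on polynomials nonnegative on `[0, ∞)` is integration against a measure. -/
theorem exists_measure_of_nonneg (L : ℝ[X] →ₗ[ℝ] ℝ)
    (hL : ∀ p : ℝ[X], (∀ x : ℝ, 0 ≤ x → 0 ≤ p.eval x) → 0 ≤ L p) :
    ∃ μ : Measure ℝ≥0, ∀ n : ℕ, Integrable (fun x : ℝ≥0 => (x : ℝ) ^ n) μ ∧
      ∫ x : ℝ≥0, (x : ℝ) ^ n ∂μ = L (X ^ n) := by
  obtain ⟨Λ, hΛ⟩ := exists_extension_compactlySupported L hL
  have hpos : ∀ f : C_c(ℝ≥0, ℝ), 0 ≤ f → 0 ≤ Λ f := fun f hf => by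
    simpa using hΛ 0 f fun x => by simpa using hf x
  set μ := RealRMK.rieszMeasure (PositiveLinearMap.mk₀ Λ hpos)
  have hμ : ∀ f : C_c(ℝ≥0, ℝ), ∫ x, f x ∂μ = Λ f := fun f =>
    RealRMK.integral_rieszMeasure (PositiveLinearMap.mk₀ Λ hpos) f
  refine ⟨μ, fun n => ?_⟩
  let φ : ℕ → ℝ≥0 → ℝ := fun k x => max 0 (min 1 (k + 1 - x))
  have hφ0 : ∀ k x, 0 ≤ φ k x := fun k x => le_max_left _ _
  have hφ1 : ∀ k x, φ k x ≤ 1 := fun k x => max_le zero_le_one (min_le_left _ _)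
  have hφmono : ∀ x, Monotone fun k => φ k x := fun x k l hkl => by
    have : (k : ℝ) ≤ l := by exact_mod_cast hkl
    simp only [φ]; gcongr
  have hφeq : ∀ (k : ℕ) (x : ℝ≥0), (x : ℝ) ≤ k → φ k x = 1 := fun k x hx => by
    simp only [φ]
    rw [min_eq_left (by linarith), max_eq_right zero_le_one]
  let f : ℕ → C_c(ℝ≥0, ℝ) := fun k =>
    { toFun := fun x => (x : ℝ) ^ n * φ k x
      continuous_toFun := by fun_prop
      hasCompactSupport' := by
        refine HasCompactSupport.intro (isCompact_Icc (a := 0) (b := (k + 1 : ℝ≥0))) fun x hx => ?_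
        have hx' : (k + 1 : ℝ≥0) < x := by simpa using hx
        have hx' : (k + 1 : ℝ) < x := by exact_mod_cast hx'
        have : φ k x = 0 := max_eq_left ((min_le_right _ _).trans (by linarith))
        simp [this] }
  have hf : ∀ k x, f k x = (x : ℝ) ^ n * φ k x := fun k x => rfl
  have hupper : ∀ k, Λ (f k) ≤ L (X ^ n) := fun k => by
    have := hΛ (X ^ n) (-f k) fun x => by
      have := mul_le_of_le_one_right (pow_nonneg x.coe_nonneg n) (hφ1 k x)
      simpa [hf] using this
    rw [map_neg] at this
    linarith
  have hlower : ∀ k : ℕ, L (X ^ n) - (k + 1 : ℝ)⁻¹ * L (X ^ (n + 1)) ≤ Λ (f (k + 1)) := fun k => by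
    have := hΛ ((k + 1 : ℝ)⁻¹ • X ^ (n + 1) - X ^ n) (f (k + 1)) fun x => by
      simp only [eval_sub, eval_smul, eval_pow, eval_X, smul_eq_mul, hf]
      have hxn := pow_nonneg x.coe_nonneg n
      have hk : (0 : ℝ) < k + 1 := by positivity
      obtain hx | hx := le_total (x : ℝ) (k + 1)
      · rw [hφeq (k + 1) x (by exact_mod_cast hx)]
        have : 0 ≤ (k + 1 : ℝ)⁻¹ * (x : ℝ) ^ (n + 1) := by positivity
        linarith
      · have h1 : 1 ≤ (k + 1 : ℝ)⁻¹ * x := by rwa [inv_mul_eq_div, one_le_div hk]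
        have h2 := mul_nonneg hxn (hφ0 (k + 1) x)
        have h3 := mul_le_mul_of_nonneg_left h1 hxn
        rw [pow_succ]
        linarith
    rw [map_sub, map_smul, smul_eq_mul] at this
    linarith
  have hlim : Tendsto (fun k => ∫ x, f k x ∂μ) atTop (nhds (L (X ^ n))) := by
    simp only [hμ]
    rw [← tendsto_add_atTop_iff_nat 1]
    refine tendsto_of_tendsto_of_tendsto_of_le_of_le ?_ tendsto_const_nhds hlower
      fun k => hupper _
    have : Tendsto (fun k : ℕ => L (X ^ n) - (k + 1 : ℝ)⁻¹ * L (X ^ (n + 1))) atTop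
        (nhds (L (X ^ n) - 0 * L (X ^ (n + 1)))) := by
      refine tendsto_const_nhds.sub (Tendsto.mul_const _ ?_)
      simpa using tendsto_one_div_add_atTop_nhds_zero_nat (𝕜 := ℝ)
    simpa using this
  have hint : ∀ k, Integrable (f k) μ := fun k =>
    (f k).continuous.integrable_of_hasCompactSupport (f k).hasCompactSupport
  have hmono : ∀ x, Monotone fun k => f k x := fun x k l hkl =>
    mul_le_mul_of_nonneg_left (hφmono x hkl) (pow_nonneg x.coe_nonneg n)
  have hpt : ∀ x : ℝ≥0, Tendsto (fun k => f k x) atTop (nhds ((x : ℝ) ^ n)) := fun x => by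
    refine tendsto_const_nhds.congr' ?_
    obtain ⟨N, hN⟩ := exists_nat_ge (x : ℝ)
    filter_upwards [eventually_ge_atTop N] with k hk
    have : (N : ℝ) ≤ k := by exact_mod_cast hk
    rw [hf, hφeq k x (hN.trans this), mul_one]
  have hI : Integrable (fun x : ℝ≥0 => (x : ℝ) ^ n) μ :=
    by
    refine ⟨by fun_prop, ?_⟩
    rw [hasFiniteIntegral_iff_ofReal (.of_forall fun x => pow_nonneg x.coe_nonneg n)]
    refine (le_of_tendsto (lintegral_tendsto_of_tendsto_of_monotone
      (f := fun k x => ENNReal.ofReal (f k x))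
      (fun k => (hint k).aestronglyMeasurable.aemeasurable.ennreal_ofReal)
      (.of_forall fun x k l hkl => ENNReal.ofReal_le_ofReal (hmono x hkl))
      (.of_forall fun x => ENNReal.tendsto_ofReal (hpt x))) (.of_forall fun k => ?_)).trans_lt
      (ENNReal.ofReal_lt_top (r := L (X ^ n)))
    rw [← ofReal_integral_eq_lintegral_ofReal (hint k)
      (.of_forall fun x => mul_nonneg (pow_nonneg x.coe_nonneg n) (hφ0 k x)), hμ]
    exact ENNReal.ofReal_le_ofReal (hupper k)
  exact ⟨hI, tendsto_nhds_unique (integral_tendsto_of_tendsto_of_monotone hint hI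
    (.of_forall hmono) (.of_forall hpt)) hlim⟩

/-- A real sequence is a Stieltjes moment sequence if and only if its infinite
Hankel matrix `H₀ = (a_{i+j})` is totally positive, i.e. every minor (determinant of a
finite square submatrix given by strictly increasing row and column indices) is
nonnegative. -/
theorem stmt_2 (a : ℕ → ℝ) :
    (∃ ρ : Measure ℝ, ρ (Set.Iio 0) = 0 ∧
        (∀ n : ℕ, Integrable (fun x : ℝ => x ^ n) ρ) ∧
        ∀ n : ℕ, a n = ∫ x, x ^ n ∂ρ) ↔
    (∀ m : ℕ, 1 ≤ m → ∀ r s : Fin m → ℕ, StrictMono r → StrictMono s →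
        0 ≤ (Matrix.of fun i j : Fin m => a (r i + s j)).det) := by
  constructor
  · rintro ⟨ρ, hρ, hint, ha⟩ m - r s hr hs
    simp only [ha]
    exact det_moments_nonneg ρ hρ hint hr hs
  · intro h
    obtain ⟨μ, hμ⟩ := exists_measure_of_nonneg (momentFunctional a)
      (nonneg_of_nonneg_on_squares (momentFunctional a)
        (fun q => by simpa using momentFunctional_X_pow_mul_sq_nonneg h 0 q)
        (fun q => by simpa using momentFunctional_X_pow_mul_sq_nonneg h 1 q))
    have hm : Measurable ((↑) : NNReal → ℝ) := measurable_coe_nnreal_real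
    refine ⟨μ.map (↑), ?_, fun n => ?_, fun n => ?_⟩
    · rw [Measure.map_apply hm measurableSet_Iio]
      convert measure_empty (μ := μ)
      ext x
      simp
    · rw [integrable_map_measure (by fun_prop) hm.aemeasurable]
      exact (hμ n).1
    · rw [integral_map hm.aemeasurable (by fun_prop), (hμ n).2,
        ← Polynomial.monomial_one_right_eq_X_pow, momentFunctional_monomial, mul_one]
end

section
/- (Marcus–Tardos / Stanley–Wilf) For every k ≥ 1 and every permutation τ of {1,…,k}, the limit lim_{n→∞} (s_n(τ))^{1/n} exists and is finite, where s_n(τ) is the number of permutations of {1,…,n} that avoid the pattern τ. Consequently the number of τ-avoiding permutations grows at most exponentially in n. -/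
open Filter

/-- `π` contains the pattern `τ`: some subsequence of `π` of length `k` has its
entries in the same relative order as `τ`. -/
def PattContains {k n : ℕ} (τ : Equiv.Perm (Fin k)) (π : Equiv.Perm (Fin n)) : Prop :=
  ∃ f : Fin k → Fin n, StrictMono f ∧ ∀ a b : Fin k, π (f a) < π (f b) ↔ τ a < τ b

/-- `avoidCount τ n` is the number of permutations of `{1, …, n}` avoiding the
pattern `τ`. -/
noncomputable def avoidCount {k : ℕ} (τ : Equiv.Perm (Fin k)) (n : ℕ) : ℕ :=
  Nat.card {π : Equiv.Perm (Fin n) // ¬ PattContains τ π}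

/-- The 0-1 matrix with support `A` contains the permutation matrix of `τ`. -/
def MatContains {k : ℕ} (τ : Equiv.Perm (Fin k)) (A : Finset (ℕ × ℕ)) : Prop :=
  ∃ r c : Fin k → ℕ, StrictMono r ∧ StrictMono c ∧ ∀ a, (r a, c (τ a)) ∈ A

/-- The block of an entry, for the subdivision of a matrix into `q × q` blocks. -/
def blockOf (q : ℕ) (p : ℕ × ℕ) : ℕ × ℕ := (p.1 / q, p.2 / q)

/-- The entries of `A` that lie in the block `b`. -/
def blockEntries (q : ℕ) (A : Finset (ℕ × ℕ)) (b : ℕ × ℕ) : Finset (ℕ × ℕ) :=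
  A.filter fun p => blockOf q p = b

/-- The matrix of nonempty `q × q` blocks of `A`. -/
def contraction (q : ℕ) (A : Finset (ℕ × ℕ)) : Finset (ℕ × ℕ) := A.image (blockOf q)

/-- The nonempty columns of the block `b` of `A`. -/
def blockCols (q : ℕ) (A : Finset (ℕ × ℕ)) (b : ℕ × ℕ) : Finset ℕ :=
  (blockEntries q A b).image Prod.snd

/-- The nonempty rows of the block `b` of `A`. -/
def blockRows (q : ℕ) (A : Finset (ℕ × ℕ)) (b : ℕ × ℕ) : Finset ℕ :=
  (blockEntries q A b).image Prod.fst

/-- The blocks of `A` that have at least `k` nonempty columns. -/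
def wideBlocks (k q : ℕ) (A : Finset (ℕ × ℕ)) : Finset (ℕ × ℕ) :=
  (contraction q A).filter fun b => k ≤ (blockCols q A b).card

/-- The blocks of `A` that have at least `k` nonempty rows. -/
def tallBlocks (k q : ℕ) (A : Finset (ℕ × ℕ)) : Finset (ℕ × ℕ) :=
  (contraction q A).filter fun b => k ≤ (blockRows q A b).card

theorem lt_of_div_lt_div {q i j : ℕ} (h : i / q < j / q) : i < j := by
  by_contra! hc
  exact absurd (Nat.div_le_div_right (c := q) hc) (not_le.mpr h)

theorem MatContains.of_contraction {k q : ℕ} {τ : Equiv.Perm (Fin k)} {A : Finset (ℕ × ℕ)}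
    (h : MatContains τ (contraction q A)) : MatContains τ A := by
  obtain ⟨r, c, hr, hc, hA⟩ := h
  have hex : ∀ a, ∃ p ∈ A, p.1 / q = r a ∧ p.2 / q = c (τ a) := by
    intro a
    obtain ⟨p, hp, hpe⟩ := Finset.mem_image.mp (hA a)
    exact ⟨p, hp, congrArg Prod.fst hpe, congrArg Prod.snd hpe⟩
  choose p hp h1 h2 using hex
  refine ⟨fun a => (p a).1, fun b => (p (τ.symm b)).2, ?_, ?_, ?_⟩
  · intro a b hab
    apply lt_of_div_lt_div (q := q)
    rw [h1, h1]
    exact hr hab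
  · intro a b hab
    apply lt_of_div_lt_div (q := q)
    rw [h2, h2]
    simpa using hc hab
  · intro a
    simpa using hp a

theorem MatContains.of_swap {k : ℕ} {τ : Equiv.Perm (Fin k)} {A : Finset (ℕ × ℕ)}
    (h : MatContains τ⁻¹ (A.image Prod.swap)) : MatContains τ A := by
  obtain ⟨r, c, hr, hc, hA⟩ := h
  refine ⟨c, r, hc, hr, fun a => ?_⟩
  obtain ⟨p, hp, hpe⟩ := Finset.mem_image.mp (hA (τ a))
  have : p = (c a, r (τ a)) := by
    rw [← Prod.swap_swap p, hpe]
    simp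
  exact this ▸ hp

theorem contraction_subset {q n : ℕ} {A : Finset (ℕ × ℕ)}
    (hA : A ⊆ Finset.range (q * n) ×ˢ Finset.range (q * n)) :
    contraction q A ⊆ Finset.range n ×ˢ Finset.range n := by
  intro b hb
  obtain ⟨p, hp, rfl⟩ := Finset.mem_image.mp hb
  have := hA hp
  simp only [Finset.mem_product, Finset.mem_range, blockOf] at this ⊢
  exact ⟨Nat.div_lt_of_lt_mul this.1, Nat.div_lt_of_lt_mul this.2⟩

theorem blockCols_subset {q : ℕ} (hq : 0 < q) (A : Finset (ℕ × ℕ)) (b : ℕ × ℕ) :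
    blockCols q A b ⊆ Finset.Ico (b.2 * q) (b.2 * q + q) := by
  intro j hj
  obtain ⟨p, hp, rfl⟩ := Finset.mem_image.mp hj
  have hb := congrArg Prod.snd (Finset.mem_filter.mp hp).2
  simp only [blockOf] at hb
  have h1 := Nat.div_add_mod p.2 q
  have h2 := Nat.mod_lt p.2 hq
  rw [hb, mul_comm] at h1
  rw [Finset.mem_Ico]
  omega

theorem blockRows_eq_blockCols_swap (q : ℕ) (A : Finset (ℕ × ℕ)) (b : ℕ × ℕ) :
    blockRows q A b = blockCols q (A.image Prod.swap) b.swap := by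
  ext i
  simp only [blockRows, blockCols, blockEntries, blockOf, Finset.mem_image, Finset.mem_filter,
    Prod.exists, Prod.ext_iff, Prod.fst_swap, Prod.snd_swap]
  constructor
  · rintro ⟨x, y, ⟨h, h1, h2⟩, rfl⟩
    exact ⟨y, x, ⟨⟨x, y, h, rfl, rfl⟩, h2, h1⟩, rfl⟩
  · rintro ⟨y, x, ⟨⟨x', y', h, rfl, rfl⟩, h1, h2⟩, rfl⟩
    exact ⟨_, _, ⟨h, h2, h1⟩, rfl⟩

theorem contraction_swap (q : ℕ) (A : Finset (ℕ × ℕ)) :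
    contraction q (A.image Prod.swap) = (contraction q A).image Prod.swap := by
  simp only [contraction, Finset.image_image]
  rfl

theorem card_tallBlocks (k q : ℕ) (A : Finset (ℕ × ℕ)) :
    (tallBlocks k q A).card = (wideBlocks k q (A.image Prod.swap)).card := by
  rw [wideBlocks, contraction_swap, Finset.filter_image,
    Finset.card_image_of_injective _ Prod.swap_injective, tallBlocks]
  simp only [blockRows_eq_blockCols_swap]

theorem card_wideBlocks_column_le {k q : ℕ} (hq : 0 < q) {τ : Equiv.Perm (Fin k)}
    {A : Finset (ℕ × ℕ)} (hτ : ¬ MatContains τ A) (J : ℕ) :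
    ((wideBlocks k q A).filter fun b => b.2 = J).card ≤ 2 ^ q * k := by
  by_contra! hlt
  have hmaps : ∀ b ∈ (wideBlocks k q A).filter (fun b => b.2 = J),
      blockCols q A b ∈ (Finset.Ico (J * q) (J * q + q)).powerset := by
    intro b hb
    rw [Finset.mem_powerset, ← (Finset.mem_filter.mp hb).2]
    exact blockCols_subset hq A b
  obtain ⟨S, -, hS⟩ := Finset.exists_lt_card_fiber_of_mul_lt_card_of_maps_to (n := k) hmaps
    (by simpa [Finset.card_powerset] using hlt)
  set F := ((wideBlocks k q A).filter fun b => b.2 = J).filter fun b => blockCols q A b = S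
    with hF
  have hmem : ∀ b ∈ F, k ≤ (blockCols q A b).card ∧ b.2 = J ∧ blockCols q A b = S := by
    intro b hb
    simp only [hF, wideBlocks, Finset.mem_filter] at hb
    exact ⟨hb.1.1.2, hb.1.2, hb.2⟩
  have hinj : Set.InjOn Prod.fst (F : Set (ℕ × ℕ)) := by
    intro x hx y hy hxy
    exact Prod.ext hxy ((hmem x hx).2.1.trans (hmem y hy).2.1.symm)
  have hrows : k ≤ (F.image Prod.fst).card := by
    rw [Finset.card_image_of_injOn hinj]
    exact hS.le
  obtain ⟨b₀, hb₀⟩ := Finset.card_pos.mp (lt_of_le_of_lt (Nat.zero_le k) hS)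
  have hcols : k ≤ S.card := by
    have := hmem b₀ hb₀
    exact this.2.2 ▸ this.1
  apply hτ
  have hrow : ∀ a : Fin k, ∃ i, i / q = (F.image Prod.fst).orderEmbOfCardLe hrows a ∧
      (i, S.orderEmbOfCardLe hcols (τ a)) ∈ A := by
    intro a
    obtain ⟨b, hb, hba⟩ := Finset.mem_image.mp (Finset.orderEmbOfCardLe_mem _ hrows a)
    have hc := Finset.orderEmbOfCardLe_mem S hcols (τ a)
    have hc' := (hmem b hb).2.2.symm.subset hc
    obtain ⟨p, hp, hpc⟩ := Finset.mem_image.mp hc'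
    obtain ⟨hpA, hpb⟩ := Finset.mem_filter.mp hp
    refine ⟨p.1, ?_, ?_⟩
    · rw [← hba, ← hpb]
      rfl
    · rw [← hpc]
      exact hpA
  choose r hr hrA using hrow
  refine ⟨r, S.orderEmbOfCardLe hcols, ?_, (S.orderEmbOfCardLe hcols).strictMono, hrA⟩
  intro a b hab
  apply lt_of_div_lt_div (q := q)
  rw [hr, hr]
  exact ((F.image Prod.fst).orderEmbOfCardLe hrows).strictMono hab

theorem card_wideBlocks_le {k q n : ℕ} (hq : 0 < q) {τ : Equiv.Perm (Fin k)}
    {A : Finset (ℕ × ℕ)} (hA : A ⊆ Finset.range (q * n) ×ˢ Finset.range (q * n))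
    (hτ : ¬ MatContains τ A) : (wideBlocks k q A).card ≤ 2 ^ q * k * n := by
  have h := Finset.card_le_mul_card_image_of_maps_to (s := wideBlocks k q A)
    (t := Finset.range n) (f := Prod.snd) ?_ (2 ^ q * k) ?_
  · simpa using h
  · intro b hb
    exact (Finset.mem_product.mp
      (contraction_subset hA (Finset.mem_filter.mp hb).1)).2
  · intro J _
    exact card_wideBlocks_column_le hq hτ J

theorem card_tallBlocks_le {k q n : ℕ} (hq : 0 < q) {τ : Equiv.Perm (Fin k)}
    {A : Finset (ℕ × ℕ)} (hA : A ⊆ Finset.range (q * n) ×ˢ Finset.range (q * n))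
    (hτ : ¬ MatContains τ A) : (tallBlocks k q A).card ≤ 2 ^ q * k * n := by
  rw [card_tallBlocks]
  refine card_wideBlocks_le hq ?_ (fun h => hτ (MatContains.of_swap h))
  intro p hp
  obtain ⟨x, hx, rfl⟩ := Finset.mem_image.mp hp
  have := Finset.mem_product.mp (hA hx)
  exact Finset.mem_product.mpr ⟨this.2, this.1⟩

theorem blockEntries_subset (q : ℕ) (A : Finset (ℕ × ℕ)) (b : ℕ × ℕ) :
    blockEntries q A b ⊆ blockRows q A b ×ˢ blockCols q A b := fun _ hp =>
  Finset.mem_product.mpr ⟨Finset.mem_image_of_mem _ hp, Finset.mem_image_of_mem _ hp⟩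

theorem card_blockCols_le {q : ℕ} (hq : 0 < q) (A : Finset (ℕ × ℕ)) (b : ℕ × ℕ) :
    (blockCols q A b).card ≤ q := by
  simpa using Finset.card_le_card (blockCols_subset hq A b)

theorem card_blockRows_le {q : ℕ} (hq : 0 < q) (A : Finset (ℕ × ℕ)) (b : ℕ × ℕ) :
    (blockRows q A b).card ≤ q :=
  blockRows_eq_blockCols_swap q A b ▸ card_blockCols_le hq _ _

theorem card_blockEntries_le {q : ℕ} (hq : 0 < q) (A : Finset (ℕ × ℕ)) (b : ℕ × ℕ) :
    (blockEntries q A b).card ≤ q * q :=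
  (Finset.card_le_card (blockEntries_subset q A b)).trans <| by
    rw [Finset.card_product]
    exact Nat.mul_le_mul (card_blockRows_le hq A b) (card_blockCols_le hq A b)

theorem card_le_of_blocks {q : ℕ} (hq : 0 < q) (k : ℕ) (A : Finset (ℕ × ℕ)) :
    A.card ≤ k * k * (contraction q A).card +
      q * q * ((wideBlocks k q A).card + (tallBlocks k q A).card) := by
  have hsum : A.card = ∑ b ∈ contraction q A, (blockEntries q A b).card :=
    Finset.card_eq_sum_card_image (blockOf q) A
  have hb : ∀ b ∈ contraction q A, (blockEntries q A b).card ≤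
      k * k + ((if k ≤ (blockCols q A b).card then q * q else 0) +
        (if k ≤ (blockRows q A b).card then q * q else 0)) := by
    intro b _
    have h := card_blockEntries_le hq A b
    split_ifs with h1 h2 h2
    · omega
    · omega
    · omega
    · have h3 := Finset.card_le_card (blockEntries_subset q A b)
      rw [Finset.card_product] at h3
      have h4 := Nat.mul_le_mul (not_le.mp h2).le (not_le.mp h1).le
      omega
  rw [hsum]
  refine (Finset.sum_le_sum hb).trans (le_of_eq ?_)
  rw [Finset.sum_add_distrib, Finset.sum_add_distrib, ← Finset.sum_filter, ← Finset.sum_filter]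
  simp only [Finset.sum_const, smul_eq_mul, wideBlocks, tallBlocks]
  ring

/-- The **Füredi–Hajnal** bound for square matrices whose size is a power of `k ^ 2 + 1`. -/
theorem exists_card_le_of_not_matContains {k : ℕ} (τ : Equiv.Perm (Fin k)) :
    ∃ C : ℕ, 0 < C ∧ ∀ (j : ℕ) (A : Finset (ℕ × ℕ)),
      A ⊆ Finset.range ((k * k + 1) ^ j) ×ˢ Finset.range ((k * k + 1) ^ j) →
      ¬ MatContains τ A → A.card ≤ C * (k * k + 1) ^ j := by
  obtain ⟨q, hqk⟩ : ∃ q, q = k * k + 1 := ⟨_, rfl⟩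
  rw [← hqk]
  have hq : 0 < q := by omega
  refine ⟨q * q * (2 * (2 ^ q * k)) + 1, Nat.succ_pos _, fun j => ?_⟩
  induction j with
  | zero =>
    intro A hA _
    have := Finset.card_le_card hA
    simp only [pow_zero, Finset.card_product, Finset.card_range] at this ⊢
    omega
  | succ j ih =>
    intro A hA hτ
    rw [pow_succ'] at hA
    have h := card_le_of_blocks hq k A
    have hw := card_wideBlocks_le (k := k) hq hA hτ
    have ht := card_tallBlocks_le (k := k) hq hA hτ
    have hB := ih _ (contraction_subset hA) (fun hc => hτ hc.of_contraction)
    set N := q ^ j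
    set D := 2 ^ q * k
    have e1 := Nat.mul_le_mul_left (k * k) hB
    have e2 := Nat.mul_le_mul_left (q * q) (add_le_add hw ht)
    calc A.card ≤ _ := h
      _ ≤ k * k * ((q * q * (2 * D) + 1) * N) + q * q * (D * N + D * N) := add_le_add e1 e2
      _ ≤ k * k * ((q * q * (2 * D) + 1) * N) + (q * q * (2 * D) + 1) * N := by
        refine Nat.add_le_add_left ?_ _
        nlinarith [Nat.zero_le N]
      _ = (q * q * (2 * D) + 1) * q ^ (j + 1) := by
        rw [pow_succ]
        change _ = (q * q * (2 * D) + 1) * (N * q)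
        generalize q * q * (2 * D) + 1 = E
        rw [hqk]
        ring

open Classical in
/-- The 0-1 matrices of size `n × n` that avoid `τ`. -/
noncomputable def avoidMats {k : ℕ} (τ : Equiv.Perm (Fin k)) (n : ℕ) :
    Finset (Finset (ℕ × ℕ)) :=
  (Finset.range n ×ˢ Finset.range n).powerset.filter fun A => ¬ MatContains τ A

theorem mem_avoidMats {k : ℕ} {τ : Equiv.Perm (Fin k)} {n : ℕ} {A : Finset (ℕ × ℕ)} :
    A ∈ avoidMats τ n ↔ A ⊆ Finset.range n ×ˢ Finset.range n ∧ ¬ MatContains τ A := by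
  simp [avoidMats]

theorem card_fiber_contraction_le {q : ℕ} (hq : 0 < q) (s : Finset (Finset (ℕ × ℕ)))
    (B : Finset (ℕ × ℕ)) :
    (s.filter fun A => contraction q A = B).card ≤ 2 ^ (q * q * B.card) := by
  set U : Finset (ℕ × ℕ) := B.biUnion fun b =>
    Finset.Ico (b.1 * q) (b.1 * q + q) ×ˢ Finset.Ico (b.2 * q) (b.2 * q + q) with hU
  have hUc : U.card ≤ q * q * B.card := by
    rw [mul_comm]
    refine Finset.card_biUnion_le_card_mul _ _ _ fun b _ => ?_
    simp
  have hsub : (s.filter fun A => contraction q A = B) ⊆ U.powerset := by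
    intro A hA
    rw [Finset.mem_powerset]
    intro p hp
    rw [hU, Finset.mem_biUnion]
    refine ⟨blockOf q p, ?_, ?_⟩
    · rw [← (Finset.mem_filter.mp hA).2]
      exact Finset.mem_image_of_mem _ hp
    · simp only [blockOf, Finset.mem_product, Finset.mem_Ico]
      have h1 := Nat.div_add_mod' p.1 q
      have h2 := Nat.mod_lt p.1 hq
      have h3 := Nat.div_add_mod' p.2 q
      have h4 := Nat.mod_lt p.2 hq
      omega
  calc _ ≤ U.powerset.card := Finset.card_le_card hsub
    _ = 2 ^ U.card := Finset.card_powerset U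
    _ ≤ _ := Nat.pow_le_pow_right (by norm_num) hUc

theorem exists_card_avoidMats_le {k : ℕ} (hk : 1 ≤ k) (τ : Equiv.Perm (Fin k)) :
    ∃ M : ℕ, 0 < M ∧ ∀ j : ℕ,
      (avoidMats τ ((k * k + 1) ^ j)).card ≤ M ^ ((k * k + 1) ^ j) := by
  obtain ⟨C, hC, hbound⟩ := exists_card_le_of_not_matContains τ
  have hq2 : 2 ≤ k * k + 1 := by nlinarith
  generalize k * k + 1 = q at hbound hq2 ⊢
  have hq : 0 < q := by omega
  refine ⟨2 ^ (q * q * C), by positivity, fun j => ?_⟩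
  induction j with
  | zero =>
    calc _ ≤ (Finset.range (q ^ 0) ×ˢ Finset.range (q ^ 0)).powerset.card :=
          Finset.card_le_card fun A hA => Finset.mem_powerset.mpr (mem_avoidMats.mp hA).1
      _ = 2 ^ 1 := by simp
      _ ≤ 2 ^ (q * q * C) := Nat.pow_le_pow_right (by norm_num) (Nat.mul_pos (Nat.mul_pos hq hq) hC)
      _ = _ := by simp
  | succ j ih =>
    have hmaps : ∀ A ∈ avoidMats τ (q ^ (j + 1)), contraction q A ∈ avoidMats τ (q ^ j) := by
      intro A hA
      rw [mem_avoidMats, pow_succ'] at hA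
      rw [mem_avoidMats]
      exact ⟨contraction_subset hA.1, fun h => hA.2 h.of_contraction⟩
    have h := Finset.card_le_mul_card_image_of_maps_to hmaps (2 ^ (q * q * (C * q ^ j))) ?_
    · calc _ ≤ _ := h
        _ ≤ 2 ^ (q * q * (C * q ^ j)) * (2 ^ (q * q * C)) ^ q ^ j := Nat.mul_le_mul_left _ ih
        _ = (2 ^ (q * q * C)) ^ (q ^ j * 2) := by
          rw [← pow_mul, ← pow_mul, ← pow_add]
          congr 1
          ring
        _ ≤ (2 ^ (q * q * C)) ^ (q ^ (j + 1)) := by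
          rw [pow_succ]
          exact Nat.pow_le_pow_right (by positivity) (Nat.mul_le_mul_left _ hq2)
    · intro B hB
      refine (card_fiber_contraction_le hq _ B).trans
        (Nat.pow_le_pow_right (by norm_num) (Nat.mul_le_mul_left _ ?_))
      rw [mem_avoidMats] at hB
      exact hbound j B hB.1 hB.2

/-- The support of the permutation matrix of `π`. -/
def permSupport {n : ℕ} (π : Equiv.Perm (Fin n)) : Finset (ℕ × ℕ) :=
  Finset.univ.image fun i : Fin n => ((i : ℕ), (π i : ℕ))

theorem mem_permSupport {n : ℕ} {π : Equiv.Perm (Fin n)} {p : ℕ × ℕ} :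
    p ∈ permSupport π ↔ ∃ i : Fin n, (i : ℕ) = p.1 ∧ (π i : ℕ) = p.2 := by
  simp [permSupport, Prod.ext_iff]

theorem permSupport_injective {n : ℕ} :
    Function.Injective (permSupport : Equiv.Perm (Fin n) → Finset (ℕ × ℕ)) := by
  intro π σ h
  ext i
  have : ((i : ℕ), (π i : ℕ)) ∈ permSupport σ := h ▸ mem_permSupport.mpr ⟨i, rfl, rfl⟩
  obtain ⟨j, h1, h2⟩ := mem_permSupport.mp this
  exact h2.symm.trans (by rw [Fin.ext h1])

theorem pattContains_of_matContains {k n : ℕ} {τ : Equiv.Perm (Fin k)} {π : Equiv.Perm (Fin n)}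
    (h : MatContains τ (permSupport π)) : PattContains τ π := by
  obtain ⟨r, c, hr, hc, hA⟩ := h
  simp only [mem_permSupport] at hA
  choose f hf1 hf2 using hA
  refine ⟨f, fun a b hab => ?_, fun a b => ?_⟩
  · rw [Fin.lt_def, hf1, hf1]
    exact hr hab
  · rw [Fin.lt_def, hf2, hf2]
    exact hc.lt_iff_lt

theorem avoidCount_le_card_avoidMats {k : ℕ} (τ : Equiv.Perm (Fin k)) {n m : ℕ} (h : n ≤ m) :
    avoidCount τ n ≤ (avoidMats τ m).card := by
  have hmem : ∀ π : {π : Equiv.Perm (Fin n) // ¬ PattContains τ π},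
      permSupport π.1 ∈ avoidMats τ m := by
    intro π
    refine mem_avoidMats.mpr ⟨?_, fun hc => π.2 (pattContains_of_matContains hc)⟩
    intro p hp
    obtain ⟨i, h1, h2⟩ := mem_permSupport.mp hp
    rw [Finset.mem_product, Finset.mem_range, Finset.mem_range, ← h1, ← h2]
    exact ⟨i.2.trans_le h, (π.1 i).2.trans_le h⟩
  have := Nat.card_le_card_of_injective
    (fun π : {π : Equiv.Perm (Fin n) // ¬ PattContains τ π} =>
      (⟨permSupport π.1, hmem π⟩ : {A // A ∈ avoidMats τ m}))
    (fun π σ hπ => Subtype.ext (permSupport_injective (congrArg Subtype.val hπ)))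
  simpa [avoidCount] using this

theorem exists_avoidCount_le_pow {k : ℕ} (hk : 1 ≤ k) (τ : Equiv.Perm (Fin k)) :
    ∃ c : ℕ, 0 < c ∧ ∀ n, avoidCount τ n ≤ c ^ n := by
  obtain ⟨M, hM, hbound⟩ := exists_card_avoidMats_le hk τ
  have hq2 : 2 ≤ k * k + 1 := by nlinarith
  generalize k * k + 1 = q at hbound hq2
  refine ⟨M ^ q, by positivity, fun n => ?_⟩
  rcases Nat.eq_zero_or_pos n with rfl | hn
  · rw [pow_zero, avoidCount]
    exact Finite.card_le_one_iff_subsingleton.mpr inferInstance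
  · have h1 : n ≤ q ^ (Nat.log q n + 1) := (Nat.lt_pow_succ_log_self hq2 n).le
    calc avoidCount τ n ≤ _ := avoidCount_le_card_avoidMats τ h1
      _ ≤ M ^ (q ^ (Nat.log q n + 1)) := hbound _
      _ ≤ M ^ (q * n) := by
        refine Nat.pow_le_pow_right hM ?_
        rw [pow_succ']
        exact Nat.mul_le_mul_left _ (Nat.pow_log_le_self q hn.ne')
      _ = (M ^ q) ^ n := pow_mul _ _ _

/-- The direct sum of two permutations. -/
def directSum {m n : ℕ} (π : Equiv.Perm (Fin m)) (σ : Equiv.Perm (Fin n)) :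
    Equiv.Perm (Fin (m + n)) :=
  finSumFinEquiv.permCongr (Equiv.sumCongr π σ)

theorem directSum_castAdd {m n : ℕ} (π : Equiv.Perm (Fin m)) (σ : Equiv.Perm (Fin n))
    (i : Fin m) : directSum π σ (Fin.castAdd n i) = Fin.castAdd n (π i) := by
  simp [directSum, Equiv.permCongr_apply]

theorem directSum_natAdd {m n : ℕ} (π : Equiv.Perm (Fin m)) (σ : Equiv.Perm (Fin n))
    (i : Fin n) : directSum π σ (Fin.natAdd m i) = Fin.natAdd m (σ i) := by
  simp [directSum, Equiv.permCongr_apply]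

theorem directSum_injective {m n : ℕ} :
    Function.Injective fun p : Equiv.Perm (Fin m) × Equiv.Perm (Fin n) => directSum p.1 p.2 := by
  rintro ⟨π, σ⟩ ⟨π', σ'⟩ h
  have h' : directSum π σ = directSum π' σ' := h
  refine Prod.ext (Equiv.ext fun i => ?_) (Equiv.ext fun i => ?_)
  · have := congrArg (fun e => e (Fin.castAdd n i)) h'
    simpa [directSum_castAdd] using this
  · have := congrArg (fun e => e (Fin.natAdd m i)) h'
    simpa [directSum_natAdd] using this

theorem exists_castAdd_eq {m n : ℕ} {x : Fin (m + n)} (h : (x : ℕ) < m) :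
    ∃ i : Fin m, Fin.castAdd n i = x := ⟨⟨x, h⟩, rfl⟩

theorem exists_natAdd_eq {m n : ℕ} {x : Fin (m + n)} (h : m ≤ (x : ℕ)) :
    ∃ i : Fin n, Fin.natAdd m i = x :=
  ⟨⟨x - m, by omega⟩, Fin.ext (by simp; omega)⟩

theorem PattContains.of_directSum {k m n : ℕ} {τ : Equiv.Perm (Fin k)} {z l : Fin k}
    (hz : ∀ a, z ≤ a) (hl : ∀ a, a ≤ l) (hzl : τ l < τ z)
    {π : Equiv.Perm (Fin m)} {σ : Equiv.Perm (Fin n)} (h : PattContains τ (directSum π σ)) :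
    PattContains τ π ∨ PattContains τ σ := by
  obtain ⟨f, hf, hτ⟩ := h
  rcases lt_or_ge (f l : ℕ) m with hm | hm
  · left
    have hex : ∀ a, ∃ i : Fin m, Fin.castAdd n i = f a := fun a =>
      exists_castAdd_eq (lt_of_le_of_lt (Fin.le_def.mp (hf.monotone (hl a))) hm)
    choose g hg using hex
    refine ⟨g, fun a b hab => ?_, fun a b => ?_⟩
    · have := hf hab
      rw [← hg, ← hg] at this
      exact this
    · rw [← hτ, ← hg, ← hg, directSum_castAdd, directSum_castAdd]
      exact Iff.rfl
  · right
    have hz' : m ≤ (f z : ℕ) := by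
      by_contra! hc
      obtain ⟨i, hi⟩ := exists_castAdd_eq hc
      obtain ⟨j, hj⟩ := exists_natAdd_eq hm
      have := (hτ l z).mpr hzl
      rw [← hi, ← hj, directSum_castAdd, directSum_natAdd, Fin.lt_def] at this
      simp only [Fin.val_natAdd, Fin.val_castAdd] at this
      omega
    have hex : ∀ a, ∃ i : Fin n, Fin.natAdd m i = f a := fun a =>
      exists_natAdd_eq (hz'.trans (Fin.le_def.mp (hf.monotone (hz a))))
    choose g hg using hex
    refine ⟨g, fun a b hab => ?_, fun a b => ?_⟩
    · have := hf hab
      rw [← hg, ← hg] at this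
      simpa using this
    · rw [← hτ, ← hg, ← hg, directSum_natAdd, directSum_natAdd]
      simp

theorem avoidCount_mul_le_of_lt {k : ℕ} {τ : Equiv.Perm (Fin k)} {z l : Fin k}
    (hz : ∀ a, z ≤ a) (hl : ∀ a, a ≤ l) (hzl : τ l < τ z) (m n : ℕ) :
    avoidCount τ m * avoidCount τ n ≤ avoidCount τ (m + n) := by
  rw [avoidCount, avoidCount, ← Nat.card_prod]
  refine Nat.card_le_card_of_injective
    (fun p => ⟨directSum p.1.1 p.2.1, fun h => (h.of_directSum hz hl hzl).elim p.1.2 p.2.2⟩) ?_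
  intro p p' h
  have := directSum_injective (a₁ := (p.1.1, p.2.1)) (a₂ := (p'.1.1, p'.2.1))
    (congrArg Subtype.val h)
  exact Prod.ext (Subtype.ext (congrArg Prod.fst this)) (Subtype.ext (congrArg Prod.snd this))

theorem pattContains_rev_iff {k n : ℕ} {τ : Equiv.Perm (Fin k)} {π : Equiv.Perm (Fin n)} :
    PattContains (Fin.revPerm * τ) (Fin.revPerm * π) ↔ PattContains τ π := by
  simp only [PattContains, Equiv.Perm.mul_apply, Fin.revPerm_apply, Fin.rev_lt_rev]
  exact exists_congr fun f => and_congr_right fun _ => forall_comm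

theorem avoidCount_rev {k : ℕ} (τ : Equiv.Perm (Fin k)) (n : ℕ) :
    avoidCount (Fin.revPerm * τ) n = avoidCount τ n :=
  (Nat.card_congr ((Equiv.mulLeft Fin.revPerm).subtypeEquiv fun _ =>
    not_congr pattContains_rev_iff.symm)).symm

theorem avoidCount_mul_le {k : ℕ} (hk : 2 ≤ k) (τ : Equiv.Perm (Fin k)) (m n : ℕ) :
    avoidCount τ m * avoidCount τ n ≤ avoidCount τ (m + n) := by
  set z : Fin k := ⟨0, by omega⟩ with hz
  set l : Fin k := ⟨k - 1, by omega⟩ with hl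
  have hz' : ∀ a, z ≤ a := fun a => Fin.le_def.mpr (Nat.zero_le _)
  have hl' : ∀ a, a ≤ l := fun a => Fin.le_def.mpr (Nat.le_sub_one_of_lt a.2)
  have hne : τ l ≠ τ z := by
    rw [Ne, τ.injective.eq_iff, Fin.ext_iff]
    simp only [hz, hl]
    omega
  rcases hne.lt_or_gt with h | h
  · exact avoidCount_mul_le_of_lt hz' hl' h m n
  · rw [← avoidCount_rev τ m, ← avoidCount_rev τ n, ← avoidCount_rev τ (m + n)]
    refine avoidCount_mul_le_of_lt hz' hl' ?_ m n
    simpa using h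

theorem avoidCount_pos_of_lt {k n : ℕ} (τ : Equiv.Perm (Fin k)) (h : n < k) :
    0 < avoidCount τ n := by
  have : Nonempty {π : Equiv.Perm (Fin n) // ¬ PattContains τ π} :=
    ⟨1, fun ⟨f, hf, _⟩ => by
      have := Fintype.card_le_of_injective f hf.injective
      simp only [Fintype.card_fin] at this
      omega⟩
  exact Nat.card_pos

theorem avoidCount_pos {k : ℕ} (hk : 2 ≤ k) (τ : Equiv.Perm (Fin k)) (n : ℕ) :
    0 < avoidCount τ n := by
  induction n with
  | zero => exact avoidCount_pos_of_lt τ (by omega)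
  | succ n ih =>
    exact (Nat.mul_pos ih (avoidCount_pos_of_lt τ (by omega))).trans_le
      (avoidCount_mul_le hk τ n 1)

theorem avoidCount_one_eq_zero (τ : Equiv.Perm (Fin 1)) {n : ℕ} (hn : 0 < n) :
    avoidCount τ n = 0 := by
  have : IsEmpty {π : Equiv.Perm (Fin n) // ¬ PattContains τ π} :=
    ⟨fun π => π.2 ⟨fun _ => ⟨0, hn⟩, Subsingleton.strictMono _, fun a b => by
      simp [Subsingleton.elim a b]⟩⟩
  exact Nat.card_of_isEmpty

theorem tendsto_rpow_of_supermultiplicative {s : ℕ → ℕ} (hpos : ∀ n, 0 < s n)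
    (hmul : ∀ m n, s m * s n ≤ s (m + n)) {c : ℕ} (hle : ∀ n, s n ≤ c ^ n) :
    ∃ L : ℝ, Tendsto (fun n : ℕ => (s n : ℝ) ^ (1 / (n : ℝ))) atTop (nhds L) := by
  have hpos' : ∀ n, (0 : ℝ) < s n := fun n => by exact_mod_cast hpos n
  have hsub : Subadditive fun n => -Real.log (s n) := by
    intro m n
    have h : Real.log ((s m : ℝ) * s n) ≤ Real.log (s (m + n)) :=
      Real.log_le_log (mul_pos (hpos' m) (hpos' n)) (by exact_mod_cast hmul m n)
    rw [Real.log_mul (hpos' m).ne' (hpos' n).ne'] at h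
    linarith
  have hlogc : 0 ≤ Real.log c := Real.log_natCast_nonneg c
  have hbdd : BddBelow (Set.range fun n : ℕ => -Real.log (s n) / n) := by
    refine ⟨-Real.log c, ?_⟩
    rintro _ ⟨n, rfl⟩
    rcases Nat.eq_zero_or_pos n with rfl | hn
    · simpa using hlogc
    · have hn' : (0 : ℝ) < n := by exact_mod_cast hn
      have h : Real.log (s n) ≤ Real.log ((c : ℝ) ^ n) :=
        Real.log_le_log (hpos' n) (by exact_mod_cast hle n)
      rw [Real.log_pow] at h
      change -Real.log c ≤ -Real.log (s n) / n
      rw [le_div_iff₀ hn']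
      linarith
  refine ⟨Real.exp (-hsub.lim), ?_⟩
  refine ((Real.continuous_exp.tendsto _).comp (hsub.tendsto_lim hbdd).neg).congr fun n => ?_
  rw [Real.rpow_def_of_pos (hpos' n)]
  simp only [Function.comp_apply]
  congr 1
  ring

/-- Marcus–Tardos / Stanley–Wilf: for every pattern `τ`, the limit
`lim (s_n(τ))^(1/n)` exists and is finite; consequently the number of
`τ`-avoiding permutations grows at most exponentially. -/
theorem stmt_7 (k : ℕ) (hk : 1 ≤ k) (τ : Equiv.Perm (Fin k)) :
    (∃ L : ℝ, Tendsto (fun n : ℕ => (avoidCount τ n : ℝ) ^ (1 / (n : ℝ)))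
        atTop (nhds L)) ∧
    (∃ c : ℝ, 0 < c ∧ ∀ n : ℕ, (avoidCount τ n : ℝ) ≤ c ^ n) := by
  obtain ⟨c, hc, hle⟩ := exists_avoidCount_le_pow hk τ
  refine ⟨?_, c, by exact_mod_cast hc, fun n => by exact_mod_cast hle n⟩
  rcases hk.eq_or_lt with rfl | hk2
  · refine ⟨0, tendsto_const_nhds.congr' ?_⟩
    filter_upwards [eventually_gt_atTop 0] with n hn
    rw [avoidCount_one_eq_zero τ hn, Nat.cast_zero, Real.zero_rpow]
    have : (n : ℝ) ≠ 0 := by exact_mod_cast hn.ne'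
    simpa using this
  · exact tendsto_rpow_of_supermultiplicative (avoidCount_pos hk2 τ) (avoidCount_mul_le hk2 τ)
      hle
end

section
/- For every permutation τ of {1,2,3} and every n ≥ 0, the number of permutations of {1,…,n} avoiding the pattern τ equals the n-th Catalan number: s_n(τ) = C_n = (1/(n+1))·binom(2n, n). -/
open Finset Equiv

namespace PermPattern

/-! ### Reverse and complement -/

theorem PattContains.complement {k n : ℕ} {τ : Perm (Fin k)} {π : Perm (Fin n)}
    (h : PattContains τ π) : PattContains (Fin.revPerm * τ) (Fin.revPerm * π) := by
  obtain ⟨f, hf, h⟩ := h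
  refine ⟨f, hf, fun a b => ?_⟩
  simpa using h b a

theorem PattContains.reverse {k n : ℕ} {τ : Perm (Fin k)} {π : Perm (Fin n)}
    (h : PattContains τ π) : PattContains (τ * Fin.revPerm) (π * Fin.revPerm) := by
  obtain ⟨f, hf, h⟩ := h
  refine ⟨fun a => (f a.rev).rev, fun a b hab => ?_, fun a b => ?_⟩
  · simpa using hf (Fin.rev_lt_rev.2 hab)
  · simpa using h a.rev b.rev

theorem revPerm_mul_self (n : ℕ) : (Fin.revPerm : Perm (Fin n)) * Fin.revPerm = 1 := by
  ext; simp

theorem avoidCount_complement {k : ℕ} (τ : Perm (Fin k)) (n : ℕ) :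
    avoidCount (Fin.revPerm * τ) n = avoidCount τ n := by
  refine (Nat.card_congr ((Equiv.mulLeft Fin.revPerm).subtypeEquiv fun π => not_congr ?_)).symm
  refine ⟨PattContains.complement, fun h => ?_⟩
  have := PattContains.complement h
  simpa only [Equiv.coe_mulLeft, ← mul_assoc, revPerm_mul_self, one_mul] using this

theorem avoidCount_reverse {k : ℕ} (τ : Perm (Fin k)) (n : ℕ) :
    avoidCount (τ * Fin.revPerm) n = avoidCount τ n := by
  refine (Nat.card_congr ((Equiv.mulRight Fin.revPerm).subtypeEquiv fun π => not_congr ?_)).symm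
  refine ⟨PattContains.reverse, fun h => ?_⟩
  have := PattContains.reverse h
  simpa only [Equiv.coe_mulRight, mul_assoc, revPerm_mul_self, mul_one] using this

/-! ### The two basic patterns -/

theorem pattContains_one_iff {n : ℕ} (π : Perm (Fin n)) :
    PattContains (1 : Perm (Fin 3)) π ↔
      ∃ i j k, i < j ∧ j < k ∧ π i < π j ∧ π j < π k := by
  constructor
  · rintro ⟨f, hf, h⟩
    exact ⟨f 0, f 1, f 2, hf (by decide), hf (by decide), (h 0 1).2 (by decide),
      (h 1 2).2 (by decide)⟩
  · rintro ⟨i, j, k, hij, hjk, h₁, h₂⟩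
    refine ⟨![i, j, k], ?_, fun a b => ?_⟩
    · rw [Fin.strictMono_iff_lt_succ]
      intro a; fin_cases a <;> simpa
    · have := h₁.trans h₂
      fin_cases a <;> fin_cases b <;> simp [h₁, h₂, h₁.le, h₂.le, this, this.le]

theorem pattContains_swap_iff {n : ℕ} (π : Perm (Fin n)) :
    PattContains (swap 1 2 : Perm (Fin 3)) π ↔
      ∃ i j k, i < j ∧ j < k ∧ π i < π k ∧ π k < π j := by
  constructor
  · rintro ⟨f, hf, h⟩
    exact ⟨f 0, f 1, f 2, hf (by decide), hf (by decide), (h 0 2).2 (by decide),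
      (h 2 1).2 (by decide)⟩
  · rintro ⟨i, j, k, hij, hjk, h₁, h₂⟩
    refine ⟨![i, j, k], ?_, fun a b => ?_⟩
    · rw [Fin.strictMono_iff_lt_succ]
      intro a; fin_cases a <;> simpa
    · have h₃ := h₁.trans h₂
      have e0 : swap (1 : Fin 3) 2 0 = 0 := by decide
      fin_cases a <;> fin_cases b <;> simp [e0, h₁, h₂, h₁.le, h₂.le, h₃, h₃.le]

/-! ### Prepending an entry -/

/-- The permutation whose first entry is `p` and whose remaining entries are in the same
relative order as those of `σ`. -/
def prepend {n : ℕ} (p : Fin (n + 1)) (σ : Perm (Fin n)) : Perm (Fin (n + 1)) :=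
  (finSuccEquiv' 0).trans ((optionCongr σ).trans (finSuccEquiv' p).symm)

@[simp] theorem prepend_zero {n : ℕ} (p : Fin (n + 1)) (σ : Perm (Fin n)) :
    prepend p σ 0 = p := by
  simp [prepend]

@[simp] theorem prepend_succ {n : ℕ} (p : Fin (n + 1)) (σ : Perm (Fin n)) (i : Fin n) :
    prepend p σ i.succ = p.succAbove (σ i) := by
  have : finSuccEquiv' (0 : Fin (n + 1)) i.succ = some i := by
    rw [← Fin.succAbove_zero_apply, finSuccEquiv'_succAbove]
  simp [prepend, this]

theorem prepend_bijective (n : ℕ) :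
    Function.Bijective (fun x : Fin (n + 1) × Perm (Fin n) => prepend x.1 x.2) := by
  rw [Fintype.bijective_iff_injective_and_card]
  refine ⟨?_, by simp [Fintype.card_perm, Nat.factorial_succ]⟩
  rintro ⟨p, σ⟩ ⟨q, ρ⟩ h
  dsimp only at h
  have hpq : p = q := by simpa using congrArg (fun e => e 0) h
  subst hpq
  congr 1
  ext i : 1
  simpa using congrArg (fun e => e i.succ) h

theorem val_succAbove {n : ℕ} (p : Fin (n + 1)) (a : Fin n) :
    (p.succAbove a : ℕ) = if (a : ℕ) < p then (a : ℕ) else a + 1 := by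
  simp only [Fin.succAbove, Fin.lt_def, Fin.val_castSucc]
  split_ifs <;> simp

/-! ### The Catalan generating tree -/

/-- The number of nodes at depth `n` below a node labelled `k` in the generating tree in which a
node labelled `k` has children labelled `1, …, k + 1`. -/
def treeCount : ℕ → ℕ → ℕ
  | 0, _ => 1
  | n + 1, k => ∑ j ∈ range (k + 1), treeCount n (j + 1)

theorem treeCount_succ_succ (n k : ℕ) :
    treeCount (n + 1) (k + 1) = treeCount (n + 1) k + treeCount n (k + 2) := by
  simp [treeCount, sum_range_succ _ (k + 1)]

theorem treeCount_succ_add_choose (n k : ℕ) :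
    treeCount (n + 1) k + (2 * n + 2 + k).choose n = (2 * n + 2 + k).choose (n + 1) := by
  induction n generalizing k with
  | zero => simp [treeCount]; omega
  | succ n ih =>
    induction k with
    | zero =>
      have h := ih 1
      have h₁ : treeCount (n + 1 + 1) 0 = treeCount (n + 1) 1 := by
        conv_lhs => rw [treeCount]
        simp
      have h₂ : (2 * n + 3).choose (n + 1 + 1) = (2 * n + 3).choose (n + 1) :=
        Nat.choose_symm_of_eq_add (by omega)
      have e₁ := Nat.choose_succ_succ' (2 * n + 3) (n + 1)
      have e₂ := Nat.choose_succ_succ' (2 * n + 3) n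
      rw [show 2 * n + 2 + 1 = 2 * n + 3 by ring] at h
      rw [show 2 * (n + 1) + 2 + 0 = 2 * n + 3 + 1 by ring]
      omega
    | succ k ihk =>
      have h := ih (k + 2)
      have h₁ := treeCount_succ_succ (n + 1) k
      have e₁ := Nat.choose_succ_succ' (2 * n + 4 + k) (n + 1)
      have e₂ := Nat.choose_succ_succ' (2 * n + 4 + k) n
      rw [show 2 * n + 2 + (k + 2) = 2 * n + 4 + k by ring] at h
      rw [show 2 * (n + 1) + 2 + k = 2 * n + 4 + k by ring] at ihk
      rw [show 2 * (n + 1) + 2 + (k + 1) = 2 * n + 4 + k + 1 by ring]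
      omega

theorem treeCount_zero_right (n : ℕ) : treeCount n 0 = catalan n := by
  cases n with
  | zero => simp [treeCount]
  | succ n =>
    have h := treeCount_succ_add_choose n 0
    have hc := succ_mul_catalan_eq_centralBinom (n + 1)
    rw [Nat.centralBinom] at hc
    rw [add_zero, show 2 * n + 2 = 2 * (n + 1) by ring] at h
    have h₁ := Nat.choose_succ_right_eq (2 * (n + 1)) n
    rw [show 2 * (n + 1) - n = n + 2 by omega] at h₁
    have : 0 < n + 1 + 1 := by omega
    refine Nat.eq_of_mul_eq_mul_left this ?_
    nlinarith

open Classical in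
/-- A class of permutations whose members, grown by prepending entries, follow the Catalan
generating tree is counted by the Catalan numbers. -/
theorem card_eq_catalan_of_generating_tree (A : ∀ {n : ℕ}, Perm (Fin n) → Prop)
    (label : ∀ {n : ℕ}, Perm (Fin n) → ℕ)
    (hA₀ : ∀ σ : Perm (Fin 0), A σ) (hlabel₀ : ∀ σ : Perm (Fin 0), label σ = 0)
    (hA : ∀ {n : ℕ} (p : Fin (n + 1)) (σ : Perm (Fin n)), A (prepend p σ) → A σ)
    (hlabel : ∀ {n : ℕ} (σ : Perm (Fin n)), A σ → ∀ g : ℕ → ℕ,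
      ∑ p with A (prepend p σ), g (label (prepend p σ)) = ∑ j ∈ range (label σ + 1), g (j + 1))
    (n : ℕ) : Nat.card {π : Perm (Fin n) // A π} = catalan n := by
  have key : ∀ n m : ℕ,
      ∑ σ : Perm (Fin n) with A σ, treeCount m (label σ) = treeCount (n + m) 0 := by
    intro n
    induction n with
    | zero => intro m; simp [hA₀, hlabel₀]
    | succ n ih =>
      intro m
      rw [show n + 1 + m = n + (m + 1) by ring, ← ih (m + 1), sum_filter,
        ← (prepend_bijective n).sum_comp, Fintype.sum_prod_type_right, sum_filter]
      refine sum_congr rfl fun σ _ => ?_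
      split_ifs with h
      · rw [treeCount, ← hlabel σ h, sum_filter]
      · exact sum_eq_zero fun p _ => if_neg fun h' => h (hA p σ h')
  have := key n 0
  rw [Nat.card_eq_fintype_card, Fintype.card_subtype, ← treeCount_zero_right]
  simpa [treeCount] using this

/-! ### Avoiding 123 -/

/-- The least `s` such that every entry of `σ` that starts an ascending pair is below `s`. -/
def ascThreshold {n : ℕ} (σ : Perm (Fin n)) : ℕ :=
  univ.sup fun x : Fin n × Fin n => if x.1 < x.2 ∧ σ x.1 < σ x.2 then (σ x.1 : ℕ) + 1 else 0

theorem ascThreshold_le_iff {n : ℕ} (σ : Perm (Fin n)) (s : ℕ) :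
    ascThreshold σ ≤ s ↔ ∀ i j, i < j → σ i < σ j → (σ i : ℕ) < s := by
  simp only [ascThreshold, Finset.sup_le_iff, mem_univ, true_imp_iff, Prod.forall]
  refine forall₂_congr fun i j => ?_
  split_ifs with h
  · simp [h]
  · simp only [Nat.zero_le, true_iff]
    exact fun h₁ h₂ => absurd ⟨h₁, h₂⟩ h

theorem ascThreshold_le {n : ℕ} (σ : Perm (Fin n)) : ascThreshold σ ≤ n :=
  (ascThreshold_le_iff σ n).2 fun i _ _ _ => (σ i).2

theorem ascThreshold_prepend_le_iff {n : ℕ} (p : Fin (n + 1)) (σ : Perm (Fin n)) (s : ℕ) :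
    ascThreshold (prepend p σ) ≤ s ↔ ((p : ℕ) < n → (p : ℕ) < s) ∧
      ∀ i j, i < j → σ i < σ j → (p.succAbove (σ i) : ℕ) < s := by
  rw [ascThreshold_le_iff]
  simp only [Fin.forall_fin_succ, Fin.not_lt_zero, false_imp_iff, true_and, Fin.succ_pos,
    true_imp_iff, prepend_zero, prepend_succ, Fin.succ_lt_succ_iff,
    (Fin.strictMono_succAbove p).lt_iff_lt]
  refine and_congr ⟨fun h hp => ?_, fun h j hj => h ?_⟩ Iff.rfl
  · refine h (σ.symm ⟨p, hp⟩) ?_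
    rw [Fin.lt_def, val_succAbove]
    simp
  · have := (p.succAbove (σ j)).2
    rw [Fin.lt_def] at hj
    omega

theorem avoids_one_prepend_iff {n : ℕ} (p : Fin (n + 1)) (σ : Perm (Fin n)) :
    ¬ PattContains (1 : Perm (Fin 3)) (prepend p σ) ↔
      ¬ PattContains (1 : Perm (Fin 3)) σ ∧ ascThreshold σ ≤ p := by
  rw [ascThreshold_le_iff, pattContains_one_iff, pattContains_one_iff]
  push Not
  simp only [Fin.forall_fin_succ, Fin.not_lt_zero, false_imp_iff, true_and, Fin.succ_pos,
    true_imp_iff, prepend_zero, prepend_succ, Fin.succ_lt_succ_iff, implies_true,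
    Fin.succAbove_le_succAbove_iff, (Fin.strictMono_succAbove p).lt_iff_lt]
  rw [and_comm]
  refine and_congr Iff.rfl (forall₂_congr fun i j => ?_)
  simp only [Fin.lt_def, Fin.le_def, val_succAbove]
  constructor <;>
  · intro h h₁ h₂
    by_contra h₃
    have := h h₁
    grind

theorem ascThreshold_prepend {n : ℕ} (p : Fin (n + 1)) (σ : Perm (Fin n))
    (h : ascThreshold σ ≤ p) :
    ascThreshold (prepend p σ) = if (p : ℕ) = n then ascThreshold σ else (p : ℕ) + 1 := by
  refine eq_of_forall_ge_iff fun s => ?_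
  rw [ascThreshold_prepend_le_iff]
  rw [ascThreshold_le_iff] at h
  have hp := p.is_le
  split_ifs with hpn
  · rw [ascThreshold_le_iff]
    simp only [val_succAbove, hpn, lt_irrefl, false_imp_iff, true_and, Fin.is_lt, if_true]
  · constructor
    · intro h'; have := h'.1; omega
    · refine fun h' => ⟨fun _ => h', fun i j h₁ h₂ => ?_⟩
      have := h i j h₁ h₂
      rw [val_succAbove, if_pos this]
      omega

theorem avoidCount_one (n : ℕ) : avoidCount (1 : Perm (Fin 3)) n = catalan n := by
  refine card_eq_catalan_of_generating_tree (fun π => ¬ PattContains (1 : Perm (Fin 3)) π)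
    (fun {n} σ => n - ascThreshold σ) (fun σ => ?_) (fun σ => by simp)
    (fun p σ h => ((avoids_one_prepend_iff p σ).1 h).1) (fun {n} σ hσ g => ?_) n
  · rw [pattContains_one_iff]
    rintro ⟨i, -⟩
    exact i.elim0
  · have ht := ascThreshold_le σ
    simp only [avoids_one_prepend_iff, hσ, not_false_eq_true, true_and]
    refine sum_bij' (fun p _ => if (p : ℕ) = n then n - ascThreshold σ else n - 1 - p)
      (fun j _ => if j = n - ascThreshold σ then Fin.last n else ⟨n - 1 - j, by omega⟩)
      ?_ ?_ ?_ ?_ ?_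
    · intro p hp
      have := p.is_le
      simp only [mem_filter, mem_univ, true_and, mem_range] at hp ⊢
      split_ifs <;> omega
    · intro j hj
      simp only [mem_filter, mem_univ, true_and, mem_range] at hj ⊢
      split_ifs <;> simp <;> omega
    · intro p hp
      have := p.is_le
      simp only [mem_filter, mem_univ, true_and] at hp
      ext
      split_ifs <;> simp <;> omega
    · intro j hj
      simp only [mem_range] at hj
      split_ifs <;> simp_all <;> omega
    · intro p hp
      have := p.is_le
      simp only [mem_filter, mem_univ, true_and] at hp
      rw [ascThreshold_prepend p σ hp]
      congr 1
      split_ifs <;> omega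

/-! ### Avoiding 132 -/

/-- The least `s` such that every entry of `σ` that ends a descending pair is below `s`. -/
def descThreshold {n : ℕ} (σ : Perm (Fin n)) : ℕ :=
  univ.sup fun x : Fin n × Fin n => if x.1 < x.2 ∧ σ x.2 < σ x.1 then (σ x.2 : ℕ) + 1 else 0

theorem descThreshold_le_iff {n : ℕ} (σ : Perm (Fin n)) (s : ℕ) :
    descThreshold σ ≤ s ↔ ∀ i j, i < j → σ j < σ i → (σ j : ℕ) < s := by
  simp only [descThreshold, Finset.sup_le_iff, mem_univ, true_imp_iff, Prod.forall]
  refine forall₂_congr fun i j => ?_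
  split_ifs with h
  · simp [h]
  · simp only [Nat.zero_le, true_iff]
    exact fun h₁ h₂ => absurd ⟨h₁, h₂⟩ h

theorem descThreshold_le {n : ℕ} (σ : Perm (Fin n)) : descThreshold σ ≤ n :=
  (descThreshold_le_iff σ n).2 fun _ j _ _ => (σ j).2

theorem avoids_swap_prepend_iff {n : ℕ} (p : Fin (n + 1)) (σ : Perm (Fin n)) :
    ¬ PattContains (swap 1 2 : Perm (Fin 3)) (prepend p σ) ↔
      ¬ PattContains (swap 1 2 : Perm (Fin 3)) σ ∧ descThreshold σ ≤ p := by
  rw [descThreshold_le_iff, pattContains_swap_iff, pattContains_swap_iff]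
  push Not
  simp only [Fin.forall_fin_succ, Fin.not_lt_zero, false_imp_iff, true_and, Fin.succ_pos,
    true_imp_iff, prepend_zero, prepend_succ, Fin.succ_lt_succ_iff, implies_true,
    Fin.succAbove_le_succAbove_iff, (Fin.strictMono_succAbove p).lt_iff_lt]
  rw [and_comm]
  refine and_congr Iff.rfl (forall₂_congr fun i j => ?_)
  simp only [Fin.lt_def, Fin.le_def, val_succAbove]
  constructor <;>
  · intro h h₁ h₂
    by_contra h₃
    have := h h₁
    grind

theorem descThreshold_prepend {n : ℕ} (p : Fin (n + 1)) (σ : Perm (Fin n))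
    (h : descThreshold σ ≤ p) : descThreshold (prepend p σ) = p := by
  refine eq_of_forall_ge_iff fun s => ?_
  rw [descThreshold_le_iff] at h ⊢
  have hp := p.is_le
  simp only [Fin.forall_fin_succ, Fin.not_lt_zero, false_imp_iff, true_and, Fin.succ_pos,
    true_imp_iff, prepend_zero, prepend_succ, Fin.succ_lt_succ_iff,
    (Fin.strictMono_succAbove p).lt_iff_lt]
  constructor
  · rintro ⟨h', -⟩
    by_contra hs
    have := h' (σ.symm ⟨p - 1, by omega⟩)
    rw [Fin.lt_def, val_succAbove] at this
    simp only [apply_symm_apply] at this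
    rw [if_pos (by omega)] at this
    omega
  · refine fun hs => ⟨fun j hj => ?_, fun i j h₁ h₂ => ?_⟩
    · rw [Fin.lt_def] at hj
      omega
    · have := h i j h₁ h₂
      rw [val_succAbove, if_pos this]
      omega

theorem avoidCount_swap (n : ℕ) : avoidCount (swap 1 2 : Perm (Fin 3)) n = catalan n := by
  refine card_eq_catalan_of_generating_tree
    (fun π => ¬ PattContains (swap 1 2 : Perm (Fin 3)) π)
    (fun {n} σ => n - descThreshold σ) (fun σ => ?_) (fun σ => by simp)
    (fun p σ h => ((avoids_swap_prepend_iff p σ).1 h).1) (fun {n} σ hσ g => ?_) n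
  · rw [pattContains_swap_iff]
    rintro ⟨i, -⟩
    exact i.elim0
  · have ht := descThreshold_le σ
    simp only [avoids_swap_prepend_iff, hσ, not_false_eq_true, true_and]
    refine sum_bij' (fun p _ => n - p) (fun j _ => ⟨n - j, by omega⟩) ?_ ?_ ?_ ?_ ?_
    · intro p hp
      simp only [mem_filter, mem_univ, true_and, mem_range] at hp ⊢
      omega
    · intro j hj
      simp only [mem_filter, mem_univ, true_and, mem_range] at hj ⊢
      omega
    · intro p hp
      have := p.is_le
      ext
      simp only
      omega
    · intro j hj
      simp only [mem_range] at hj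
      simp only
      omega
    · intro p hp
      have := p.is_le
      simp only [mem_filter, mem_univ, true_and] at hp
      rw [descThreshold_prepend p σ hp]
      congr 1
      omega

theorem perm_fin_three_cases : ∀ τ : Perm (Fin 3),
    τ = 1 ∨ τ = Fin.revPerm * 1 ∨ τ = swap 1 2 ∨ τ = Fin.revPerm * swap 1 2 ∨
      τ = swap 1 2 * Fin.revPerm ∨ τ = Fin.revPerm * (swap 1 2 * Fin.revPerm) := by
  decide

theorem avoidCount_eq_catalan (τ : Perm (Fin 3)) (n : ℕ) : avoidCount τ n = catalan n := by
  rcases perm_fin_three_cases τ with rfl | rfl | rfl | rfl | rfl | rfl <;>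
    simp only [avoidCount_complement, avoidCount_reverse, avoidCount_one, avoidCount_swap]

end PermPattern

/-- Every pattern of length 3 is avoided by exactly the Catalan number
`C_n = (1/(n+1)) * binom(2n, n)` of permutations of `{1, …, n}`. -/
theorem stmt_8 (τ : Equiv.Perm (Fin 3)) (n : ℕ) :
    avoidCount τ n = catalan n ∧
    (n + 1) * avoidCount τ n = Nat.choose (2 * n) n := by
  rw [PermPattern.avoidCount_eq_catalan]
  exact ⟨rfl, succ_mul_catalan_eq_centralBinom n⟩
end

section
/- (Gessel) The number s_n(1234) of permutations of {1,…,n} avoiding the pattern 1234 satisfies the asymptotic formula s_n(1234) ∼ (81√3/(16π)) · 9^n · n^{−4} as n → ∞; that is, lim_{n→∞} s_n(1234) · 16π n^4 / (81√3 · 9^n) = 1. -/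
open Filter

/-- The pattern `1234`, i.e. the identity permutation of `{1,2,3,4}`. -/
def patt1234 : Equiv.Perm (Fin 4) := Equiv.refl (Fin 4)

/-- `π` has an increasing subsequence of length `k` all of whose values are below `V`. -/
def HasInc (k : ℕ) {n : ℕ} (π : Equiv.Perm (Fin n)) (V : ℕ) : Prop :=
  ∃ f : Fin k → Fin n, StrictMono f ∧ StrictMono (π ∘ f) ∧ ∀ i, (π (f i) : ℕ) < V

lemma pattContains_patt1234_iff {n : ℕ} (π : Equiv.Perm (Fin n)) :
    PattContains patt1234 π ↔ HasInc 4 π n := by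
  constructor
  · rintro ⟨f, hf, h⟩
    exact ⟨f, hf, fun a b hab => (h a b).2 hab, fun i => (π (f i)).isLt⟩
  · rintro ⟨f, hf, h, -⟩
    exact ⟨f, hf, fun a b => h.lt_iff_lt⟩

lemma HasInc.mono {k n : ℕ} {π : Equiv.Perm (Fin n)} {V W : ℕ} (h : HasInc k π V) (hVW : V ≤ W) :
    HasInc k π W := by
  obtain ⟨f, hf, hf', hV⟩ := h
  exact ⟨f, hf, hf', fun i => (hV i).trans_le hVW⟩

lemma HasInc.of_succ {k n : ℕ} {π : Equiv.Perm (Fin n)} {V : ℕ} (h : HasInc (k + 1) π V) :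
    HasInc k π V := by
  obtain ⟨f, hf, hf', hV⟩ := h
  exact ⟨f ∘ Fin.castSucc, hf.comp Fin.strictMono_castSucc, hf'.comp Fin.strictMono_castSucc,
    fun i => hV i.castSucc⟩

lemma not_hasInc_zero (k : ℕ) {n : ℕ} (π : Equiv.Perm (Fin n)) : ¬ HasInc (k + 1) π 0 := by
  rintro ⟨f, -, -, h⟩
  exact absurd (h 0) (Nat.not_lt_zero _)

lemma hasInc_one_iff {n : ℕ} (π : Equiv.Perm (Fin n)) {V : ℕ} (hV : V ≤ n) :
    HasInc 1 π V ↔ 0 < V := by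
  constructor
  · rintro ⟨f, -, -, h⟩
    exact (Nat.zero_le _).trans_lt (h 0)
  · intro h
    refine ⟨fun _ => π.symm ⟨0, h.trans_le hV⟩, ?_, ?_, fun i => by simpa using h⟩ <;>
    exact Subsingleton.strictMono _

/-- Append the value `v` at the end of `σ`, shifting up the values `≥ v`. -/
def appendVal {n : ℕ} (v : Fin (n + 1)) (σ : Equiv.Perm (Fin n)) : Equiv.Perm (Fin (n + 1)) :=
  (finSuccEquiv' (Fin.last n)).trans ((Equiv.optionCongr σ).trans (finSuccEquiv' v).symm)

@[simp] lemma appendVal_last {n : ℕ} (v : Fin (n + 1)) (σ : Equiv.Perm (Fin n)) :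
    appendVal v σ (Fin.last n) = v := by
  simp [appendVal]

@[simp] lemma appendVal_castSucc {n : ℕ} (v : Fin (n + 1)) (σ : Equiv.Perm (Fin n)) (i : Fin n) :
    appendVal v σ i.castSucc = v.succAbove (σ i) := by
  simp [appendVal, finSuccEquiv'_last_apply_castSucc]

lemma appendVal_bijective (n : ℕ) :
    Function.Bijective
      (fun x : Equiv.Perm (Fin n) × Fin (n + 1) => appendVal x.2 x.1) := by
  rw [Fintype.bijective_iff_injective_and_card]
  constructor
  · rintro ⟨σ, v⟩ ⟨τ, w⟩ h
    have hvw : v = w := by simpa using DFunLike.congr_fun h (Fin.last n)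
    subst hvw
    refine Prod.ext (Equiv.ext fun i => ?_) rfl
    simpa using DFunLike.congr_fun h i.castSucc
  · simp [Fintype.card_perm, Nat.factorial_succ, mul_comm]

lemma succAbove_val_lt_iff {n : ℕ} (v : Fin (n + 1)) (a : Fin n) (V : ℕ) :
    (v.succAbove a : ℕ) < V ↔ (a : ℕ) < if V ≤ v then V else V - 1 := by
  unfold Fin.succAbove
  split_ifs <;> simp_all [Fin.lt_def] <;> omega

lemma hasInc_appendVal_iff {k n : ℕ} (v : Fin (n + 1)) (σ : Equiv.Perm (Fin n)) (V : ℕ) :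
    HasInc (k + 1) (appendVal v σ) V ↔
      HasInc (k + 1) σ (if V ≤ v then V else V - 1) ∨ (HasInc k σ v ∧ (v : ℕ) < V) := by
  constructor
  · rintro ⟨f, hf, hf', hV⟩
    by_cases hlast : f (Fin.last k) = Fin.last n
    · right
      have hne (i : Fin k) : f i.castSucc ≠ Fin.last n := by
        rw [← hlast]
        exact (hf (Fin.castSucc_lt_last i)).ne
      choose g hg using fun i => Fin.exists_castSucc_eq.2 (hne i)
      refine ⟨⟨g, fun a b hab => ?_, fun a b hab => ?_, fun i => ?_⟩, ?_⟩
      · have := hf (Fin.castSucc_lt_castSucc_iff.2 hab)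
        rwa [← hg, ← hg, Fin.castSucc_lt_castSucc_iff] at this
      · have := hf' (Fin.castSucc_lt_castSucc_iff.2 hab)
        simpa [← hg] using this
      · have := hf' (Fin.castSucc_lt_last i)
        simp only [Function.comp_apply, hlast, ← hg, appendVal_last, appendVal_castSucc] at this
        rw [Fin.lt_def, succAbove_val_lt_iff] at this
        simpa using this
      · simpa [hlast] using hV (Fin.last k)
    · left
      have hne (i : Fin (k + 1)) : f i ≠ Fin.last n := by
        intro h
        exact hlast (Fin.last_le_iff.1 (h ▸ hf.monotone (Fin.le_last i)))
      choose g hg using fun i => Fin.exists_castSucc_eq.2 (hne i)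
      refine ⟨g, fun a b hab => ?_, fun a b hab => ?_, fun i => ?_⟩
      · have := hf hab
        rwa [← hg, ← hg, Fin.castSucc_lt_castSucc_iff] at this
      · have := hf' hab
        simpa [← hg] using this
      · have := hV i
        rwa [← hg, appendVal_castSucc, succAbove_val_lt_iff] at this
  · rintro (⟨g, hg, hg', hV⟩ | ⟨⟨g, hg, hg', hV⟩, hvV⟩)
    · refine ⟨Fin.castSucc ∘ g, Fin.strictMono_castSucc.comp hg, fun a b hab => ?_, fun i => ?_⟩
      · simpa using hg' hab
      · simpa [succAbove_val_lt_iff] using hV i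
    · have hlt (i : Fin k) : v.succAbove (σ (g i)) < v := by
        rw [Fin.lt_def, succAbove_val_lt_iff]
        simpa using hV i
      refine ⟨Fin.snoc (α := fun _ => Fin (n + 1)) (Fin.castSucc ∘ g) (Fin.last n),
        fun a b hab => ?_, fun a b hab => ?_, fun i => ?_⟩
      · induction b using Fin.lastCases with
        | last =>
          obtain ⟨a, rfl⟩ := Fin.exists_castSucc_eq.2 hab.ne
          simp
        | cast b =>
          obtain ⟨a, rfl⟩ := Fin.exists_castSucc_eq.2 (hab.trans (Fin.castSucc_lt_last b)).ne
          simpa using hg (Fin.castSucc_lt_castSucc_iff.1 hab)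
      · induction b using Fin.lastCases with
        | last =>
          obtain ⟨a, rfl⟩ := Fin.exists_castSucc_eq.2 hab.ne
          simpa using hlt a
        | cast b =>
          obtain ⟨a, rfl⟩ := Fin.exists_castSucc_eq.2 (hab.trans (Fin.castSucc_lt_last b)).ne
          simpa using hg' (Fin.castSucc_lt_castSucc_iff.1 hab)
      · induction i using Fin.lastCases with
        | last => simpa using hvV
        | cast i => simpa using (Fin.lt_def.1 (hlt i)).trans hvV

open Classical in
/-- The least final value of an increasing subsequence of length `k` in `π`, or `n` if there is
none. -/
noncomputable def minTop (k : ℕ) {n : ℕ} (π : Equiv.Perm (Fin n)) : ℕ :=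
  Nat.findGreatest (fun V => ¬ HasInc k π V) n

open Classical in
lemma minTop_le (k : ℕ) {n : ℕ} (π : Equiv.Perm (Fin n)) : minTop k π ≤ n :=
  Nat.findGreatest_le n

lemma hasInc_iff_minTop_lt {k n : ℕ} (π : Equiv.Perm (Fin n)) {V : ℕ} (hV : V ≤ n) :
    HasInc (k + 1) π V ↔ minTop (k + 1) π < V := by
  classical
  constructor
  · intro h
    by_contra! hle
    exact Nat.findGreatest_spec (P := fun V => ¬ HasInc (k + 1) π V) (Nat.zero_le n)
      (not_hasInc_zero k π) (h.mono hle)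
  · intro h
    by_contra hc
    exact absurd (Nat.le_findGreatest (P := fun V => ¬ HasInc (k + 1) π V) hV hc) h.not_ge

lemma minTop_eq_of_forall {k n : ℕ} {π : Equiv.Perm (Fin n)} {w : ℕ} (hw : w ≤ n)
    (h : ∀ V ≤ n, HasInc (k + 1) π V ↔ w < V) : minTop (k + 1) π = w := by
  have h₁ := (h _ (minTop_le (k + 1) π)).symm.trans (hasInc_iff_minTop_lt π (minTop_le _ π))
  have h₂ := (h w hw).symm.trans (hasInc_iff_minTop_lt π hw)
  omega

lemma minTop_le_minTop_succ (k : ℕ) {n : ℕ} (π : Equiv.Perm (Fin n)) :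
    minTop (k + 1) π ≤ minTop (k + 2) π := by
  by_contra! h
  have := ((hasInc_iff_minTop_lt (k := k + 1) π (minTop_le (k + 1) π)).2 h).of_succ
  exact lt_irrefl _ ((hasInc_iff_minTop_lt π (minTop_le (k + 1) π)).1 this)

lemma minTop_appendVal_of_hasInc {k n : ℕ} (v : Fin (n + 1)) (σ : Equiv.Perm (Fin n))
    (h : HasInc k σ v) (hv : (v : ℕ) ≤ minTop (k + 1) σ) :
    minTop (k + 1) (appendVal v σ) = v := by
  refine minTop_eq_of_forall v.is_le' fun V hV => ?_
  have hle := minTop_le (k + 1) σ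
  rw [hasInc_appendVal_iff, hasInc_iff_minTop_lt σ (by split_ifs <;> omega)]
  simp only [h, true_and]
  split_ifs <;> omega

lemma minTop_appendVal_of_not_hasInc {k n : ℕ} (v : Fin (n + 1)) (σ : Equiv.Perm (Fin n))
    (h : ¬ HasInc k σ v) (hv : (v : ℕ) ≤ minTop (k + 1) σ) :
    minTop (k + 1) (appendVal v σ) = minTop (k + 1) σ + 1 := by
  have hle := minTop_le (k + 1) σ
  refine minTop_eq_of_forall (by omega) fun V hV => ?_
  rw [hasInc_appendVal_iff, hasInc_iff_minTop_lt σ (by split_ifs <;> omega)]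
  simp only [h, false_and, or_false]
  split_ifs <;> omega

lemma minTop_appendVal_of_lt {k n : ℕ} (v : Fin (n + 1)) (σ : Equiv.Perm (Fin n))
    (hv : minTop (k + 1) σ < (v : ℕ)) :
    minTop (k + 1) (appendVal v σ) = minTop (k + 1) σ := by
  have hle := minTop_le (k + 1) σ
  refine minTop_eq_of_forall (by omega) fun V hV => ?_
  rw [hasInc_appendVal_iff, hasInc_iff_minTop_lt σ (by split_ifs <;> omega)]
  split_ifs <;> omega

/-- The succession rule of the generating tree of `1234`-avoiding permutations, acting on functions
of the two labels. -/
def treeStep {M : Type*} [AddCommMonoid M] (f : ℕ → ℕ → M) (p q : ℕ) : M :=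
  f (p + 1) (q + 1) + ∑ i ∈ Finset.Ioc 0 p, f i (q + 1) + ∑ j ∈ Finset.Ioc p q, f p j

/-- The number of nodes at depth `n` below a node with labels `(p, q)`. -/
def treeCount : ℕ → ℕ → ℕ → ℕ
  | 0 => fun _ _ => 1
  | n + 1 => treeStep (treeCount n)

open Classical in
lemma sum_appendVal {n : ℕ} (σ : Equiv.Perm (Fin n)) (hσ : ¬ HasInc 4 σ n) (f : ℕ → ℕ → ℕ) :
    ∑ v : Fin (n + 1), (if HasInc 4 (appendVal v σ) (n + 1) then 0 else
      f (minTop 2 (appendVal v σ)) (minTop 3 (appendVal v σ))) =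
      treeStep f (minTop 2 σ) (minTop 3 σ) := by
  have hpq : minTop 2 σ ≤ minTop 3 σ := minTop_le_minTop_succ 1 σ
  have hqn := minTop_le 3 σ
  have hval (v : Fin (n + 1)) : (if HasInc 4 (appendVal v σ) (n + 1) then 0 else
      f (minTop 2 (appendVal v σ)) (minTop 3 (appendVal v σ))) =
      (fun v : ℕ => if minTop 3 σ < v then 0 else if minTop 2 σ < v then f (minTop 2 σ) v else
        if 0 < v then f v (minTop 3 σ + 1) else f (minTop 2 σ + 1) (minTop 3 σ + 1)) v := by
    have hvn : (v : ℕ) ≤ n := v.is_le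
    have h4 : HasInc 4 (appendVal v σ) (n + 1) ↔ minTop 3 σ < v := by
      rw [hasInc_appendVal_iff, if_neg (by omega), Nat.add_sub_cancel,
        hasInc_iff_minTop_lt (k := 2) σ hvn]
      simp only [hσ, false_or, Nat.reduceAdd]
      omega
    have h2 : HasInc 2 σ v ↔ minTop 2 σ < v := hasInc_iff_minTop_lt σ hvn
    have h1 := hasInc_one_iff σ hvn
    simp only [h4]
    split_ifs with hq hp h0
    · rfl
    · rw [minTop_appendVal_of_lt (k := 1) v σ hp,
        minTop_appendVal_of_hasInc (k := 2) v σ (h2.2 hp) (not_lt.1 hq)]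
    · rw [minTop_appendVal_of_hasInc (k := 1) v σ (h1.2 h0) (not_lt.1 hp),
        minTop_appendVal_of_not_hasInc (k := 2) v σ (fun h => hp (h2.1 h)) (not_lt.1 hq)]
    · rw [minTop_appendVal_of_not_hasInc (k := 1) v σ (fun h => h0 (h1.1 h)) (not_lt.1 hp),
        minTop_appendVal_of_not_hasInc (k := 2) v σ (fun h => hp (h2.1 h)) (not_lt.1 hq)]
  rw [Finset.sum_congr rfl fun v _ => hval v, Fin.sum_univ_eq_sum_range (fun v : ℕ =>
    if minTop 3 σ < v then 0 else if minTop 2 σ < v then f (minTop 2 σ) v else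
      if 0 < v then f v (minTop 3 σ + 1) else f (minTop 2 σ + 1) (minTop 3 σ + 1))]
  generalize minTop 2 σ = p at *
  generalize minTop 3 σ = q at *
  have hr : Finset.range (n + 1) =
      ({0} ∪ Finset.Ioc 0 p) ∪ Finset.Ioc p q ∪ Finset.Ioc q n := by
    ext i
    simp only [Finset.mem_range, Finset.mem_union, Finset.mem_singleton, Finset.mem_Ioc]
    omega
  rw [hr, Finset.sum_union, Finset.sum_union, Finset.sum_union, Finset.sum_singleton, treeStep]
  · rw [Finset.sum_eq_zero (s := Finset.Ioc q n), add_zero]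
    · refine congrArg₂ (· + ·) (congrArg₂ (· + ·) (by simp) ?_) ?_
      · refine Finset.sum_congr rfl fun i hi => ?_
        rw [Finset.mem_Ioc] at hi
        rw [if_neg (by omega), if_neg (by omega), if_pos hi.1]
      · refine Finset.sum_congr rfl fun i hi => ?_
        rw [Finset.mem_Ioc] at hi
        rw [if_neg (by omega), if_pos hi.1]
    · intro i hi
      rw [if_pos (Finset.mem_Ioc.1 hi).1]
  all_goals
    rw [Finset.disjoint_left]
    intro i
    simp only [Finset.mem_union, Finset.mem_singleton, Finset.mem_Ioc]
    omega

open Classical in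
lemma sum_perm_succ (n : ℕ) (f : ℕ → ℕ → ℕ) :
    ∑ π : Equiv.Perm (Fin (n + 1)),
      (if HasInc 4 π (n + 1) then 0 else f (minTop 2 π) (minTop 3 π)) =
    ∑ σ : Equiv.Perm (Fin n),
      (if HasInc 4 σ n then 0 else treeStep f (minTop 2 σ) (minTop 3 σ)) := by
  rw [← (appendVal_bijective n).sum_comp
    (fun π => if HasInc 4 π (n + 1) then 0 else f (minTop 2 π) (minTop 3 π)),
    Fintype.sum_prod_type]
  refine Finset.sum_congr rfl fun σ _ => ?_
  split_ifs with h
  · refine Finset.sum_eq_zero fun v _ => if_pos ?_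
    rw [hasInc_appendVal_iff, if_neg (by have := v.is_le; dsimp only; omega)]
    exact Or.inl h
  · exact sum_appendVal σ h f

open Classical in
lemma sum_perm_treeCount (n m : ℕ) :
    ∑ π : Equiv.Perm (Fin n),
      (if HasInc 4 π n then 0 else treeCount m (minTop 2 π) (minTop 3 π)) =
    treeCount (n + m) 0 0 := by
  induction n generalizing m with
  | zero =>
    have h2 := minTop_le 2 (1 : Equiv.Perm (Fin 0))
    have h3 := minTop_le 3 (1 : Equiv.Perm (Fin 0))
    rw [Fintype.sum_unique, show (default : Equiv.Perm (Fin 0)) = 1 from Subsingleton.elim _ _,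
      if_neg (not_hasInc_zero 3 _), Nat.le_zero.1 h2, Nat.le_zero.1 h3, Nat.zero_add]
  | succ n ih =>
    rw [sum_perm_succ, show n + 1 + m = n + (m + 1) by ring]
    exact ih (m + 1)

lemma avoidCount_patt1234 (n : ℕ) : avoidCount patt1234 n = treeCount n 0 0 := by
  classical
  have h := sum_perm_treeCount n 0
  simp only [treeCount, add_zero] at h
  rw [← h, avoidCount, Nat.card_eq_fintype_card, Fintype.card_subtype, Finset.card_filter]
  refine Finset.sum_congr rfl fun π _ => ?_
  rw [pattContains_patt1234_iff]
  split_ifs <;> simp_all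
/-- Laurent polynomials with integer coefficients in two variables. -/
abbrev BiLaurent : Type := AddMonoidAlgebra ℤ (ℤ × ℤ)

namespace BiLaurent

/-- Evaluation of Laurent polynomials at a pair of units. -/
noncomputable def eval {R : Type*} [CommRing R] (X Y : Rˣ) : BiLaurent →ₐ[ℤ] R :=
  AddMonoidAlgebra.lift ℤ R (ℤ × ℤ)
    { toFun := fun m => ((X ^ m.toAdd.1 * Y ^ m.toAdd.2 : Rˣ) : R)
      map_one' := by simp
      map_mul' := fun m m' => by
        rw [← Units.val_mul]
        congr 1
        simp only [toAdd_mul, Prod.fst_add, Prod.snd_add, zpow_add]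
        exact mul_mul_mul_comm _ _ _ _ }

lemma eval_single {R : Type*} [CommRing R] (X Y : Rˣ) (m : ℤ × ℤ) (r : ℤ) :
    eval X Y (AddMonoidAlgebra.single m r) = r • ((X ^ m.1 * Y ^ m.2 : Rˣ) : R) := by
  rw [eval, AddMonoidAlgebra.lift_single]
  rfl

/-- The first variable. -/
noncomputable def a : BiLaurentˣ where
  val := AddMonoidAlgebra.single (1, 0) 1
  inv := AddMonoidAlgebra.single (-1, 0) 1
  val_inv := by simp [AddMonoidAlgebra.single_mul_single, AddMonoidAlgebra.one_def]; rfl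
  inv_val := by simp [AddMonoidAlgebra.single_mul_single, AddMonoidAlgebra.one_def]; rfl

/-- The second variable. -/
noncomputable def b : BiLaurentˣ where
  val := AddMonoidAlgebra.single (0, 1) 1
  inv := AddMonoidAlgebra.single (0, -1) 1
  val_inv := by simp [AddMonoidAlgebra.single_mul_single, AddMonoidAlgebra.one_def]; rfl
  inv_val := by simp [AddMonoidAlgebra.single_mul_single, AddMonoidAlgebra.one_def]; rfl

section eval

variable {R : Type*} [CommRing R] (X Y : Rˣ)

@[simp] lemma eval_a : eval X Y a = X := by
  simp [a, eval_single]

@[simp] lemma eval_b : eval X Y b = Y := by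
  simp [b, eval_single]

@[simp] lemma eval_a_inv : eval X Y ↑a⁻¹ = ↑X⁻¹ := by
  simp [a, eval_single]

@[simp] lemma eval_b_inv : eval X Y ↑b⁻¹ = ↑Y⁻¹ := by
  simp [b, eval_single]

end eval

lemma a_zpow (i : ℤ) : ((a ^ i : BiLaurentˣ) : BiLaurent) = AddMonoidAlgebra.single (i, 0) 1 := by
  have h (n : ℕ) : ((a : BiLaurent)) ^ n = AddMonoidAlgebra.single ((n : ℤ), 0) 1 := by
    simp [a, AddMonoidAlgebra.single_pow]
  have h' (n : ℕ) : ((↑a⁻¹ : BiLaurent)) ^ n = AddMonoidAlgebra.single (-(n : ℤ), 0) 1 := by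
    simp [a, AddMonoidAlgebra.single_pow]
  obtain ⟨n, rfl | rfl⟩ := i.eq_nat_or_neg
  · simpa using h n
  · simpa using h' n

lemma b_zpow (i : ℤ) : ((b ^ i : BiLaurentˣ) : BiLaurent) = AddMonoidAlgebra.single (0, i) 1 := by
  have h (n : ℕ) : ((b : BiLaurent)) ^ n = AddMonoidAlgebra.single (0, (n : ℤ)) 1 := by
    simp [b, AddMonoidAlgebra.single_pow]
  have h' (n : ℕ) : ((↑b⁻¹ : BiLaurent)) ^ n = AddMonoidAlgebra.single (0, -(n : ℤ)) 1 := by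
    simp [b, AddMonoidAlgebra.single_pow]
  obtain ⟨n, rfl | rfl⟩ := i.eq_nat_or_neg
  · simpa using h n
  · simpa using h' n

/-- The constant term of a Laurent polynomial. -/
noncomputable def constTerm : BiLaurent →+ ℤ where
  toFun g := g.coeff 0
  map_zero' := by simp
  map_add' := by simp

lemma constTerm_single (m : ℤ × ℤ) (r : ℤ) :
    constTerm (AddMonoidAlgebra.single m r) = if m = 0 then r else 0 := by
  change (AddMonoidAlgebra.single m r).coeff 0 = _
  rw [AddMonoidAlgebra.coeff_single, Finsupp.single_apply]

lemma constTerm_a_zpow_mul_b_zpow (i j : ℤ) :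
    constTerm ((a ^ i * b ^ j : BiLaurentˣ) : BiLaurent) = if i = 0 ∧ j = 0 then 1 else 0 := by
  rw [Units.val_mul, a_zpow, b_zpow, AddMonoidAlgebra.single_mul_single, constTerm_single]
  simp [Prod.ext_iff]

/-- A functional on a ring that picks out the constant term on monomials in the units `X`, `Y` does
so on all Laurent polynomials in them. -/
lemma map_eval {R S : Type*} [CommRing R] [CommRing S] (L : R →+ S) (X Y : Rˣ)
    (h : ∀ i j : ℤ, L ((X ^ i * Y ^ j : Rˣ) : R) = if i = 0 ∧ j = 0 then 1 else 0)
    (g : BiLaurent) : L (eval X Y g) = constTerm g := by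
  suffices L.comp (eval X Y).toRingHom.toAddMonoidHom =
      (Int.castAddHom S).comp constTerm from DFunLike.congr_fun this g
  refine AddMonoidAlgebra.addMonoidHom_ext fun m r => ?_
  change L (eval X Y (AddMonoidAlgebra.single m r)) = (constTerm (AddMonoidAlgebra.single m r) : S)
  rw [eval_single, map_zsmul, h, constTerm_single]
  by_cases hm : m = 0
  · subst hm; simp
  · have : ¬ (m.1 = 0 ∧ m.2 = 0) := fun h => hm (Prod.ext h.1 h.2)
    simp [hm, this]

lemma constTerm_eval_swap (g : BiLaurent) : constTerm (eval b a g) = constTerm g := by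
  refine map_eval constTerm b a (fun i j => ?_) g
  rw [mul_comm, constTerm_a_zpow_mul_b_zpow]
  simp [and_comm]

lemma constTerm_eval_inv (g : BiLaurent) : constTerm (eval a⁻¹ b g) = constTerm g := by
  refine map_eval constTerm a⁻¹ b (fun i j => ?_) g
  rw [inv_zpow', constTerm_a_zpow_mul_b_zpow]
  simp

lemma constTerm_eval_shear (g : BiLaurent) :
    constTerm (eval a⁻¹ (b * a⁻¹) g) = constTerm g := by
  refine map_eval constTerm a⁻¹ (b * a⁻¹) (fun i j => ?_) g
  have h : a⁻¹ ^ i * (b * a⁻¹) ^ j = a ^ (-i - j) * b ^ j := by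
    rw [mul_zpow, inv_zpow', inv_zpow', sub_eq_add_neg, zpow_add]
    exact (mul_left_comm _ _ _).trans (mul_comm _ _)
  rw [h, constTerm_a_zpow_mul_b_zpow]
  exact if_congr (by omega) rfl rfl

end BiLaurent

/-- On the monomials in `t`, `1 + t` and `s`, the functional `L` is the constant term of the
expansion as an iterated Laurent series in `s` over the Laurent series in `t`. -/
structure IsConstTerm {K : Type*} [Field K] (L : K →+ ℚ) (t s : K) : Prop where
  t_ne_zero : t ≠ 0
  s_ne_zero : s ≠ 0
  one_add_t_ne_zero : 1 + t ≠ 0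
  map_t_zpow : ∀ i : ℤ, L (t ^ i) = if i = 0 then 1 else 0
  map_mul_s_zpow : ∀ i j k : ℤ, k ≠ 0 → L (t ^ i * (1 + t) ^ j * s ^ k) = 0

lemma laurentSeries_single_one_zpow {K : Type*} [Field K] (i : ℤ) :
    (HahnSeries.single (1 : ℤ) (1 : K)) ^ i = HahnSeries.single i 1 := by
  have hinv : (HahnSeries.single (1 : ℤ) (1 : K))⁻¹ = HahnSeries.single (-1) 1 := by
    rw [HahnSeries.inv_single, inv_one]
  obtain ⟨n, rfl | rfl⟩ := i.eq_nat_or_neg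
  · simp [HahnSeries.single_pow]
  · rw [zpow_neg, ← inv_zpow, hinv]
    simp [HahnSeries.single_pow]

lemma laurentSeries_coeff_single_one_zpow {K : Type*} [Field K] (i : ℤ) :
    ((HahnSeries.single (1 : ℤ) (1 : K)) ^ i).coeff 0 = if i = 0 then 1 else 0 := by
  rw [laurentSeries_single_one_zpow]
  by_cases hk : i = 0
  · simp [hk]
  · rw [HahnSeries.coeff_single_of_ne (Ne.symm hk), if_neg hk]

lemma isConstTerm_of_field {F : Type*} [Field F] (l : F →+ ℚ) (x : F) (hx : x ≠ 0)
    (hx1 : 1 + x ≠ 0) (h : ∀ i : ℤ, l (x ^ i) = if i = 0 then 1 else 0) :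
    IsConstTerm (K := LaurentSeries F) (l.comp (HahnSeries.coeff.addMonoidHom 0))
      (HahnSeries.C x) (HahnSeries.single 1 1) where
  t_ne_zero := HahnSeries.C_ne_zero hx
  s_ne_zero := HahnSeries.single_ne_zero one_ne_zero
  one_add_t_ne_zero := by
    rw [← map_one (HahnSeries.C (Γ := ℤ) (R := F)), ← map_add]
    exact HahnSeries.C_ne_zero hx1
  map_t_zpow i := by
    rw [← map_zpow₀ (HahnSeries.C (Γ := ℤ) (R := F)), ← h i, HahnSeries.C_apply]
    change l ((HahnSeries.single (0 : ℤ) (x ^ i)).coeff 0) = _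
    rw [HahnSeries.coeff_single_same]
  map_mul_s_zpow i j k hk := by
    have hC : (HahnSeries.C x : LaurentSeries F) ^ i * (1 + HahnSeries.C x) ^ j =
        HahnSeries.C (x ^ i * (1 + x) ^ j) := by
      rw [map_mul, map_zpow₀, map_zpow₀, map_add, map_one]
    rw [hC, laurentSeries_single_one_zpow, HahnSeries.C_apply, HahnSeries.single_mul_single,
      zero_add]
    simp [HahnSeries.coeff_single_of_ne (Ne.symm hk)]

lemma exists_isConstTerm :
    ∃ (K : Type) (_ : Field K) (L : K →+ ℚ) (t s : K), IsConstTerm L t s := by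
  refine ⟨LaurentSeries (LaurentSeries ℚ), inferInstance, _, _, _,
    isConstTerm_of_field (HahnSeries.coeff.addMonoidHom 0) (HahnSeries.single (1 : ℤ) (1 : ℚ))
      (HahnSeries.single_ne_zero one_ne_zero) (fun h => ?_) fun i => ?_⟩
  · have := congrArg (fun f => HahnSeries.coeff f 0) h
    simp [HahnSeries.coeff_one] at this
  · exact laurentSeries_coeff_single_one_zpow i

namespace IsConstTerm

variable {K : Type*} [Field K] {L : K →+ ℚ} {t s : K}

lemma map_eval_t_s (H : IsConstTerm L t s) (g : BiLaurent) :
    L (BiLaurent.eval (Units.mk0 t H.t_ne_zero) (Units.mk0 s H.s_ne_zero) g) =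
      BiLaurent.constTerm g := by
  refine BiLaurent.map_eval L _ _ (fun i j => ?_) g
  simp only [Units.val_mul, Units.val_zpow_eq_zpow_val, Units.val_mk0]
  by_cases hj : j = 0
  · simpa [hj] using H.map_t_zpow i
  · simpa [hj] using H.map_mul_s_zpow i 0 j hj

/-- The unit `s t / (1 + t)`. -/
def u (H : IsConstTerm L t s) : Kˣ :=
  Units.mk0 (s * t / (1 + t)) (div_ne_zero (mul_ne_zero H.s_ne_zero H.t_ne_zero)
    H.one_add_t_ne_zero)

/-- The unit `s / (1 + t)`. -/
def v (H : IsConstTerm L t s) : Kˣ :=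
  Units.mk0 (s / (1 + t)) (div_ne_zero H.s_ne_zero H.one_add_t_ne_zero)

lemma map_eval_u_v (H : IsConstTerm L t s) (g : BiLaurent) :
    L (BiLaurent.eval H.u H.v g) = BiLaurent.constTerm g := by
  refine BiLaurent.map_eval L _ _ (fun i j => ?_) g
  have hs := H.s_ne_zero
  have ht := H.t_ne_zero
  have ht1 := H.one_add_t_ne_zero
  have h : ((H.u ^ i * H.v ^ j : Kˣ) : K) =
      t ^ i * (1 + t) ^ (-(i + j)) * s ^ (i + j) := by
    simp only [Units.val_mul, Units.val_zpow_eq_zpow_val, u, v, Units.val_mk0, div_zpow, mul_zpow,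
      zpow_neg, zpow_add₀ hs, zpow_add₀ ht1]
    field_simp
  rw [h]
  by_cases hij : i + j = 0
  · simp only [hij, neg_zero, zpow_zero, mul_one, H.map_t_zpow]
    exact if_congr (by omega) rfl rfl
  · rw [H.map_mul_s_zpow _ _ _ hij, if_neg (by omega)]

lemma map_t_pow_mul_one_add_t_pow (H : IsConstTerm L t s) (k p : ℕ) :
    L (t ^ k * (1 + t) ^ p) = if k = 0 then 1 else 0 := by
  induction p generalizing k with
  | zero => simpa using H.map_t_zpow k
  | succ p ih =>
    rw [show t ^ k * (1 + t) ^ (p + 1) = t ^ k * (1 + t) ^ p + t ^ (k + 1) * (1 + t) ^ p by ring,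
      map_add, ih, ih]
    simp

lemma map_mul_s_inv_pow_mul (H : IsConstTerm L t s) (i : ℤ) (j k q : ℕ) :
    L (t ^ i * (1 + t) ^ j * s⁻¹ ^ k * (1 + s⁻¹) ^ q) =
      if k = 0 then L (t ^ i * (1 + t) ^ j) else 0 := by
  induction q generalizing k with
  | zero =>
    rw [pow_zero, mul_one]
    split_ifs with hk
    · simp [hk]
    · simpa using H.map_mul_s_zpow i j (-(k : ℤ)) (by simpa using hk)
  | succ q ih =>
    rw [show t ^ i * (1 + t) ^ j * s⁻¹ ^ k * (1 + s⁻¹) ^ (q + 1) =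
      t ^ i * (1 + t) ^ j * s⁻¹ ^ k * (1 + s⁻¹) ^ q +
      t ^ i * (1 + t) ^ j * s⁻¹ ^ (k + 1) * (1 + s⁻¹) ^ q by ring, map_add, ih, ih]
    simp

end IsConstTerm

/-- The kernel of the generating tree, in the coordinates `1 + t` and `1 + s⁻¹` dual to the
labels. -/
def treeKernel {K : Type*} [Field K] (t s : K) : K := (1 + s⁻¹) * (s + (1 + t) ^ 2 / t)

/-- The weight whose moments against powers of `treeKernel` count the nodes of the tree. -/
def treeWeight {K : Type*} [Field K] (t s : K) : K :=
  (1 - t) * (s - 1 - t) * (s * t - 1 - t) / (s ^ 2 * t)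

namespace BiLaurent

/-- `|1 + a + b|²` on the torus. -/
noncomputable def kernel : BiLaurent := (a + b + 1) * (↑a⁻¹ + ↑b⁻¹ + 1)

/-- The weight whose moments against powers of `kernel` count `1234`-avoiding permutations. -/
noncomputable def weight : BiLaurent := (b - a) * (b - 1) * (a - 1) * ↑a⁻¹ * ↑b⁻¹ ^ 2

lemma eval_swap_kernel : eval b a kernel = kernel := by
  simp only [kernel, map_mul, map_add, map_one, eval_a, eval_b, eval_a_inv, eval_b_inv]
  ring

lemma eval_shear_kernel : eval a⁻¹ (b * a⁻¹) kernel = kernel := by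
  have ha : (a : BiLaurent) * ↑a⁻¹ = 1 := a.mul_inv
  simp only [kernel, map_mul, map_add, map_one, eval_a, eval_b, eval_a_inv, eval_b_inv, inv_inv,
    mul_inv, Units.val_mul]
  linear_combination ((a + b + 1) * (↑a⁻¹ + ↑b⁻¹ + 1) - ↑a⁻¹ * (a + b + 1) -
    a * (↑a⁻¹ + ↑b⁻¹ + 1) + (a * ↑a⁻¹ - 1) : BiLaurent) * ha

end BiLaurent

namespace IsConstTerm

variable {K : Type*} [Field K] {L : K →+ ℚ} {t s : K}

lemma map_treeWeight_mul (H : IsConstTerm L t s) (p q : ℕ) :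
    L (treeWeight t s * (1 + t) ^ p * (1 + s⁻¹) ^ q) = 1 := by
  have hs := H.s_ne_zero
  have ht := H.t_ne_zero
  have h : treeWeight t s * (1 + t) ^ p * (1 + s⁻¹) ^ q =
      t ^ (0 : ℤ) * (1 + t) ^ p * s⁻¹ ^ 0 * (1 + s⁻¹) ^ q -
      t ^ (1 : ℤ) * (1 + t) ^ p * s⁻¹ ^ 0 * (1 + s⁻¹) ^ q -
      t ^ (-1 : ℤ) * (1 + t) ^ (p + 2) * s⁻¹ ^ 1 * (1 + s⁻¹) ^ q +
      t ^ (0 : ℤ) * (1 + t) ^ (p + 2) * s⁻¹ ^ 1 * (1 + s⁻¹) ^ q +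
      t ^ (-1 : ℤ) * (1 + t) ^ (p + 2) * s⁻¹ ^ 2 * (1 + s⁻¹) ^ q -
      t ^ (0 : ℤ) * (1 + t) ^ (p + 2) * s⁻¹ ^ 2 * (1 + s⁻¹) ^ q := by
    rw [treeWeight]
    generalize (1 + s⁻¹) ^ q = z
    simp only [zpow_neg, zpow_zero, zpow_one]
    field_simp
    ring
  have h0 := H.map_t_pow_mul_one_add_t_pow 0 p
  have h1 := H.map_t_pow_mul_one_add_t_pow 1 p
  rw [h, map_sub, map_add, map_add, map_sub, map_sub]
  simp only [H.map_mul_s_inv_pow_mul]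
  simp_all

lemma map_treeWeight_reflect (H : IsConstTerm L t s) (n q : ℕ) :
    L (treeWeight t s * ((1 + t) / t) * (1 + s⁻¹) ^ q * treeKernel t s ^ n) = 0 := by
  have hs := H.s_ne_zero
  have ht := H.t_ne_zero
  set a := BiLaurent.a with ha
  set b := BiLaurent.b with hb
  set g : BiLaurent := (↑a⁻¹ - ↑a) * (↑b - 1 - ↑a) * (↑b - 1 - ↑a⁻¹) * ↑b⁻¹ ^ 2 *
    (1 + ↑b⁻¹) ^ q * ((1 + ↑b⁻¹) * (↑b + 2 + ↑a + ↑a⁻¹)) ^ n with hg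
  have hanti : BiLaurent.eval a⁻¹ b g = -g := by
    simp only [hg, map_mul, map_sub, map_add, map_pow, map_one, map_ofNat, ha, hb,
      BiLaurent.eval_a, BiLaurent.eval_b, BiLaurent.eval_a_inv, BiLaurent.eval_b_inv, inv_inv]
    rw [show (BiLaurent.b : BiLaurent) + 2 + ↑BiLaurent.a⁻¹ + ↑BiLaurent.a =
      BiLaurent.b + 2 + ↑BiLaurent.a + ↑BiLaurent.a⁻¹ by ring]
    ring
  have hzero : BiLaurent.constTerm g = 0 := by
    have := BiLaurent.constTerm_eval_inv g
    rw [← ha, ← hb, hanti, map_neg] at this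
    omega
  have heval : treeWeight t s * ((1 + t) / t) * (1 + s⁻¹) ^ q * treeKernel t s ^ n =
      BiLaurent.eval (Units.mk0 t ht) (Units.mk0 s hs) g := by
    simp only [hg, map_mul, map_sub, map_add, map_pow, map_one, map_ofNat, ha, hb,
      BiLaurent.eval_a, BiLaurent.eval_b, BiLaurent.eval_a_inv, BiLaurent.eval_b_inv,
      Units.val_mk0, Units.val_inv_eq_inv_val]
    have h1 : treeWeight t s * ((1 + t) / t) =
        (t⁻¹ - t) * (s - 1 - t) * (s - 1 - t⁻¹) * s⁻¹ ^ 2 := by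
      rw [treeWeight]
      field_simp
      ring
    have h2 : treeKernel t s = (1 + s⁻¹) * (s + 2 + t + t⁻¹) := by
      rw [treeKernel]
      field_simp
      ring
    rw [h1, h2]
  rw [heval, H.map_eval_t_s, hzero, Int.cast_zero]

lemma eval_u_v_kernel (H : IsConstTerm L t s) :
    BiLaurent.eval H.u H.v BiLaurent.kernel = treeKernel t s := by
  have hs := H.s_ne_zero
  have ht := H.t_ne_zero
  have ht1 := H.one_add_t_ne_zero
  simp only [BiLaurent.kernel, map_mul, map_add, map_one, BiLaurent.eval_a,
    BiLaurent.eval_b, BiLaurent.eval_a_inv, BiLaurent.eval_b_inv, u, v, Units.val_mk0,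
    Units.val_inv_eq_inv_val, treeKernel]
  field_simp
  ring

lemma eval_u_v_weight (H : IsConstTerm L t s) :
    BiLaurent.eval H.u H.v BiLaurent.weight = treeWeight t s := by
  have hs := H.s_ne_zero
  have ht := H.t_ne_zero
  have ht1 := H.one_add_t_ne_zero
  simp only [BiLaurent.weight, map_mul, map_sub, map_pow, map_one, BiLaurent.eval_a,
    BiLaurent.eval_b, BiLaurent.eval_a_inv, BiLaurent.eval_b_inv, u, v, Units.val_mk0,
    Units.val_inv_eq_inv_val, treeWeight]
  field_simp
  ring

lemma map_treeWeight_shear (H : IsConstTerm L t s) (n p : ℕ) :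
    L (treeWeight t s * (1 + s) * ((1 + t) * (1 + s⁻¹)) ^ p * treeKernel t s ^ n) = 0 := by
  have hs := H.s_ne_zero
  have ht := H.t_ne_zero
  have ht1 := H.one_add_t_ne_zero
  set a := BiLaurent.a with ha
  set b := BiLaurent.b with hb
  have hab : (a : BiLaurent) * ↑a⁻¹ = 1 := a.mul_inv
  set g₁ : BiLaurent := BiLaurent.weight * (↑a + ↑b + 1) with hg₁
  set g₂ : BiLaurent := (↑a + ↑b + 1) * ↑b⁻¹ with hg₂
  have h₁ : BiLaurent.eval a⁻¹ (b * a⁻¹) g₁ = -g₁ := by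
    simp only [hg₁, BiLaurent.weight, map_mul, map_sub, map_add, map_pow, map_one, ha, hb,
      BiLaurent.eval_a, BiLaurent.eval_b, BiLaurent.eval_a_inv, BiLaurent.eval_b_inv, inv_inv,
      mul_inv, Units.val_mul]
    simp only [← ha, ← hb]
    generalize (a : BiLaurent) = x at *
    generalize (b : BiLaurent) = y at *
    generalize (↑a⁻¹ : BiLaurent) = x' at *
    generalize (↑b⁻¹ : BiLaurent) = y' at *
    grind
  have h₂ : BiLaurent.eval a⁻¹ (b * a⁻¹) g₂ = g₂ := by
    simp only [hg₂, map_mul, map_add, map_one, ha, hb,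
      BiLaurent.eval_a, BiLaurent.eval_b, BiLaurent.eval_b_inv, inv_inv,
      mul_inv, Units.val_mul]
    simp only [← ha, ← hb]
    linear_combination (↑b⁻¹ + ↑b * ↑b⁻¹) * hab
  have hzero : BiLaurent.constTerm (g₁ * g₂ ^ p * BiLaurent.kernel ^ n) = 0 := by
    have := BiLaurent.constTerm_eval_shear (g₁ * g₂ ^ p * BiLaurent.kernel ^ n)
    rw [map_mul (BiLaurent.eval _ _), map_mul (BiLaurent.eval _ _), map_pow (BiLaurent.eval _ _),
      map_pow (BiLaurent.eval _ _), BiLaurent.eval_shear_kernel, ← ha, ← hb, h₁, h₂, neg_mul,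
      neg_mul, map_neg] at this
    omega
  have heval : treeWeight t s * (1 + s) * ((1 + t) * (1 + s⁻¹)) ^ p * treeKernel t s ^ n =
      BiLaurent.eval H.u H.v (g₁ * g₂ ^ p * BiLaurent.kernel ^ n) := by
    rw [map_mul, map_pow _ BiLaurent.kernel, H.eval_u_v_kernel, map_mul, map_pow, hg₁, map_mul,
      H.eval_u_v_weight]
    simp only [hg₂, map_mul, map_add, map_one, ha, hb, BiLaurent.eval_a,
      BiLaurent.eval_b, BiLaurent.eval_b_inv, u, v, Units.val_mk0, Units.val_inv_eq_inv_val]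
    rw [show s * t / (1 + t) + s / (1 + t) + 1 = 1 + s by field_simp; ring,
      show (1 + s) * (s / (1 + t))⁻¹ = (1 + t) * (1 + s⁻¹) by field_simp; ring]
  rw [heval, H.map_eval_u_v, hzero, Int.cast_zero]

end IsConstTerm

lemma mul_sum_Ioc_pow {R : Type*} [CommRing R] (x : R) {p q : ℕ} (h : p ≤ q) :
    (x - 1) * ∑ i ∈ Finset.Ioc p q, x ^ i = x ^ (q + 1) - x ^ (p + 1) := by
  induction q, h using Nat.le_induction with
  | base => simp
  | succ q h ih =>
    rw [← Finset.insert_Ioc_right_eq_Ioc_add_one h, Finset.sum_insert (by simp), mul_add, ih]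
    ring

namespace IsConstTerm

variable {K : Type*} [Field K] {L : K →+ ℚ} {t s : K}

lemma treeStep_monomial (H : IsConstTerm L t s) {p q : ℕ} (hpq : p ≤ q) :
    treeStep (fun p q => (1 + t) ^ p * (1 + s⁻¹) ^ q) p q =
      treeKernel t s * ((1 + t) ^ p * (1 + s⁻¹) ^ q) - (1 + t) / t * (1 + s⁻¹) ^ (q + 1) -
        (1 + s) * ((1 + t) * (1 + s⁻¹)) ^ p := by
  have hs := H.s_ne_zero
  have ht := H.t_ne_zero
  have h1 := mul_sum_Ioc_pow (1 + t) (Nat.zero_le p)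
  have h2 := mul_sum_Ioc_pow (1 + s⁻¹) hpq
  rw [add_sub_cancel_left, mul_comm, ← eq_div_iff ht] at h1
  rw [add_sub_cancel_left, mul_comm, ← eq_div_iff (inv_ne_zero hs)] at h2
  rw [treeStep, ← Finset.sum_mul, ← Finset.mul_sum, h1, h2, treeKernel, mul_pow]
  simp only [pow_succ]
  generalize (1 + t) ^ p = x
  generalize (1 + s⁻¹) ^ p = y
  generalize (1 + s⁻¹) ^ q = z
  field_simp
  ring

lemma treeCount_eq_map (H : IsConstTerm L t s) (n : ℕ) {p q : ℕ} (hpq : p ≤ q) :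
    (treeCount n p q : ℚ) =
      L (treeWeight t s * treeKernel t s ^ n * ((1 + t) ^ p * (1 + s⁻¹) ^ q)) := by
  induction n generalizing p q with
  | zero => simpa [treeCount, mul_assoc] using (H.map_treeWeight_mul p q).symm
  | succ n ih =>
    have hstep : treeWeight t s * treeKernel t s ^ (n + 1) * ((1 + t) ^ p * (1 + s⁻¹) ^ q) =
        treeStep (fun p q => treeWeight t s * treeKernel t s ^ n *
          ((1 + t) ^ p * (1 + s⁻¹) ^ q)) p q +
        treeWeight t s * ((1 + t) / t) * (1 + s⁻¹) ^ (q + 1) * treeKernel t s ^ n +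
        treeWeight t s * (1 + s) * ((1 + t) * (1 + s⁻¹)) ^ p * treeKernel t s ^ n := by
      have := H.treeStep_monomial hpq
      simp only [treeStep] at this ⊢
      rw [← Finset.mul_sum, ← Finset.mul_sum, ← mul_add, ← mul_add, this]
      ring
    rw [hstep, map_add, map_add, H.map_treeWeight_reflect, H.map_treeWeight_shear, add_zero,
      add_zero]
    simp only [treeCount, treeStep, Nat.cast_add, Nat.cast_sum, map_add, map_sum]
    rw [ih (by omega)]
    refine congrArg₂ (· + ·) (congrArg₂ (· + ·) rfl ?_) ?_
    · refine Finset.sum_congr rfl fun i hi => ih ?_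
      have := Finset.mem_Ioc.1 hi
      omega
    · refine Finset.sum_congr rfl fun i hi => ih ?_
      have := Finset.mem_Ioc.1 hi
      omega

end IsConstTerm

lemma avoidCount_patt1234_eq_constTerm (n : ℕ) :
    (avoidCount patt1234 n : ℤ) =
      BiLaurent.constTerm (BiLaurent.weight * BiLaurent.kernel ^ n) := by
  obtain ⟨K, _, L, t, s, H⟩ := exists_isConstTerm
  have h := H.treeCount_eq_map n (le_refl 0)
  rw [pow_zero, pow_zero, mul_one, mul_one, ← H.eval_u_v_weight, ← H.eval_u_v_kernel, ← map_pow,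
    ← map_mul, H.map_eval_u_v] at h
  rw [avoidCount_patt1234]
  exact_mod_cast h

namespace BiLaurent

/-- The squared modulus of the Vandermonde product of `1`, `a` and `b` on the torus. -/
noncomputable def vandermondeSq : BiLaurent :=
  (1 - a) * (1 - ↑a⁻¹) * ((1 - b) * (1 - ↑b⁻¹)) * ((a - b) * (↑a⁻¹ - ↑b⁻¹))

lemma constTerm_eval_swap_mul_kernel_pow (g : BiLaurent) (n : ℕ) :
    constTerm (eval b a g * kernel ^ n) = constTerm (g * kernel ^ n) := by
  rw [← constTerm_eval_swap (g * kernel ^ n), map_mul (eval b a), map_pow (eval b a),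
    eval_swap_kernel]

lemma constTerm_eval_shear_mul_kernel_pow (g : BiLaurent) (n : ℕ) :
    constTerm (eval a⁻¹ (b * a⁻¹) g * kernel ^ n) = constTerm (g * kernel ^ n) := by
  rw [← constTerm_eval_shear (g * kernel ^ n), map_mul (eval _ _), map_pow (eval _ _),
    eval_shear_kernel]

lemma sum_orbit_weight :
    weight + eval b a weight + eval a⁻¹ (b * a⁻¹) weight +
      eval b a (eval a⁻¹ (b * a⁻¹) weight) + eval a⁻¹ (b * a⁻¹) (eval b a weight) +
      eval b a (eval a⁻¹ (b * a⁻¹) (eval b a weight)) = vandermondeSq := by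
  have ha : (a : BiLaurent) * ↑a⁻¹ = 1 := a.mul_inv
  have hb : (b : BiLaurent) * ↑b⁻¹ = 1 := b.mul_inv
  simp only [weight, vandermondeSq, map_mul, map_sub, map_pow, map_one, eval_a, eval_b, eval_a_inv,
    eval_b_inv, inv_inv, mul_inv, Units.val_mul]
  generalize (a : BiLaurent) = x at *
  generalize (b : BiLaurent) = y at *
  generalize (↑a⁻¹ : BiLaurent) = x' at *
  generalize (↑b⁻¹ : BiLaurent) = y' at *
  grind

lemma constTerm_vandermondeSq_mul_kernel_pow (n : ℕ) :
    constTerm (vandermondeSq * kernel ^ n) = 6 * constTerm (weight * kernel ^ n) := by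
  rw [← sum_orbit_weight]
  simp only [add_mul, map_add, constTerm_eval_swap_mul_kernel_pow,
    constTerm_eval_shear_mul_kernel_pow]
  ring

end BiLaurent

open MeasureTheory

section Gaussian

variable {b : ℝ}

lemma integrable_pow_mul_exp_neg_mul_sq (hb : 0 < b) (k : ℕ) :
    Integrable fun x : ℝ => x ^ k * Real.exp (-b * x ^ 2) := by
  have := integrable_rpow_mul_exp_neg_mul_sq hb (s := k) (by linarith [k.cast_nonneg (α := ℝ)])
  simpa only [Real.rpow_natCast] using this

lemma integral_pow_add_two_mul_exp_neg_mul_sq (hb : 0 < b) (k : ℕ) :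
    ∫ x : ℝ, x ^ (k + 2) * Real.exp (-b * x ^ 2) =
      (k + 1) / (2 * b) * ∫ x : ℝ, x ^ k * Real.exp (-b * x ^ 2) := by
  have hint := integrable_pow_mul_exp_neg_mul_sq hb
  have hderiv (x : ℝ) : HasDerivAt (fun x : ℝ => x ^ (k + 1) * Real.exp (-b * x ^ 2))
      ((k + 1) * (x ^ k * Real.exp (-b * x ^ 2)) -
        2 * b * (x ^ (k + 2) * Real.exp (-b * x ^ 2))) x := by
    refine ((hasDerivAt_pow (k + 1) x).mul
      (((hasDerivAt_pow 2 x).const_mul (-b)).exp)).congr_deriv ?_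
    push_cast
    ring
  have h := integral_eq_zero_of_hasDerivAt_of_integrable hderiv
    (((hint k).const_mul _).sub ((hint (k + 2)).const_mul _)) (hint (k + 1))
  rw [integral_sub ((hint k).const_mul _) ((hint (k + 2)).const_mul _), integral_const_mul,
    integral_const_mul, sub_eq_zero] at h
  rw [div_mul_eq_mul_div, eq_div_iff (by positivity), h]
  ring

lemma integral_sq_mul_exp_neg_mul_sq (hb : 0 < b) :
    ∫ x : ℝ, x ^ 2 * Real.exp (-b * x ^ 2) = 1 / (2 * b) * √(Real.pi / b) := by
  rw [← integral_gaussian]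
  simpa using integral_pow_add_two_mul_exp_neg_mul_sq hb 0

lemma integral_pow_four_mul_exp_neg_mul_sq (hb : 0 < b) :
    ∫ x : ℝ, x ^ 4 * Real.exp (-b * x ^ 2) = 3 / (2 * b) ^ 2 * √(Real.pi / b) := by
  rw [integral_pow_add_two_mul_exp_neg_mul_sq hb 2, integral_sq_mul_exp_neg_mul_sq hb]
  push_cast
  field_simp
  ring

lemma integral_pow_six_mul_exp_neg_mul_sq (hb : 0 < b) :
    ∫ x : ℝ, x ^ 6 * Real.exp (-b * x ^ 2) = 15 / (2 * b) ^ 3 * √(Real.pi / b) := by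
  rw [integral_pow_add_two_mul_exp_neg_mul_sq hb 4, integral_pow_four_mul_exp_neg_mul_sq hb]
  push_cast
  field_simp
  ring

end Gaussian

/-- The limit of the rescaled integrands. -/
noncomputable def limitDensity (p : ℝ × ℝ) : ℝ :=
  p.1 ^ 2 * p.2 ^ 2 * (p.1 - p.2) ^ 2 *
    Real.exp (-(p.1 ^ 2 + p.2 ^ 2 + (p.1 - p.2) ^ 2) / 9)

/-- An integrable bound for the rescaled integrands. -/
noncomputable def dominatingDensity (c : ℝ) (p : ℝ × ℝ) : ℝ :=
  p.1 ^ 2 * p.2 ^ 2 * (p.1 - p.2) ^ 2 * Real.exp (-c * (p.1 ^ 2 + p.2 ^ 2))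

lemma integrable_dominatingDensity {c : ℝ} (hc : 0 < c) : Integrable (dominatingDensity c) := by
  have h (k : ℕ) := integrable_pow_mul_exp_neg_mul_sq hc k
  refine ((((h 4).mul_prod (h 2)).sub (((h 3).mul_prod (h 3)).const_mul 2)).add
    ((h 2).mul_prod (h 4))).congr (ae_of_all _ fun p => ?_)
  simp only [dominatingDensity, mul_add, Real.exp_add, Pi.add_apply, Pi.sub_apply]
  ring

lemma integrable_limitDensity : Integrable limitDensity := by
  refine (integrable_dominatingDensity (c := 1 / 9) (by norm_num)).mono'
    (by unfold limitDensity; fun_prop) (ae_of_all _ fun p => ?_)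
  rw [Real.norm_of_nonneg (by unfold limitDensity; positivity), limitDensity, dominatingDensity]
  gcongr
  linarith [sq_nonneg (p.1 - p.2)]

lemma integral_limitDensity_left (y : ℝ) :
    ∫ x : ℝ, limitDensity (x, y) =
      √(Real.pi / (2 / 9)) * ((243 / 16) * (y ^ 2 * Real.exp (-(1 / 6) * y ^ 2)) -
        9 / 8 * (y ^ 4 * Real.exp (-(1 / 6) * y ^ 2)) +
        1 / 16 * (y ^ 6 * Real.exp (-(1 / 6) * y ^ 2))) := by
  have hb : (0 : ℝ) < 2 / 9 := by norm_num
  have hint := integrable_pow_mul_exp_neg_mul_sq hb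
  have h0 : Integrable fun z : ℝ => Real.exp (-(2 / 9) * z ^ 2) := by simpa using hint 0
  have hz (z : ℝ) : limitDensity (z + y / 2, y) = y ^ 2 * Real.exp (-(1 / 6) * y ^ 2) *
      (z ^ 4 * Real.exp (-(2 / 9) * z ^ 2) - y ^ 2 / 2 * (z ^ 2 * Real.exp (-(2 / 9) * z ^ 2)) +
        y ^ 4 / 16 * Real.exp (-(2 / 9) * z ^ 2)) := by
    have : -((z + y / 2) ^ 2 + y ^ 2 + (z + y / 2 - y) ^ 2) / 9 =
        -(1 / 6) * y ^ 2 + -(2 / 9) * z ^ 2 := by ring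
    simp only [limitDensity, this, Real.exp_add]
    ring
  rw [← integral_add_right_eq_self _ (y / 2)]
  simp only [hz]
  rw [integral_const_mul, integral_add ((hint 4).sub' ((hint 2).const_mul _)) (h0.const_mul _),
    integral_sub (hint 4) ((hint 2).const_mul _), integral_const_mul, integral_const_mul,
    integral_pow_four_mul_exp_neg_mul_sq hb, integral_sq_mul_exp_neg_mul_sq hb, integral_gaussian]
  ring

lemma integral_limitDensity : ∫ p, limitDensity p = 243 * √3 * Real.pi / 2 := by
  have hb : (0 : ℝ) < 1 / 6 := by norm_num
  have hint := integrable_pow_mul_exp_neg_mul_sq hb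
  rw [Measure.volume_eq_prod, integral_prod_symm _ integrable_limitDensity]
  simp only [integral_limitDensity_left]
  rw [integral_const_mul, integral_add (((hint 2).const_mul _).sub' ((hint 4).const_mul _))
    ((hint 6).const_mul _), integral_sub ((hint 2).const_mul _) ((hint 4).const_mul _),
    integral_const_mul, integral_const_mul, integral_const_mul,
    integral_sq_mul_exp_neg_mul_sq hb, integral_pow_four_mul_exp_neg_mul_sq hb,
    integral_pow_six_mul_exp_neg_mul_sq hb]
  have h : √(Real.pi / (2 / 9)) * √(Real.pi / (1 / 6)) = 3 * √3 * Real.pi := by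
    rw [← Real.sqrt_mul (by positivity),
      show Real.pi / (2 / 9) * (Real.pi / (1 / 6)) = (3 * Real.pi) ^ 2 * 3 by ring,
      Real.sqrt_mul (by positivity), Real.sqrt_sq (by positivity)]
    ring
  linear_combination 81 / 2 * h

/-- The squared modulus `|1 - exp (i x)|²`. -/
noncomputable def chordSq (x : ℝ) : ℝ := 2 - 2 * Real.cos x

lemma continuous_chordSq : Continuous chordSq := by
  unfold chordSq
  fun_prop

lemma chordSq_nonneg (x : ℝ) : 0 ≤ chordSq x := by
  rw [chordSq]
  linarith [Real.cos_le_one x]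

lemma chordSq_le_sq (x : ℝ) : chordSq x ≤ x ^ 2 := by
  rw [chordSq]
  linarith [Real.one_sub_sq_div_two_le_cos (x := x)]

lemma mul_sq_le_chordSq {x : ℝ} (hx : |x| ≤ Real.pi) : 4 / Real.pi ^ 2 * x ^ 2 ≤ chordSq x := by
  have := Real.cos_le_one_sub_mul_cos_sq hx
  rw [chordSq]
  linear_combination 2 * this

lemma chordSq_add_le_nine (x y : ℝ) : chordSq x + chordSq y + chordSq (x - y) ≤ 9 := by
  simp only [chordSq, Real.cos_sub]
  nlinarith [sq_nonneg (1 + Real.cos x + Real.cos y), sq_nonneg (Real.sin x + Real.sin y),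
    Real.sin_sq_add_cos_sq x, Real.sin_sq_add_cos_sq y]

lemma tendsto_inv_sqrt_mul (x : ℝ) :
    Tendsto (fun n : ℕ => (√(n : ℝ))⁻¹ * x) atTop (nhds 0) := by
  have : Tendsto (fun n : ℕ => √(n : ℝ)) atTop atTop :=
    Real.tendsto_sqrt_atTop.comp tendsto_natCast_atTop_atTop
  simpa using this.inv_tendsto_atTop.mul_const x

lemma sq_sub_pow_four_le_chordSq {x : ℝ} (hx : |x| ≤ 1) : x ^ 2 - x ^ 4 ≤ chordSq x := by
  have := (abs_le.1 (Real.cos_bound hx)).2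
  rw [show |x| ^ 4 = x ^ 4 from (even_two_mul 2).pow_abs x] at this
  rw [chordSq]
  nlinarith [sq_nonneg (x ^ 2)]

lemma mul_inv_sqrt_mul_sq {n : ℕ} (hn : 0 < n) (x : ℝ) :
    (n : ℝ) * ((√(n : ℝ))⁻¹ * x) ^ 2 = x ^ 2 := by
  have : (n : ℝ) ≠ 0 := by positivity
  rw [mul_pow, inv_pow, Real.sq_sqrt n.cast_nonneg]
  field_simp

lemma mul_chordSq_le {n : ℕ} (hn : 0 < n) (x : ℝ) :
    (n : ℝ) * chordSq ((√(n : ℝ))⁻¹ * x) ≤ x ^ 2 := by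
  rw [← mul_inv_sqrt_mul_sq hn x]
  gcongr
  exact chordSq_le_sq _

lemma tendsto_mul_chordSq (x : ℝ) :
    Tendsto (fun n : ℕ => (n : ℝ) * chordSq ((√(n : ℝ))⁻¹ * x)) atTop (nhds (x ^ 2)) := by
  have h0 := tendsto_inv_sqrt_mul x
  have hlow : Tendsto (fun n : ℕ => x ^ 2 * (1 - ((√(n : ℝ))⁻¹ * x) ^ 2)) atTop
      (nhds (x ^ 2)) := by
    simpa using ((h0.pow 2).const_sub 1).const_mul (x ^ 2)
  refine tendsto_of_tendsto_of_tendsto_of_le_of_le' hlow tendsto_const_nhds ?_ ?_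
  · have hev : ∀ᶠ n : ℕ in atTop, |(√(n : ℝ))⁻¹ * x| ≤ 1 := by
      have := h0.abs
      rw [abs_zero] at this
      exact this.eventually_le_const one_pos
    filter_upwards [hev, eventually_gt_atTop 0] with n hn hpos
    refine le_trans (le_of_eq ?_)
      (mul_le_mul_of_nonneg_left (sq_sub_pow_four_le_chordSq hn) n.cast_nonneg)
    nth_rw 1 [← mul_inv_sqrt_mul_sq hpos x]
    ring
  · filter_upwards [eventually_gt_atTop 0] with n hpos
    exact mul_chordSq_le hpos x

/-- The integrand, over the torus, of the `n`-th constant term. -/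
noncomputable def torusDensity (n : ℕ) (p : ℝ × ℝ) : ℝ :=
  chordSq p.1 * chordSq p.2 * chordSq (p.1 - p.2) *
    (9 - (chordSq p.1 + chordSq p.2 + chordSq (p.1 - p.2))) ^ n

/-- The square `[-π, π]²`. -/
def piSquare : Set (ℝ × ℝ) := Set.Icc (-Real.pi) Real.pi ×ˢ Set.Icc (-Real.pi) Real.pi

lemma measurableSet_piSquare : MeasurableSet piSquare :=
  measurableSet_Icc.prod measurableSet_Icc

lemma mem_piSquare {p : ℝ × ℝ} : p ∈ piSquare ↔ |p.1| ≤ Real.pi ∧ |p.2| ≤ Real.pi := by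
  simp only [piSquare, Set.mem_prod, Set.mem_Icc, abs_le]

lemma continuous_torusDensity (n : ℕ) : Continuous (torusDensity n) := by
  have := continuous_chordSq
  unfold torusDensity
  fun_prop

/-- The integrand of the `n`-th constant term, normalised and rescaled by `√n`. -/
noncomputable def rescaledDensity (n : ℕ) (p : ℝ × ℝ) : ℝ :=
  n ^ 3 / 9 ^ n * piSquare.indicator (torusDensity n) ((√(n : ℝ))⁻¹ • p)

lemma mul_setIntegral_torusDensity {n : ℕ} (hn : 0 < n) :
    n ^ 4 / 9 ^ n * ∫ p in piSquare, torusDensity n p = ∫ p, rescaledDensity n p := by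
  have hn' : (n : ℝ) ≠ 0 := by positivity
  simp only [rescaledDensity]
  rw [integral_const_mul, Measure.integral_comp_smul, integral_indicator measurableSet_piSquare]
  simp only [Module.finrank_prod, Module.finrank_self, inv_pow, inv_inv, smul_eq_mul,
    one_add_one_eq_two, Real.sq_sqrt n.cast_nonneg, abs_of_nonneg (n.cast_nonneg (α := ℝ))]
  ring

lemma rescaledDensity_of_mem {n : ℕ} {x y : ℝ} (h : (√(n : ℝ))⁻¹ • (x, y) ∈ piSquare) :
    rescaledDensity n (x, y) = n * chordSq ((√(n : ℝ))⁻¹ * x) * (n * chordSq ((√(n : ℝ))⁻¹ * y)) *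
      (n * chordSq ((√(n : ℝ))⁻¹ * (x - y))) *
      (1 + -(chordSq ((√(n : ℝ))⁻¹ * x) + chordSq ((√(n : ℝ))⁻¹ * y) +
        chordSq ((√(n : ℝ))⁻¹ * (x - y))) / 9) ^ n := by
  rw [rescaledDensity, Set.indicator_of_mem h]
  simp only [torusDensity, Prod.smul_mk, smul_eq_mul, ← mul_sub]
  generalize chordSq _ = A
  generalize chordSq _ = B
  generalize chordSq _ = C
  rw [show 9 - (A + B + C) = 9 * (1 + -(A + B + C) / 9) by ring, mul_pow]
  field_simp

lemma norm_rescaledDensity_le {n : ℕ} (hn : 0 < n) (p : ℝ × ℝ) :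
    ‖rescaledDensity n p‖ ≤ dominatingDensity (4 / (9 * Real.pi ^ 2)) p := by
  by_cases hp : (√(n : ℝ))⁻¹ • p ∈ piSquare
  swap
  · rw [rescaledDensity, Set.indicator_of_notMem hp, mul_zero, norm_zero, dominatingDensity]
    positivity
  obtain ⟨x, y⟩ := p
  obtain ⟨hx, hy⟩ := mem_piSquare.1 hp
  rw [rescaledDensity_of_mem hp, dominatingDensity]
  simp only [Prod.smul_mk, smul_eq_mul] at hx hy ⊢
  have h9 := chordSq_add_le_nine ((√(n : ℝ))⁻¹ * x) ((√(n : ℝ))⁻¹ * y)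
  rw [← mul_sub] at h9
  have hA := mul_chordSq_le hn x
  have hB := mul_chordSq_le hn y
  have hC := mul_chordSq_le hn (x - y)
  have hA0 := chordSq_nonneg ((√(n : ℝ))⁻¹ * x)
  have hB0 := chordSq_nonneg ((√(n : ℝ))⁻¹ * y)
  have hC0 := chordSq_nonneg ((√(n : ℝ))⁻¹ * (x - y))
  have hA1 := mul_sq_le_chordSq hx
  have hB1 := mul_sq_le_chordSq hy
  rw [show -(4 / (9 * Real.pi ^ 2)) * (x ^ 2 + y ^ 2) =
      n * (-(4 / (9 * Real.pi ^ 2)) * (((√(n : ℝ))⁻¹ * x) ^ 2 + ((√(n : ℝ))⁻¹ * y) ^ 2)) by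
    rw [← mul_inv_sqrt_mul_sq hn x, ← mul_inv_sqrt_mul_sq hn y]; ring, Real.exp_nat_mul]
  generalize chordSq ((√(n : ℝ))⁻¹ * x) = A at *
  generalize chordSq ((√(n : ℝ))⁻¹ * y) = B at *
  generalize chordSq ((√(n : ℝ))⁻¹ * (x - y)) = C at *
  have hbase : 0 ≤ 1 + -(A + B + C) / 9 := by linarith
  rw [Real.norm_of_nonneg (by positivity)]
  gcongr
  refine le_trans ?_ (Real.add_one_le_exp _)
  rw [show 4 / (9 * Real.pi ^ 2) = 4 / Real.pi ^ 2 / 9 by ring]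
  linarith

lemma tendsto_rescaledDensity (p : ℝ × ℝ) :
    Tendsto (fun n => rescaledDensity n p) atTop (nhds (limitDensity p)) := by
  obtain ⟨x, y⟩ := p
  have hA := tendsto_mul_chordSq x
  have hB := tendsto_mul_chordSq y
  have hC := tendsto_mul_chordSq (x - y)
  have hexp := Real.tendsto_one_add_pow_exp_of_tendsto
    (g := fun n : ℕ => -(chordSq ((√(n : ℝ))⁻¹ * x) + chordSq ((√(n : ℝ))⁻¹ * y) +
      chordSq ((√(n : ℝ))⁻¹ * (x - y))) / 9) (t := -(x ^ 2 + y ^ 2 + (x - y) ^ 2) / 9)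
    ((((hA.add hB).add hC).neg.div_const 9).congr fun n => by ring)
  refine (((hA.mul hB).mul hC).mul hexp).congr' ?_
  have hmem (z : ℝ) : ∀ᶠ n : ℕ in atTop, |(√(n : ℝ))⁻¹ * z| ≤ Real.pi := by
    have := (tendsto_inv_sqrt_mul z).abs
    rw [abs_zero] at this
    exact this.eventually_le_const Real.pi_pos
  filter_upwards [hmem x, hmem y] with n hx hy
  exact (rescaledDensity_of_mem (mem_piSquare.2 ⟨hx, hy⟩)).symm

lemma tendsto_mul_setIntegral_torusDensity :
    Tendsto (fun n : ℕ => (n : ℝ) ^ 4 / 9 ^ n * ∫ p in piSquare, torusDensity n p) atTop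
      (nhds (243 * √3 * Real.pi / 2)) := by
  rw [← integral_limitDensity]
  have h : Tendsto (fun n => ∫ p, rescaledDensity n p) atTop (nhds (∫ p, limitDensity p)) := by
    refine tendsto_integral_filter_of_dominated_convergence
      (dominatingDensity (4 / (9 * Real.pi ^ 2))) (Eventually.of_forall fun n => ?_) ?_
      (integrable_dominatingDensity (by positivity)) (ae_of_all _ tendsto_rescaledDensity)
    · exact ((((continuous_torusDensity n).measurable.indicator
        measurableSet_piSquare).comp (measurable_const_smul _)).const_mul _).aestronglyMeasurable
    · filter_upwards [eventually_gt_atTop 0] with n hn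
      exact ae_of_all _ fun p => norm_rescaledDensity_le hn p
  refine h.congr' ?_
  filter_upwards [eventually_gt_atTop 0] with n hn
  exact (mul_setIntegral_torusDensity hn).symm

/-- The unit `exp (i f)` of the ring of continuous functions on the plane. -/
noncomputable def expUnit (f : C(ℝ × ℝ, ℝ)) : C(ℝ × ℝ, ℂ)ˣ where
  val := ⟨fun p => Complex.exp (f p * Complex.I), by fun_prop⟩
  inv := ⟨fun p => Complex.exp (-(f p * Complex.I)), by fun_prop⟩
  val_inv := by ext p; simp [← Complex.exp_add]
  inv_val := by ext p; simp [← Complex.exp_add]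

lemma expUnit_zpow_apply (f : C(ℝ × ℝ, ℝ)) (k : ℤ) (p : ℝ × ℝ) :
    ((expUnit f ^ k : C(ℝ × ℝ, ℂ)ˣ) : C(ℝ × ℝ, ℂ)) p = Complex.exp (k * (f p * Complex.I)) := by
  have hpow (n : ℕ) : ((expUnit f ^ n : C(ℝ × ℝ, ℂ)ˣ) : C(ℝ × ℝ, ℂ)) p =
      Complex.exp (f p * Complex.I) ^ n := by
    rw [Units.val_pow_eq_pow_val, ContinuousMap.pow_apply]
    rfl
  have hpow' (n : ℕ) : (((expUnit f)⁻¹ ^ n : C(ℝ × ℝ, ℂ)ˣ) : C(ℝ × ℝ, ℂ)) p =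
      Complex.exp (-(f p * Complex.I)) ^ n := by
    rw [Units.val_pow_eq_pow_val, ContinuousMap.pow_apply]
    rfl
  obtain ⟨n, rfl | rfl⟩ := k.eq_nat_or_neg
  · rw [zpow_natCast, hpow, ← Complex.exp_nat_mul, Int.cast_natCast]
  · rw [zpow_neg, zpow_natCast, ← inv_pow, hpow', ← Complex.exp_nat_mul]
    push_cast
    ring_nf

lemma integrableOn_piSquare {E : Type*} [NormedAddCommGroup E] {f : ℝ × ℝ → E}
    (hf : Continuous f) : IntegrableOn f piSquare :=
  hf.continuousOn.integrableOn_compact (isCompact_Icc.prod isCompact_Icc)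

/-- Integration over the square `[-π, π]²`, normalised to have total mass `1`. -/
noncomputable def torusMean : C(ℝ × ℝ, ℂ) →+ ℂ where
  toFun f := (4 * Real.pi ^ 2 : ℂ)⁻¹ * ∫ p in piSquare, f p
  map_zero' := by simp
  map_add' f g := by
    rw [← mul_add, ← integral_add (integrableOn_piSquare f.continuous)
      (integrableOn_piSquare g.continuous)]
    rfl

lemma setIntegral_exp_int_mul (k : ℤ) :
    ∫ x in Set.Icc (-Real.pi) Real.pi, Complex.exp (k * (x * Complex.I)) =
      if k = 0 then (2 * Real.pi : ℂ) else 0 := by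
  rw [integral_Icc_eq_integral_Ioc, ← intervalIntegral.integral_of_le (by linarith [Real.pi_pos])]
  split_ifs with hk
  · simp [hk]
    ring
  · have hc : (k * Complex.I : ℂ) ≠ 0 := by simp [hk]
    have h := integral_exp_mul_complex (a := -Real.pi) (b := Real.pi) hc
    rw [show (fun x : ℝ => Complex.exp (k * (x * Complex.I))) =
      fun x : ℝ => Complex.exp (k * Complex.I * x) by ext x; ring_nf, h, div_eq_zero_iff,
      sub_eq_zero]
    refine Or.inl (Complex.exp_eq_exp_iff_exists_int.2 ⟨k, ?_⟩)
    push_cast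
    ring

lemma torusMean_eval (g : BiLaurent) :
    torusMean (BiLaurent.eval (expUnit ⟨Prod.fst, continuous_fst⟩)
      (expUnit ⟨Prod.snd, continuous_snd⟩) g) = (BiLaurent.constTerm g : ℂ) := by
  refine BiLaurent.map_eval torusMean _ _ (fun i j => ?_) g
  change (4 * Real.pi ^ 2 : ℂ)⁻¹ * ∫ p in piSquare, _ = _
  simp only [Units.val_mul, ContinuousMap.mul_apply, expUnit_zpow_apply, ContinuousMap.coe_mk]
  rw [piSquare, Measure.volume_eq_prod,
    setIntegral_prod_mul (fun x : ℝ => Complex.exp (i * (x * Complex.I)))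
      (fun y : ℝ => Complex.exp (j * (y * Complex.I))),
    setIntegral_exp_int_mul, setIntegral_exp_int_mul]
  have : (Real.pi : ℂ) ≠ 0 := by exact_mod_cast Real.pi_ne_zero
  by_cases hi : i = 0 <;> by_cases hj : j = 0 <;> simp [hi, hj]
  field_simp
  norm_num

lemma eval_vandermondeSq_mul_kernel_pow (n : ℕ) (p : ℝ × ℝ) :
    BiLaurent.eval (expUnit ⟨Prod.fst, continuous_fst⟩) (expUnit ⟨Prod.snd, continuous_snd⟩)
      (BiLaurent.vandermondeSq * BiLaurent.kernel ^ n) p = torusDensity n p := by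
  have hval (f : C(ℝ × ℝ, ℝ)) : (expUnit f : C(ℝ × ℝ, ℂ)) p =
      Real.cos (f p) + Real.sin (f p) * Complex.I := by
    rw [Complex.ofReal_cos, Complex.ofReal_sin, ← Complex.exp_mul_I]
    rfl
  have hinv (f : C(ℝ × ℝ, ℝ)) : (↑(expUnit f)⁻¹ : C(ℝ × ℝ, ℂ)) p =
      Real.cos (f p) - Real.sin (f p) * Complex.I := by
    change Complex.exp (-(f p * Complex.I)) = _
    rw [← neg_mul, Complex.exp_mul_I, Complex.cos_neg, Complex.sin_neg, Complex.ofReal_cos,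
      Complex.ofReal_sin, neg_mul, sub_eq_add_neg]
  simp only [BiLaurent.vandermondeSq, BiLaurent.kernel, map_mul, map_sub, map_add, map_pow,
    map_one, BiLaurent.eval_a, BiLaurent.eval_b, BiLaurent.eval_a_inv, BiLaurent.eval_b_inv,
    ContinuousMap.mul_apply, ContinuousMap.sub_apply, ContinuousMap.add_apply,
    ContinuousMap.pow_apply, ContinuousMap.one_apply, hval, hinv, ContinuousMap.coe_mk,
    torusDensity, chordSq, Real.cos_sub]
  have h1 : (Real.cos p.1 : ℂ) ^ 2 + (Real.sin p.1 : ℂ) ^ 2 = 1 := by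
    exact_mod_cast Real.cos_sq_add_sin_sq p.1
  have h2 : (Real.cos p.2 : ℂ) ^ 2 + (Real.sin p.2 : ℂ) ^ 2 = 1 := by
    exact_mod_cast Real.cos_sq_add_sin_sq p.2
  have hI := Complex.I_sq
  generalize Real.cos p.1 = c at *
  generalize Real.sin p.1 = s at *
  generalize Real.cos p.2 = d at *
  generalize Real.sin p.2 = t at *
  push_cast
  congr 1
  · congr 1
    · congr 1
      · linear_combination h1 - s ^ 2 * hI
      · linear_combination h2 - t ^ 2 * hI
    · linear_combination h1 + h2 - (s - t) ^ 2 * hI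
  · congr 1
    linear_combination h1 + h2 - (s + t) ^ 2 * hI

lemma avoidCount_patt1234_eq_integral (n : ℕ) :
    (avoidCount patt1234 n : ℝ) =
      (24 * Real.pi ^ 2)⁻¹ * ∫ p in piSquare, torusDensity n p := by
  have h1 := avoidCount_patt1234_eq_constTerm n
  have h2 := BiLaurent.constTerm_vandermondeSq_mul_kernel_pow n
  have h3 := torusMean_eval (BiLaurent.vandermondeSq * BiLaurent.kernel ^ n)
  rw [h2, ← h1] at h3
  change (4 * Real.pi ^ 2 : ℂ)⁻¹ * ∫ p in piSquare, _ = _ at h3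
  simp only [eval_vandermondeSq_mul_kernel_pow, integral_complex_ofReal] at h3
  have h4 : (4 * Real.pi ^ 2)⁻¹ * ∫ p in piSquare, torusDensity n p =
      6 * (avoidCount patt1234 n : ℝ) := by exact_mod_cast h3
  linear_combination -h4 / 6

/-- Gessel: `s_n(1234) ~ (81√3/(16π)) ⬝ 9ⁿ ⬝ n⁻⁴` as `n → ∞`. -/
theorem stmt_9 :
    Tendsto (fun n : ℕ =>
        (avoidCount patt1234 n : ℝ) * (16 * Real.pi * (n : ℝ) ^ 4) /
          (81 * Real.sqrt 3 * 9 ^ n))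
      atTop (nhds 1) := by
  have h3 : √(3 : ℝ) ≠ 0 := by positivity
  have hpi := Real.pi_ne_zero
  have h := tendsto_mul_setIntegral_torusDensity.const_mul (2 / (243 * √3 * Real.pi))
  rw [show 2 / (243 * √3 * Real.pi) * (243 * √3 * Real.pi / 2) = 1 by field_simp] at h
  refine h.congr fun n => ?_
  rw [avoidCount_patt1234_eq_integral]
  field_simp
  ring
end
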